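/- Suppose that in a stochastic game each payoff function f_i is bounded, Borel-measurable, and shift-invariant, i.e., f_i(s¹,a¹,s²,a²,s³,a³,…) = f_i(s²,a²,s³,a³,…) for every run. Then for every ε > 0 there is an initial state s ∈ S for which an ε-equilibrium exists. -/

import Mathlib

open scoped ENNReal NNReal Classical

/-- A multiplayer stochastic game: a nonempty finite set of players `I`, a nonempty
countable set of states `S`, nonempty finite action sets `A i`, a transition function
`trans` and bounded Borel payoff functions `payoff i` on runs. -/
structure StochGame where
  I : Type
  S : Type
  A : I → Type
  [fintypeI : Fintype I]
  [nonemptyI : Nonempty I]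
  [countableS : Countable S]
  [nonemptyS : Nonempty S]
  [fintypeA : ∀ i, Fintype (A i)]
  [nonemptyA : ∀ i, Nonempty (A i)]
  trans : S → (∀ i, A i) → PMF S
  payoff : I → S × (ℕ → (∀ i, A i) × S) → ℝ

open MeasureTheory

attribute [instance] StochGame.fintypeI StochGame.nonemptyI StochGame.countableS
  StochGame.nonemptyS StochGame.fintypeA StochGame.nonemptyA

namespace StochGame

variable (G : StochGame)

noncomputable instance : DecidableEq G.I := Classical.decEq _

noncomputable instance (i : G.I) : DecidableEq (G.A i) := Classical.decEq _

/-- Action profiles. -/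
abbrev ActionProfile := ∀ i, G.A i

/-- Runs `(s¹,a¹,s²,a²,…)`, encoded as an initial state together with a sequence of
(action profile, next state) pairs. -/
abbrev Run := G.S × (ℕ → G.ActionProfile × G.S)

/-- Histories `(s¹,a¹,…,s^n)`, encoded as an initial state together with a finite list of
(action profile, next state) pairs. -/
abbrev History := G.S × List (G.ActionProfile × G.S)

instance : MeasurableSpace G.S := ⊤
instance : MeasurableSpace G.ActionProfile := ⊤

variable {G}

/-- The final state `s_h` of a history. -/
def lastState (h : G.History) : G.S := h.2.getLast?.elim h.1 Prod.snd

/-- The stage (length) of a history: a history `(s¹,a¹,…,s^n)` is in stage `n`. -/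
def stage (h : G.History) : ℕ := h.2.length + 1

/-- The history obtained by appending one action profile and one state. -/
def snocH (h : G.History) (a : G.ActionProfile) (s : G.S) : G.History :=
  (h.1, h.2 ++ [(a, s)])

/-- The history obtained by appending a finite list of (action profile, state) pairs. -/
def catH (h : G.History) (l : List (G.ActionProfile × G.S)) : G.History := (h.1, h.2 ++ l)

/-- The history in stage 1 consisting of the initial state `s` only. -/
def initH (G : StochGame) (s : G.S) : G.History := (s, [])

/-- All transitions along the list have positive probability when starting from `s`. -/
def ValidFrom (G : StochGame) : G.S → List (G.ActionProfile × G.S) → Prop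
  | _, [] => True
  | s, (a, t) :: l => G.trans s a t ≠ 0 ∧ ValidFrom G t l

/-- A history belongs to the set `H` of histories of the game iff all its transitions have
positive probability. -/
def Valid (h : G.History) : Prop := ValidFrom G h.1 h.2

/-- `Ext h h'` means that the history `h'` extends the history `h` (possibly `h = h'`),
written `h ⪯ h'` in the paper. -/
def Ext (h h' : G.History) : Prop := h.1 = h'.1 ∧ h.2 <+: h'.2

/-- A behavior strategy of player `i`: a mixed action at every history. -/
abbrev Strategy (G : StochGame) (i : G.I) := G.History → PMF (G.A i)

/-- A strategy profile: one behavior strategy for each player. -/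
abbrev Profile (G : StochGame) := ∀ i, G.Strategy i

/-- The probability, under the strategy profile `σ`, that after the history `h` play continues
exactly along the finite continuation `l`. -/
noncomputable def contProb (σ : G.Profile) : G.History → List (G.ActionProfile × G.S) → ℝ≥0∞
  | _, [] => 1
  | h, (a, s) :: l =>
      (∏ i, σ i h (a i)) * G.trans (lastState h) a s * contProb σ (snocH h a s) l

/-- The cylinder set `C(h)` of all runs extending the history `h`. -/
def cyl (h : G.History) : Set G.Run :=
  {r | r.1 = h.1 ∧ ∀ k, (hk : k < h.2.length) → r.2 k = h.2.get ⟨k, hk⟩}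

/-- `P` is the family of probability measures `P_{h,σ}` on runs induced, via the
Ionescu-Tulcea/Kolmogorov extension, by a history `h` and a strategy profile `σ`:
each `P h σ` is a probability measure, and the measure of the cylinder set of any finite
extension of `h` is the product of the transition probabilities prescribed by `σ` and `p`.
(These properties determine `P h σ` uniquely, since `P h σ (cyl h) = 1`.) -/
def IsInducedFamily (G : StochGame) (P : G.History → G.Profile → Measure G.Run) : Prop :=
  (∀ h σ, IsProbabilityMeasure (P h σ)) ∧
    ∀ (h : G.History) (σ : G.Profile) (l : List (G.ActionProfile × G.S)),
      P h σ (cyl (catH h l)) = contProb σ h l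

/-- The expected payoff `E_{h,σ}[f_i]` of player `i` in the subgame at `h` under `σ`. -/
noncomputable def expPay (P : G.History → G.Profile → Measure G.Run) (h : G.History)
    (σ : G.Profile) (i : G.I) : ℝ :=
  ∫ r, G.payoff i r ∂(P h σ)

/-- The minmax value `v̄_i(h)` of player `i` at the history `h`. -/
noncomputable def minmaxVal (P : G.History → G.Profile → Measure G.Run) (i : G.I)
    (h : G.History) : ℝ :=
  ⨅ σ : G.Profile, ⨆ τ : G.Strategy i, expPay P h (Function.update σ i τ) i

/-- The maxmin value `v̲_i(h)` of player `i` at the history `h`. -/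
noncomputable def maxminVal (P : G.History → G.Profile → Measure G.Run) (i : G.I)
    (h : G.History) : ℝ :=
  ⨆ τ : G.Strategy i, ⨅ σ : G.Profile, expPay P h (Function.update σ i τ) i

/-- `E[D | h, x]`: the expected value of `D` at the next history, when at history `h` the
players use the mixed action profile `x` and the next state is drawn according to `p`. -/
noncomputable def oneShotExp (D : G.History → ℝ) (h : G.History) (x : ∀ i, PMF (G.A i)) : ℝ :=
  ∑ a : G.ActionProfile, (∏ i, (x i (a i)).toReal) *
    ∑' s : G.S, (G.trans (lastState h) a s).toReal * D (snocH h a s)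

/-- The minmax value `v̄_{O,i}(D,h)` of player `i` in the one-shot game `G_O(D,h)`. -/
noncomputable def oneShotMinmax (D : G.History → ℝ) (i : G.I) (h : G.History) : ℝ :=
  ⨅ x : ∀ j, PMF (G.A j), ⨆ y : PMF (G.A i), oneShotExp D h (Function.update x i y)

/-- The maxmin value `v̲_{O,i}(D,h)` of player `i` in the one-shot game `G_O(D,h)`. -/
noncomputable def oneShotMaxmin (D : G.History → ℝ) (i : G.I) (h : G.History) : ℝ :=
  ⨆ y : PMF (G.A i), ⨅ x : ∀ j, PMF (G.A j), oneShotExp D h (Function.update x i y)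

end StochGame

namespace StochGame

variable {G : StochGame}

/-- The state of a run at stage `k+1` (so `stateAt r 0 = s¹`). -/
def stateAt (r : G.Run) : ℕ → G.S
  | 0 => r.1
  | k + 1 => (r.2 k).2

/-- A run belongs to the set `𝓡` of runs of the game iff all its transitions have positive
probability. -/
def RunValid (r : G.Run) : Prop :=
  ∀ k : ℕ, G.trans (stateAt r k) (r.2 k).1 (r.2 k).2 ≠ 0

/-- The shift of a run: `(s¹,a¹,s²,a²,s³,…) ↦ (s²,a²,s³,…)`. -/
def shiftRun (r : G.Run) : G.Run := ((r.2 0).2, fun k => r.2 (k + 1))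

end StochGame

section
open scoped ENNReal NNReal Classical

namespace BDet

/-- Reversed prefix of length `n` of a sequence. -/
def pre {M : Type} (x : ℕ → M) : ℕ → List M
  | 0 => []
  | n + 1 => x n :: pre x n

@[simp] theorem pre_length {M : Type} (x : ℕ → M) (n : ℕ) : (pre x n).length = n := by
  induction n with
  | zero => rfl
  | succ n ih => simp [pre, ih]

theorem pre_map {M N : Type} (f : M → N) (x : ℕ → M) (n : ℕ) :
    (pre x n).map f = pre (fun k => f (x k)) n := by
  induction n with
  | zero => rfl
  | succ n ih => simp [pre, ih]

theorem pre_suffix {M : Type} (x : ℕ → M) {m n : ℕ} (h : m ≤ n) : pre x m <:+ pre x n := by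
  induction n, h using Nat.le_induction with
  | base => exact List.suffix_rfl
  | succ n _ ih => exact ih.trans (List.suffix_cons _ _)

theorem eq_pre_of_suffix {M : Type} (x : ℕ → M) {u : List M} {n : ℕ} (h : u <:+ pre x n) :
    u = pre x u.length ∧ u.length ≤ n := by
  have hl : u.length ≤ n := by simpa using h.length_le
  exact ⟨(List.suffix_of_suffix_length_le h (pre_suffix x hl) (by simp)).eq_of_length (by simp), hl⟩

theorem pre_eq_of_le {M : Type} {x y : ℕ → M} {m n : ℕ} (h : m ≤ n) (e : pre x n = pre y n) :
    pre x m = pre y m := by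
  have := eq_pre_of_suffix y (n := n) (u := pre x m) (e ▸ pre_suffix x h)
  simpa using this.1

/-- A pruned game tree; positions are reversed lists of moves. -/
structure Arena where
  M : Type
  T : Set (List M)
  nil_mem : [] ∈ T
  tail_mem : ∀ m p, m :: p ∈ T → p ∈ T
  ext : ∀ p ∈ T, ∃ m, m :: p ∈ T

namespace Arena
variable (G : Arena)

theorem suffix_mem {p q : List G.M} (h : p <:+ q) (hq : q ∈ G.T) : p ∈ G.T := by
  induction q with
  | nil => simpa [List.suffix_nil.1 h] using hq
  | cons m q ih =>
    rcases List.suffix_cons_iff.1 h with h | h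
    · exact h ▸ hq
    · exact ih h (G.tail_mem _ _ hq)

instance : Nonempty G.M := ⟨(G.ext [] G.nil_mem).choose⟩

def IsRun (x : ℕ → G.M) : Prop := ∀ n, pre x n ∈ G.T
def Legal (σ : List G.M → G.M) : Prop := ∀ p ∈ G.T, σ p :: p ∈ G.T

/-- some legal move -/
noncomputable def dflt (p : List G.M) : G.M :=
  if h : ∃ m, m :: p ∈ G.T then h.choose else Classical.arbitrary _

theorem dflt_legal : G.Legal G.dflt := by
  intro p hp
  have h := G.ext p hp
  simp only [dflt, h, dif_pos]
  exact h.choose_spec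

/-- The set `A` of runs is clopen relative to the arena. -/
def Decided (A : Set (ℕ → G.M)) : Prop :=
  ∀ x, G.IsRun x → ∃ n, ∀ y, G.IsRun y → pre y n = pre x n → (x ∈ A ↔ y ∈ A)

end Arena

/-- `x` is consistent with the strategy `σ` of player `b`. -/
def Cons {M : Type} (b : Bool) (σ : List M → M) (x : ℕ → M) : Prop :=
  ∀ n, n.bodd = b → x n = σ (pre x n)

/-- Coverings in the sense of Martin. -/
structure Cov (k : ℕ) (H G : Arena) where
  π : H.M → G.M
  map_mem : ∀ p ∈ H.T, p.map π ∈ G.T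
  lift : ∀ p ∈ G.T, p.length ≤ k → ∃ q ∈ H.T, q.map π = p
  uniq : ∀ q ∈ H.T, ∀ q' ∈ H.T, q.length ≤ k → q.map π = q'.map π → q = q'
  φ : Bool → (List H.M → H.M) → (List G.M → G.M)
  legal : ∀ b σ, H.Legal σ → G.Legal (φ b σ)
  dep : ∀ b σ σ', ∀ n, (∀ p ∈ H.T, p.length ≤ n → σ p = σ' p) →
    ∀ p ∈ G.T, p.length ≤ n → φ b σ p = φ b σ' p
  loc : ∀ b σ, H.Legal σ → ∀ q ∈ H.T, q.length < k → φ b σ (q.map π) = π (σ q)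
  runs : ∀ b σ, H.Legal σ → ∀ x, G.IsRun x → Cons b (φ b σ) x →
    ∃ y, H.IsRun y ∧ Cons b σ y ∧ ∀ n, π (y n) = x n

namespace Cov

def id (k : ℕ) (G : Arena) : Cov k G G where
  π := fun m => m
  map_mem := by simp
  lift := fun p hp _ => ⟨p, hp, by simp⟩
  uniq := by simp
  φ := fun _ σ => σ
  legal := fun _ _ h => h
  dep := fun _ _ _ n h p hp hl => h p hp hl
  loc := by simp
  runs := fun _ σ _ x hx hc => ⟨x, hx, hc, fun _ => rfl⟩

def comp {k : ℕ} {K H G : Arena} (d : Cov k K H) (c : Cov k H G) : Cov k K G where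
  π := fun m => c.π (d.π m)
  map_mem := fun p hp => by
    have := c.map_mem _ (d.map_mem p hp)
    simpa [List.map_map, Function.comp_def] using this
  lift := fun p hp hl => by
    obtain ⟨q, hq, rfl⟩ := c.lift p hp hl
    obtain ⟨r, hr, rfl⟩ := d.lift q hq (by simpa using hl)
    exact ⟨r, hr, by simp [Function.comp_def]⟩
  uniq := fun q hq q' hq' hl h => by
    refine d.uniq q hq q' hq' hl (c.uniq _ (d.map_mem _ hq) _ (d.map_mem _ hq') (by simpa) ?_)
    simpa [List.map_map, Function.comp_def] using h
  φ := fun b σ => c.φ b (d.φ b σ)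
  legal := fun b σ h => c.legal _ _ (d.legal _ _ h)
  dep := fun b σ σ' n h p hp hl =>
    c.dep b _ _ n (fun q hq hlq => d.dep b σ σ' n h q hq hlq) p hp hl
  loc := fun b σ hσ q hq hl => by
    have h1 := c.loc b _ (d.legal b _ hσ) (q.map d.π) (d.map_mem q hq) (by simpa)
    rw [d.loc b σ hσ q hq hl] at h1
    simpa [List.map_map, Function.comp_def] using h1
  runs := fun b σ hσ x hx hc => by
    obtain ⟨y, hy, hyc, hxy⟩ := c.runs b _ (d.legal b _ hσ) x hx hc
    obtain ⟨z, hz, hzc, hyz⟩ := d.runs b _ hσ y hy hyc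
    exact ⟨z, hz, hzc, fun n => by rw [hyz, hxy]⟩

theorem isRun {k : ℕ} {H G : Arena} (c : Cov k H G) {y : ℕ → H.M} (hy : H.IsRun y) :
    G.IsRun (fun n => c.π (y n)) := fun n => by
  rw [← pre_map]; exact c.map_mem _ (hy n)

theorem decided {k : ℕ} {H G : Arena} (c : Cov k H G) {A : Set (ℕ → G.M)} (hA : G.Decided A) :
    H.Decided ((fun y n => c.π (y n)) ⁻¹' A) := by
  intro x hx
  obtain ⟨n, hn⟩ := hA _ (c.isRun hx)
  refine ⟨n, fun y hy h => hn _ (c.isRun hy) ?_⟩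
  rw [← pre_map c.π y, ← pre_map c.π x, h]

end Cov

theorem thread {M : ℕ → Type} [∀ i, Nonempty (M i)] (π : ∀ i, M (i + 1) → M i)
    (P : ∀ i, M i → Prop) (down : ∀ i m, P (i + 1) m → P i (π i m)) (j : ℕ)
    (up : ∀ i, j ≤ i → ∀ m, P i m → ∃ m', π i m' = m ∧ P (i + 1) m') (m : M j) (hm : P j m) :
    ∃ μ : ∀ i, M i, (∀ i, π i (μ (i + 1)) = μ i) ∧ μ j = m ∧ ∀ i, P i (μ i) := by
  have h1 : ∀ (j : ℕ) (m : M j), P j m → ∃ ν : ∀ i, M i, ν j = m ∧ (∀ i, i < j → π i (ν (i + 1)) = ν i)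
      ∧ ∀ i, i ≤ j → P i (ν i) := by
    intro j
    induction j with
    | zero =>
      intro m hm
      refine ⟨Function.update (fun i => Classical.arbitrary _) 0 m, by simp, by simp, ?_⟩
      intro i hi
      obtain rfl : i = 0 := by omega
      simpa
    | succ j ih =>
      intro m hm
      obtain ⟨ν, h1, h2, h3⟩ := ih (π j m) (down _ _ hm)
      refine ⟨Function.update ν (j + 1) m, by simp, ?_, ?_⟩
      · intro i hi
        rcases Nat.lt_succ_iff_lt_or_eq.1 hi with h | rfl
        · rw [Function.update_of_ne (by omega), Function.update_of_ne (by omega), h2 i h]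
        · simp [h1]
      · intro i hi
        rcases Nat.le_succ_iff.1 hi with h | rfl
        · rw [Function.update_of_ne (by omega)]; exact h3 i h
        · simpa
  obtain ⟨ν, h1, h2, h3⟩ := h1 j m hm
  have hg : ∀ i (m : M i), ∃ m' : M (i + 1), j ≤ i → P i m → π i m' = m ∧ P (i + 1) m' := by
    intro i m
    by_cases h : j ≤ i ∧ P i m
    · obtain ⟨m', hm'⟩ := up i h.1 m h.2
      exact ⟨m', fun _ _ => hm'⟩
    · exact ⟨Classical.arbitrary _, fun a b => absurd ⟨a, b⟩ h⟩
  choose g hg using hg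
  let μ : ∀ i, M i := fun i => Nat.rec (motive := fun i => M i) (ν 0)
    (fun i r => if i + 1 ≤ j then ν (i + 1) else g i r) i
  have μs : ∀ i, μ (i + 1) = if i + 1 ≤ j then ν (i + 1) else g i (μ i) := fun i => rfl
  have hle : ∀ i, i ≤ j → μ i = ν i := by
    intro i hi
    cases i with
    | zero => rfl
    | succ i => rw [μs, if_pos hi]
  have hP : ∀ i, P i (μ i) := by
    intro i
    induction i with
    | zero => exact h3 0 (Nat.zero_le _)
    | succ i ih =>
      by_cases h : i + 1 ≤ j
      · rw [hle _ h]; exact h3 _ h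
      · rw [μs, if_neg h]
        exact (hg i (μ i) (by omega) ih).2
  refine ⟨μ, fun i => ?_, by rw [hle j le_rfl, h1], hP⟩
  by_cases h : i + 1 ≤ j
  · rw [hle _ h, hle i (by omega), h2 i (by omega)]
  · rw [μs, if_neg h]
    exact (hg i (μ i) (by omega) (hP i)).1

end BDet
end

section
open scoped ENNReal NNReal Classical

namespace BDet
namespace Lim
variable {k0 : ℕ} {G : ℕ → Arena} (c : ∀ i, Cov (k0 + i) (G (i + 1)) (G i))

/-- Moves of the limit arena. -/
def LM : Type := {m : ∀ i, (G i).M // ∀ i, (c i).π (m (i + 1)) = m i}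

def ev (i : ℕ) (m : LM c) : (G i).M := m.1 i

theorem ev_succ (i : ℕ) (m : LM c) : (c i).π (ev c (i + 1) m) = ev c i m := m.2 i

def LT : Set (List (LM c)) := {p | ∀ i, p.map (ev c i) ∈ (G i).T}

theorem map_ev (i : ℕ) (p : List (LM c)) :
    (p.map (ev c (i + 1))).map (c i).π = p.map (ev c i) := by
  simp [Function.comp_def, ev_succ]

theorem extend {j : ℕ} {p : List (LM c)} (hp : p ∈ LT c) (hl : p.length + 1 ≤ k0 + j)
    (m : (G j).M) (hm : m :: p.map (ev c j) ∈ (G j).T) :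
    ∃ μ : LM c, ev c j μ = m ∧ μ :: p ∈ LT c := by
  obtain ⟨μ, h1, h2, h3⟩ := thread (fun i => (c i).π)
    (fun i m => m :: p.map (ev c i) ∈ (G i).T)
    (fun i m h => by
      have := (c i).map_mem _ h
      rwa [List.map_cons, map_ev] at this) j
    (fun i hi m h => by
      obtain ⟨q, hq, e⟩ := (c i).lift _ h (by simp; omega)
      cases q with
      | nil => simp at e
      | cons m' q =>
        simp only [List.map_cons, List.cons.injEq] at e
        refine ⟨m', e.1, ?_⟩
        have : q = p.map (ev c (i + 1)) := by
          refine (c i).uniq q ((G (i+1)).tail_mem _ _ hq) _ (hp (i + 1)) ?_ ?_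
          · have := congrArg List.length e.2
            simp at this; omega
          · rw [e.2, map_ev]
        exact this ▸ hq) m hm
  exact ⟨⟨μ, h1⟩, h2, h3⟩

theorem lift_lim (j : ℕ) (q : List (G j).M) (hq : q ∈ (G j).T) (hl : q.length ≤ k0 + j) :
    ∃ p ∈ LT c, p.map (ev c j) = q := by
  induction q with
  | nil => exact ⟨[], fun i => (G i).nil_mem, rfl⟩
  | cons m q ih =>
    obtain ⟨p, hp, rfl⟩ := ih ((G j).tail_mem _ _ hq) (by simp at hl; omega)
    obtain ⟨μ, h1, h2⟩ := extend c hp (by simpa using hl) m hq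
    exact ⟨μ :: p, h2, by simp [h1]⟩

theorem eq_of_map (p p' : List (LM c)) (h : ∀ i, p.map (ev c i) = p'.map (ev c i)) : p = p' := by
  induction p generalizing p' with
  | nil => have := h 0; simp at this; exact this.symm
  | cons m p ih =>
    cases p' with
    | nil => have := h 0; simp at this
    | cons m' p' =>
      simp only [List.map_cons, List.cons.injEq] at h
      rw [ih p' fun i => (h i).2]
      congr 1
      exact Subtype.ext (funext fun i => (h i).1)

theorem uniq_lim (j : ℕ) (p p' : List (LM c)) (hp : p ∈ LT c) (hp' : p' ∈ LT c)
    (hl : p.length ≤ k0 + j) (h : p.map (ev c j) = p'.map (ev c j)) : p = p' := by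
  apply eq_of_map
  have hup : ∀ i, j ≤ i → p.map (ev c i) = p'.map (ev c i) := by
    intro i hi
    induction i, hi using Nat.le_induction with
    | base => exact h
    | succ i hi ih =>
      exact (c i).uniq _ (hp _) _ (hp' _) (by simp; omega) (by rw [map_ev, map_ev, ih])
  intro i
  by_cases hi : j ≤ i
  · exact hup i hi
  · have hdown : ∀ d, ∀ i, i + d = j → p.map (ev c i) = p'.map (ev c i) := by
      intro d
      induction d with
      | zero => rintro i rfl; exact h
      | succ d ih =>
        intro i hi
        rw [← map_ev c i p, ← map_ev c i p', ih (i + 1) (by omega)]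
    exact hdown (j - i) i (by omega)

abbrev LA : Arena where
  M := LM c
  T := LT c
  nil_mem := fun i => (G i).nil_mem
  tail_mem := fun m p h i => (G i).tail_mem _ _ (h i)
  ext := fun p hp => by
    obtain ⟨m, hm⟩ := (G (p.length + 1)).ext _ (hp (p.length + 1))
    obtain ⟨μ, -, h⟩ := extend c hp (by omega) m hm
    exact ⟨μ, h⟩

noncomputable def ρ (σ : List (LM c) → LM c) (j : ℕ) (q : List (G j).M) : (G j).M :=
  if h : ∃ p ∈ LT c, p.map (ev c j) = q then ev c j (σ h.choose) else (G j).dflt q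

theorem ρ_eq (σ : List (LM c) → LM c) (j : ℕ) (p : List (LM c)) (hp : p ∈ LT c)
    (hl : p.length ≤ k0 + j) : ρ c σ j (p.map (ev c j)) = ev c j (σ p) := by
  have h : ∃ p' ∈ LT c, p'.map (ev c j) = p.map (ev c j) := ⟨p, hp, rfl⟩
  rw [ρ, dif_pos h]
  congr 2
  exact (uniq_lim c j p _ hp h.choose_spec.1 hl h.choose_spec.2.symm).symm

theorem ρ_legal {σ : List (LM c) → LM c} (hσ : (LA c).Legal σ) (j : ℕ) :
    (G j).Legal (ρ c σ j) := by
  intro q hq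
  unfold ρ
  split_ifs with h
  · have := hσ _ h.choose_spec.1 j
    rw [List.map_cons, h.choose_spec.2] at this
    exact this
  · exact (G j).dflt_legal q hq

theorem ρ_dep {σ σ' : List (LM c) → LM c} {n : ℕ} (h : ∀ p ∈ LT c, p.length ≤ n → σ p = σ' p)
    (j : ℕ) (q : List (G j).M) (hl : q.length ≤ n) : ρ c σ j q = ρ c σ' j q := by
  unfold ρ
  split_ifs with h'
  · rw [h _ h'.choose_spec.1]
    have := congrArg List.length h'.choose_spec.2
    rw [List.length_map] at this
    omega
  · rfl

noncomputable def AA (b : Bool) (σ : List (LM c) → LM c) :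
    ℕ → ∀ i, List (G i).M → (G i).M
  | 0, i => ρ c σ i
  | d + 1, i => (c i).φ b (AA b σ d (i + 1))

theorem AA_legal (b : Bool) {σ : List (LM c) → LM c} (hσ : (LA c).Legal σ) (d : ℕ) :
    ∀ i, (G i).Legal (AA c b σ d i) := by
  induction d with
  | zero => exact ρ_legal c hσ
  | succ d ih => exact fun i => (c i).legal _ _ (ih _)

theorem AA_dep (b : Bool) {σ σ' : List (LM c) → LM c} {n : ℕ}
    (h : ∀ p ∈ LT c, p.length ≤ n → σ p = σ' p) (d : ℕ) :
    ∀ i, ∀ q ∈ (G i).T, q.length ≤ n → AA c b σ d i q = AA c b σ' d i q := by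
  induction d with
  | zero => exact fun i q _ hl => ρ_dep c h i q hl
  | succ d ih => exact fun i q hq hl => (c i).dep b _ _ n (ih (i + 1)) q hq hl

theorem AA_succ (b : Bool) {σ : List (LM c) → LM c} (hσ : (LA c).Legal σ) (d : ℕ) :
    ∀ i, ∀ q ∈ (G i).T, q.length < k0 + i + d → AA c b σ (d + 1) i q = AA c b σ d i q := by
  induction d with
  | zero =>
    intro i q hq hl
    obtain ⟨p, hp, rfl⟩ := lift_lim c i q hq (by omega)
    simp only [List.length_map] at hl
    have h1 : AA c b σ (0 + 1) i (p.map (ev c i)) = (c i).φ b (ρ c σ (i + 1)) (p.map (ev c i)) := rfl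
    have h2 := (c i).loc b _ (ρ_legal c hσ (i + 1)) (p.map (ev c (i + 1))) (hp _) (by simp; omega)
    rw [map_ev, ρ_eq c σ _ p hp (by omega), ev_succ] at h2
    rw [h1, h2]
    exact (ρ_eq c σ i p hp (by omega)).symm
  | succ d ih =>
    intro i q hq hl
    refine (c i).dep b _ _ q.length ?_ q hq le_rfl
    intro p hp hl'
    exact ih (i + 1) p hp (by omega)

theorem AA_stab (b : Bool) {σ : List (LM c) → LM c} (hσ : (LA c).Legal σ) {d d' : ℕ} (hd : d ≤ d')
    (i : ℕ) (q : List (G i).M) (hq : q ∈ (G i).T) (hl : q.length < k0 + i + d) :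
    AA c b σ d' i q = AA c b σ d i q := by
  induction d', hd using Nat.le_induction with
  | base => rfl
  | succ n hn ih => rw [AA_succ c b hσ n i q hq (by omega), ih]

noncomputable def SS (b : Bool) (σ : List (LM c) → LM c) (i : ℕ) (q : List (G i).M) : (G i).M :=
  AA c b σ (q.length + 1) i q

theorem SS_legal (b : Bool) {σ : List (LM c) → LM c} (hσ : (LA c).Legal σ) (i : ℕ) :
    (G i).Legal (SS c b σ i) := fun q hq => AA_legal c b hσ _ i q hq

theorem SS_step (b : Bool) {σ : List (LM c) → LM c} (hσ : (LA c).Legal σ) (i : ℕ)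
    (q : List (G i).M) (hq : q ∈ (G i).T) :
    (c i).φ b (SS c b σ (i + 1)) q = SS c b σ i q := by
  rw [SS, ← AA_stab c b hσ (Nat.le_succ (q.length + 1)) i q hq (by omega)]
  refine (c i).dep b _ _ q.length ?_ q hq le_rfl
  intro p hp hl
  exact (AA_stab c b hσ (by omega) (i + 1) p hp (by omega)).symm

theorem SS_loc (b : Bool) {σ : List (LM c) → LM c} (hσ : (LA c).Legal σ) (i : ℕ)
    (p : List (LM c)) (hp : p ∈ LT c) (hl : p.length < k0 + i) :
    SS c b σ i (p.map (ev c i)) = ev c i (σ p) := by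
  rw [SS, AA_stab c b hσ (Nat.zero_le _) i _ (hp i) (by simpa), AA, ρ_eq c σ i p hp hl.le]

theorem lim_runs (b : Bool) (σ : List (LM c) → LM c) (hσ : (LA c).Legal σ) (x : ℕ → (G 0).M)
    (hx : (G 0).IsRun x) (hc : Cons b (SS c b σ 0) x) :
    ∃ y : ℕ → LM c, (LA c).IsRun y ∧ Cons b σ y ∧ ∀ n, ev c 0 (y n) = x n := by
  let Q : ∀ i, (ℕ → (G i).M) → Prop := fun i x => (G i).IsRun x ∧ Cons b (SS c b σ i) x
  have step : ∀ i (x : {x // Q i x}), ∃ y : {y // Q (i + 1) y}, ∀ n, (c i).π (y.1 n) = x.1 n := by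
    rintro i ⟨x, h1, h2⟩
    obtain ⟨y, hy1, hy2, hy3⟩ := (c i).runs b _ (SS_legal c b hσ (i + 1)) x h1 (fun n hn => by
      rw [SS_step c b hσ i _ (h1 n)]; exact h2 n hn)
    exact ⟨⟨y, hy1, hy2⟩, hy3⟩
  choose g hg using step
  let X : ∀ i, {x // Q i x} := fun i => Nat.rec (motive := fun i => {x // Q i x}) ⟨x, hx, hc⟩ g i
  have hX : ∀ i n, (c i).π ((X (i + 1)).1 n) = (X i).1 n := fun i n => hg i (X i) n
  let y : ℕ → LM c := fun n => ⟨fun i => (X i).1 n, fun i => hX i n⟩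
  have hpre : ∀ i n, (pre y n).map (ev c i) = pre (X i).1 n := fun i n => pre_map _ _ _
  have hrun : (LA c).IsRun y := fun n i => by rw [hpre]; exact (X i).2.1 n
  refine ⟨y, hrun, ?_, fun n => rfl⟩
  intro n hn
  have key : ∀ d i, n + 1 ≤ i + d → (X i).1 n = ev c i (σ (pre y n)) := by
    intro d
    induction d with
    | zero =>
      intro i hi
      rw [← SS_loc c b hσ i _ (hrun n) (by simp; omega), hpre]
      exact (X i).2.2 n hn
    | succ d ih =>
      intro i hi
      rw [← hX, ih (i + 1) (by omega), ev_succ]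
  exact Subtype.ext (funext fun i => key (n + 1) i (by omega))

noncomputable def cov : Cov k0 (LA c) (G 0) where
  π := ev c 0
  map_mem := fun p hp => hp 0
  lift := fun p hp hl => lift_lim c 0 p hp hl
  uniq := fun q hq q' hq' hl h => uniq_lim c 0 q q' hq hq' hl h
  φ := fun b σ => SS c b σ 0
  legal := fun b σ h => SS_legal c b h 0
  dep := fun b σ σ' n h p hp hl => AA_dep c b h _ 0 p hp hl
  loc := fun b σ hσ q hq hl => SS_loc c b hσ 0 q hq hl
  runs := fun b σ hσ x hx hc => lim_runs c b σ hσ x hx hc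

/-- The sequence of projections from the limit to the arena number `i` maps runs to runs. -/
theorem ev_isRun {y : ℕ → LM c} (hy : (LA c).IsRun y) (i : ℕ) :
    (G i).IsRun (fun n => ev c i (y n)) := fun n => by
  rw [← pre_map]; exact hy n i

theorem ev_decided (i : ℕ) {A : Set (ℕ → (G i).M)} (hA : (G i).Decided A) :
    (LA c).Decided ((fun y n => ev c i (y n)) ⁻¹' A) := by
  intro x hx
  obtain ⟨n, hn⟩ := hA _ (ev_isRun c hx i)
  refine ⟨n, fun y hy h => hn _ (ev_isRun c hy i) ?_⟩
  rw [← pre_map (ev c i) y, ← pre_map (ev c i) x, h]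

end Lim
end BDet
end

section
open scoped ENNReal NNReal Classical

namespace BDet

section lists
variable {M : Type}

/-- the shortest suffix lying in `S` -/
noncomputable def firstIn (S : Set (List M)) : List M → Option (List M)
  | [] => if [] ∈ S then some [] else none
  | m :: r => match firstIn S r with
    | some u => some u
    | none => if m :: r ∈ S then some (m :: r) else none

theorem firstIn_spec {S : Set (List M)} {r u : List M} (h : firstIn S r = some u) :
    u ∈ S ∧ u <:+ r := by
  induction r with
  | nil =>
    simp only [firstIn] at h
    split_ifs at h with h1
    simp only [Option.some.injEq] at h
    subst h; exact ⟨h1, List.suffix_rfl⟩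
  | cons m r ih =>
    simp only [firstIn] at h
    cases hf : firstIn S r with
    | some v =>
      simp only [hf, Option.some.injEq] at h
      subst h
      exact ⟨(ih hf).1, (ih hf).2.trans (List.suffix_cons _ _)⟩
    | none =>
      simp only [hf] at h
      split_ifs at h with h1
      simp only [Option.some.injEq] at h
      subst h; exact ⟨h1, List.suffix_rfl⟩

theorem firstIn_stable {S : Set (List M)} {r r' u : List M} (h : firstIn S r = some u)
    (hr : r <:+ r') : firstIn S r' = some u := by
  induction r' with
  | nil => rw [List.suffix_nil.1 hr] at h; exact h
  | cons m r' ih =>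
    rcases List.suffix_cons_iff.1 hr with e | h'
    · rw [← e]; exact h
    · simp [firstIn, ih h']

theorem firstIn_ne_none {S : Set (List M)} {r u : List M} (hu : u ∈ S) (hr : u <:+ r) :
    firstIn S r ≠ none := by
  have : firstIn S u ≠ none := by
    cases u with
    | nil => simp [firstIn, hu]
    | cons m u =>
      simp only [firstIn]
      cases firstIn S u <;> simp [hu]
  obtain ⟨v, hv⟩ := Option.ne_none_iff_exists'.1 this
  simp [firstIn_stable hv hr]

theorem suffix_step {r u : List M} (h : r <:+ u) (hne : r ≠ u) : ∃ m, m :: r <:+ u := by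
  obtain ⟨t, rfl⟩ := h
  rcases List.eq_nil_or_concat t with rfl | ⟨t', m, rfl⟩
  · simp at hne
  · exact ⟨m, t', by simp⟩

/-- quasi-strategies -/
structure Quasi (b : Bool) (X R : Set (List M)) (p : List M) : Prop where
  sub : R ⊆ X
  root : p ∈ R
  above : ∀ r ∈ R, p <:+ r
  own : ∀ r ∈ R, r.length.bodd = b → ∃ m, m :: r ∈ R
  opp : ∀ r ∈ R, r.length.bodd ≠ b → ∀ m, m :: r ∈ X → m :: r ∈ R

def Win (b : Bool) (X U : Set (List M)) (q : List M) (w : List M → M) : Prop :=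
  (∀ r ∈ X, w r :: r ∈ X) ∧ ∀ x : ℕ → M, pre x q.length = q → (∀ n, q.length ≤ n → pre x n ∈ X) →
    (∀ n, q.length ≤ n → n.bodd = b → x n = w (pre x n)) → ∃ n, q.length ≤ n ∧ pre x n ∈ U

variable {b : Bool} {X U : Set (List M)}

theorem exists_choice (hX : ∀ r ∈ X, ∃ m, m :: r ∈ X) (hne : X.Nonempty) :
    ∃ w : List M → M, ∀ r ∈ X, w r :: r ∈ X := by
  obtain ⟨r0, h0⟩ := hne
  obtain ⟨m0, _⟩ := hX r0 h0
  have : ∀ r, ∃ m, r ∈ X → m :: r ∈ X := fun r => by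
    by_cases h : r ∈ X
    · exact (hX r h).imp fun m h _ => h
    · exact ⟨m0, fun h' => absurd h' h⟩
  choose w hw using this
  exact ⟨w, hw⟩

theorem win_of_mem (hX : ∀ r ∈ X, ∃ m, m :: r ∈ X) {q : List M} (hq : q ∈ X) (hU : q ∈ U) :
    ∃ w, Win b X U q w := by
  obtain ⟨w, hw⟩ := exists_choice hX ⟨q, hq⟩
  exact ⟨w, hw, fun x hx _ _ => ⟨q.length, le_rfl, by rwa [hx]⟩⟩

theorem win_own {q : List M} (hb : q.length.bodd = b) {m : M} (hm : m :: q ∈ X)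
    (h : ∃ w, Win b X U (m :: q) w) : ∃ w, Win b X U q w := by
  obtain ⟨w, h1, h2⟩ := h
  refine ⟨fun r => if r = q then m else w r, fun r hr => ?_, fun x hx hxX hc => ?_⟩
  · dsimp only
    split_ifs with e
    · rw [e]; exact hm
    · exact h1 r hr
  · have e1 : pre x (q.length + 1) = m :: q := by
      have := hc q.length le_rfl hb
      rw [hx] at this
      simp only [if_true] at this
      simp [pre, hx, this]
    obtain ⟨n, hn, hnU⟩ := h2 x (by simpa using e1) (fun n hn => hxX n (by simp at hn; omega))
      (fun n hn hbn => by
        simp only [List.length_cons] at hn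
        rw [hc n (by omega) hbn]
        dsimp only
        rw [if_neg]
        intro e
        have := congrArg List.length e
        simp at this; omega)
    exact ⟨n, by simp at hn; omega, hnU⟩

theorem win_opp (hX : ∀ r ∈ X, ∃ m, m :: r ∈ X) {q : List M} (hq : q ∈ X)
    (h : ∀ m, m :: q ∈ X → ∃ w, Win b X U (m :: q) w) (hb : q.length.bodd ≠ b) :
    ∃ w, Win b X U q w := by
  obtain ⟨w0, hw0⟩ := exists_choice hX ⟨q, hq⟩
  choose W hW using h
  refine ⟨fun r => if h : ∃ m, m :: q ∈ X ∧ m :: q <:+ r then W h.choose h.choose_spec.1 r else w0 r,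
    fun r hr => ?_, fun x hx hxX hc => ?_⟩
  · dsimp only
    split_ifs with e
    · exact (hW e.choose e.choose_spec.1).1 r hr
    · exact hw0 r hr
  · have e1 : pre x (q.length + 1) = x q.length :: q := by simp [pre, hx]
    have hm : x q.length :: q ∈ X := by rw [← e1]; exact hxX _ (by omega)
    obtain ⟨n, hn, hnU⟩ := (hW _ hm).2 x (by simpa using e1)
      (fun n hn => hxX n (by simp at hn; omega))
      (fun n hn hbn => by
        simp only [List.length_cons] at hn
        rw [hc n (by omega) hbn]
        have hs : x q.length :: q <:+ pre x n := by rw [← e1]; exact pre_suffix x hn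
        have hex : ∃ m, m :: q ∈ X ∧ m :: q <:+ pre x n := ⟨_, hm, hs⟩
        dsimp only
        rw [dif_pos hex]
        have : hex.choose = x q.length := by
          have := (List.suffix_of_suffix_length_le hex.choose_spec.2 hs (by simp)).eq_of_length
            (by simp)
          simpa using this
        congr 1)
    exact ⟨n, by simp at hn; omega, hnU⟩

end lists
end BDet
end

section
open scoped ENNReal NNReal Classical

namespace BDet
namespace Unr
variable (G : Arena) (C : Set (List G.M)) (k : ℕ)

/-- moves of the unravelled game -/
abbrev UM : Type := G.M × Set (List G.M)

def exAt {M : Type} (j : ℕ) : List (M × Set (List M)) → Set (List M)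
  | [] => ∅
  | e :: t => if t.length = j then e.2 else exAt j t

def ru (p u : List G.M) : Set (List G.M) := {r | r ∈ G.T ∧ p <:+ r ∧ (r <:+ u ∨ u <:+ r)}

def Lev1 (Y R : Set (List G.M)) (p : List G.M) : Prop :=
  p ∈ Y ∧ ((∃ u ∈ Y, p <:+ u ∧ u ∉ C ∧ R = ru G p u) ∨ (Quasi (!k.bodd) Y R p ∧ R ⊆ C))

def UT : List (UM G) → Prop
  | [] => True
  | e :: t => UT t ∧ e.1 :: t.map Prod.fst ∈ G.T ∧
      (if t.length = k then Quasi k.bodd G.T e.2 (e.1 :: t.map Prod.fst)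
       else if t.length = k + 1 then Lev1 G C k (exAt k t) e.2 (e.1 :: t.map Prod.fst)
       else e.2 = ∅ ∧ (k + 2 ≤ t.length → e.1 :: t.map Prod.fst ∈ exAt (k + 1) t))

variable {G C k}

theorem UT_map {q : List (UM G)} (h : UT G C k q) : q.map Prod.fst ∈ G.T := by
  cases q with
  | nil => exact G.nil_mem
  | cons e t => exact h.2.1

theorem exAt_append {M : Type} {j : ℕ} (t' t : List (M × Set (List M))) (h : j < t.length) :
    exAt j (t' ++ t) = exAt j t := by
  induction t' with
  | nil => rfl
  | cons e t' ih =>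
    have h1 : ((e :: t') ++ t) = e :: (t' ++ t) := rfl
    rw [h1, exAt, if_neg (by simp; omega), ih]

theorem quasi_ext {b : Bool} {Y : Set (List G.M)} {p : List G.M} (h : Quasi b G.T Y p)
    (r : List G.M) (hr : r ∈ Y) : ∃ m, m :: r ∈ Y := by
  by_cases hb : r.length.bodd = b
  · exact h.own r hr hb
  · obtain ⟨m, hm⟩ := G.ext r (h.sub hr)
    exact ⟨m, h.opp r hr hb m hm⟩

theorem quasi_full {b : Bool} {p : List G.M} (hp : p ∈ G.T) :
    Quasi b G.T {r | r ∈ G.T ∧ p <:+ r} p where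
  sub := fun r h => h.1
  root := ⟨hp, List.suffix_rfl⟩
  above := fun r h => h.2
  own := fun r h _ => by
    obtain ⟨m, hm⟩ := G.ext r h.1
    exact ⟨m, hm, h.2.trans (List.suffix_cons _ _)⟩
  opp := fun r h _ m hm => ⟨hm, h.2.trans (List.suffix_cons _ _)⟩

theorem lev1_root {Y R : Set (List G.M)} {p p0 : List G.M} (hq : Quasi k.bodd G.T Y p0)
    (h : Lev1 G C k Y R p) : p ∈ R := by
  rcases h with ⟨h1, ⟨u, hu, hpu, huC, rfl⟩ | ⟨h2, h3⟩⟩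
  · exact ⟨hq.sub h1, List.suffix_rfl, Or.inl hpu⟩
  · exact h2.root

theorem lev1_sub {Y R : Set (List G.M)} {p p0 : List G.M} (hq : Quasi k.bodd G.T Y p0)
    (h : Lev1 G C k Y R p) : R ⊆ G.T := by
  rcases h with ⟨h1, ⟨u, hu, hpu, huC, rfl⟩ | ⟨h2, h3⟩⟩
  · exact fun r hr => hr.1
  · exact h2.sub.trans hq.sub

theorem lev1_ext {Y R : Set (List G.M)} {p p0 : List G.M} (hq : Quasi k.bodd G.T Y p0)
    (h : Lev1 G C k Y R p) (r : List G.M) (hr : r ∈ R) : ∃ m, m :: r ∈ R := by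
  rcases h with ⟨h1, ⟨u, hu, hpu, huC, rfl⟩ | ⟨h2, h3⟩⟩
  · by_cases h' : u <:+ r
    · obtain ⟨m, hm⟩ := G.ext r hr.1
      exact ⟨m, hm, hr.2.1.trans (List.suffix_cons _ _), Or.inr (h'.trans (List.suffix_cons _ _))⟩
    · have h4 := hr.2.2.resolve_right h'
      obtain ⟨m, hm⟩ := suffix_step h4 (fun e => h' (e ▸ List.suffix_rfl))
      exact ⟨m, G.suffix_mem hm (hq.sub hu), hr.2.1.trans (List.suffix_cons _ _), Or.inl hm⟩
  · by_cases hb : r.length.bodd = (!k.bodd)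
    · exact h2.own r hr hb
    · obtain ⟨m, hm⟩ := quasi_ext hq r (h2.sub hr)
      exact ⟨m, h2.opp r hr hb m hm⟩

theorem lev1_exists {Y : Set (List G.M)} {p p0 : List G.M} (hq : Quasi k.bodd G.T Y p0)
    (hp : p ∈ Y) : ∃ R, Lev1 G C k Y R p := by
  by_cases h : ∃ u ∈ Y, p <:+ u ∧ u ∉ C
  · obtain ⟨u, h1, h2, h3⟩ := h
    exact ⟨_, hp, Or.inl ⟨u, h1, h2, h3, rfl⟩⟩
  · push Not at h
    refine ⟨{r | r ∈ Y ∧ p <:+ r}, hp, Or.inr ⟨⟨fun r h => h.1, ⟨hp, List.suffix_rfl⟩,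
      fun r h => h.2, fun r h _ => ?_, fun r h _ m hm => ⟨hm, h.2.trans (List.suffix_cons _ _)⟩⟩,
      fun r hr => h r hr.1 hr.2⟩⟩
    obtain ⟨m, hm⟩ := quasi_ext hq r h.1
    exact ⟨m, hm, h.2.trans (List.suffix_cons _ _)⟩

/-- invariants of positions of the unravelled game -/
theorem UT_inv0 {t : List (UM G)} (h : UT G C k t) (hl : k + 1 ≤ t.length) :
    Quasi k.bodd G.T (exAt k t) ((t.map Prod.fst).drop (t.length - (k + 1))) := by
  induction t with
  | nil => simp at hl
  | cons e t ih =>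
    simp only [List.length_cons] at hl
    by_cases h1 : t.length = k
    · have := h.2.2
      rw [if_pos h1] at this
      simpa [exAt, h1] using this
    · have h2 := ih h.1 (by omega)
      rw [exAt, if_neg h1]
      have e1 : (e :: t).length - (k + 1) = (t.length - (k + 1)) + 1 := by simp; omega
      rw [e1, List.map_cons, List.drop_succ_cons]
      exact h2

theorem UT_inv1 {t : List (UM G)} (h : UT G C k t) (hl : k + 2 ≤ t.length) :
    Lev1 G C k (exAt k t) (exAt (k + 1) t) ((t.map Prod.fst).drop (t.length - (k + 2))) ∧
    t.map Prod.fst ∈ exAt (k + 1) t := by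
  induction t with
  | nil => simp at hl
  | cons e t ih =>
    simp only [List.length_cons] at hl
    by_cases h1 : t.length = k + 1
    · have := h.2.2
      rw [if_neg (by omega), if_pos h1] at this
      have h3 : Lev1 G C k (exAt k (e :: t)) (exAt (k + 1) (e :: t))
        ((e :: t).map Prod.fst) := by simpa [exAt, h1] using this
      refine ⟨by simpa [h1] using h3, lev1_root (UT_inv0 h (by simp; omega)) h3⟩
    · have h2 := ih h.1 (by omega)
      have h3 := h.2.2
      rw [if_neg (by omega), if_neg h1] at h3
      rw [exAt, if_neg (by omega), exAt, if_neg h1]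
      have e1 : (e :: t).length - (k + 2) = (t.length - (k + 2)) + 1 := by simp; omega
      rw [e1, List.map_cons, List.drop_succ_cons]
      exact ⟨h2.1, h3.2 (by omega)⟩

variable (G C k)

abbrev UA : Arena where
  M := UM G
  T := {q | UT G C k q}
  nil_mem := trivial
  tail_mem := fun m p h => h.1
  ext := fun t ht => by
    rcases lt_trichotomy t.length k with h | h | h
    · obtain ⟨m, hm⟩ := G.ext _ (UT_map ht)
      refine ⟨(m, ∅), ht, hm, ?_⟩
      rw [if_neg (by omega), if_neg (by omega)]
      exact ⟨rfl, fun h => by omega⟩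
    · obtain ⟨m, hm⟩ := G.ext _ (UT_map ht)
      refine ⟨(m, {r | r ∈ G.T ∧ (m :: t.map Prod.fst) <:+ r}), ht, hm, ?_⟩
      rw [if_pos h]
      exact quasi_full hm
    · by_cases h1 : t.length = k + 1
      · have h2 := UT_inv0 ht (by omega)
        rw [h1, Nat.sub_self, List.drop_zero] at h2
        obtain ⟨m, hm⟩ := quasi_ext h2 _ h2.root
        obtain ⟨R, hR⟩ := lev1_exists (C := C) h2 hm
        refine ⟨(m, R), ht, h2.sub hm, ?_⟩
        rw [if_neg (by omega), if_pos h1]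
        exact hR
      · have h2 := UT_inv0 ht (by omega)
        have h3 := UT_inv1 ht (by omega)
        obtain ⟨m, hm⟩ := lev1_ext h2 h3.1 _ h3.2
        refine ⟨(m, ∅), ht, lev1_sub h2 h3.1 hm, ?_⟩
        rw [if_neg (by omega), if_neg (by omega)]
        exact ⟨rfl, fun _ => hm⟩

def clo : Set (ℕ → G.M) := {x | ∀ n, pre x n ∈ C}

variable {G C k}

theorem UA_decided (hC : ∀ m p, m :: p ∈ C → p ∈ C) :
    (UA G C k).Decided ((fun y n => (y n).1) ⁻¹' clo G C) := by
  have key : ∀ y, (UA G C k).IsRun y →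
      ((fun n => (y n).1) ∈ clo G C ↔ exAt (k + 1) (pre y (k + 2)) ⊆ C) := by
    intro y hy
    have hex : ∀ n, k + 2 ≤ n → exAt (k + 1) (pre y n) = exAt (k + 1) (pre y (k + 2)) ∧
        exAt k (pre y n) = exAt k (pre y (k + 2)) := by
      intro n hn
      obtain ⟨t, ht⟩ := pre_suffix y hn
      rw [← ht]
      exact ⟨exAt_append _ _ (by simp), exAt_append _ _ (by simp)⟩
    have hin : ∀ n, k + 2 ≤ n → pre (fun n => (y n).1) n ∈ exAt (k + 1) (pre y (k + 2)) := by
      intro n hn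
      have := (UT_inv1 (hy n) (by simpa using hn)).2
      rw [pre_map] at this
      rwa [(hex n hn).1] at this
    have hlev := (UT_inv1 (hy (k + 2)) (by simp)).1
    have hq := UT_inv0 (hy (k + 2)) (by simp)
    constructor
    · intro hA
      rcases hlev with ⟨h1, ⟨u, hu, hpu, huC, hR⟩ | ⟨h2, h3⟩⟩
      · exfalso
        have hl : k + 2 ≤ u.length := by simpa using hpu.length_le
        have h3 := hin u.length hl
        rw [hR] at h3
        have h4 : pre (fun n => (y n).1) u.length = u := by
          rcases h3.2.2 with h | h
          · exact h.eq_of_length (by simp)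
          · exact (h.eq_of_length (by simp)).symm
        exact huC (h4 ▸ hA u.length)
      · exact h3
    · intro hR n
      have h1 : pre (fun n => (y n).1) (n + (k + 2)) ∈ C := hR (hin _ (by omega))
      have : ∀ d, pre (fun n => (y n).1) (n + d) ∈ C → pre (fun n => (y n).1) n ∈ C := by
        intro d
        induction d with
        | zero => exact fun h => h
        | succ d ih => exact fun h => ih (hC _ _ h)
      exact this _ h1
  intro x hx
  refine ⟨k + 2, fun y hy h => ?_⟩
  have := key x hx
  rw [← h] at this
  exact this.trans (key y hy).symm

end Unr
end BDet
end

section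
open scoped ENNReal NNReal Classical

namespace BDet
namespace Unr
variable {G : Arena} {C : Set (List G.M)} {k : ℕ}

/-- the extra component at level `n` -/
noncomputable def ex {M : Type} (k : ℕ) (E : Set (List M) × Set (List M)) (n : ℕ) : Set (List M) :=
  if n = k then E.1 else if n = k + 1 then E.2 else ∅

noncomputable def lft {M : Type} (k : ℕ) (E : Set (List M) × Set (List M)) :
    List M → List (M × Set (List M))
  | [] => []
  | m :: r => (m, ex k E r.length) :: lft k E r

noncomputable def lfr {M : Type} (k : ℕ) (E : Set (List M) × Set (List M)) (x : ℕ → M) (n : ℕ) :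
    M × Set (List M) := (x n, ex k E n)

theorem lft_pre {M : Type} (k : ℕ) (E : Set (List M) × Set (List M)) (x : ℕ → M) (n : ℕ) :
    lft k E (pre x n) = pre (lfr k E x) n := by
  induction n with
  | zero => rfl
  | succ n ih => simp [pre, lft, ih, lfr]

@[simp] theorem lft_length {M : Type} (k : ℕ) (E : Set (List M) × Set (List M)) (r : List M) :
    (lft k E r).length = r.length := by
  induction r with
  | nil => rfl
  | cons m r ih => simp [lft, ih]

@[simp] theorem lft_map {M : Type} (k : ℕ) (E : Set (List M) × Set (List M)) (r : List M) :
    (lft k E r).map Prod.fst = r := by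
  induction r with
  | nil => rfl
  | cons m r ih => simp [lft, ih]

theorem lft_congr {M : Type} {k : ℕ} {E E' : Set (List M) × Set (List M)} {r : List M}
    (h : ∀ n < r.length, ex k E n = ex k E' n) : lft k E r = lft k E' r := by
  induction r with
  | nil => rfl
  | cons m r ih =>
    rw [lft, lft, ih (fun n hn => h n (by simp; omega)), h r.length (by simp)]

theorem lft_small {M : Type} {k : ℕ} (E E' : Set (List M) × Set (List M)) {r : List M}
    (h : r.length ≤ k) : lft k E r = lft k E' r :=
  lft_congr fun n hn => by simp [ex, show n ≠ k by omega, show n ≠ k + 1 by omega]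

theorem lft_mid {M : Type} {k : ℕ} (E E' : Set (List M) × Set (List M)) {r : List M}
    (h : r.length ≤ k + 1) (hE : E.1 = E'.1) : lft k E r = lft k E' r :=
  lft_congr fun n hn => by simp [ex, show n ≠ k + 1 by omega, hE]

theorem exAt_lft {M : Type} (k j : ℕ) (E : Set (List M) × Set (List M)) (r : List M)
    (h : j < r.length) : exAt j (lft k E r) = ex k E j := by
  induction r with
  | nil => simp at h
  | cons m r ih =>
    rw [lft, exAt]
    split_ifs with h1
    · simp at h1; simp [h1]
    · simp at h1; exact ih (by simp at h; omega)

theorem UT_pre {x : ℕ → G.M} {E : Set (List G.M) × Set (List G.M)} {n : ℕ}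
    (h0 : ∀ j ≤ n, pre x j ∈ G.T) (h1 : k + 1 ≤ n → Quasi k.bodd G.T E.1 (pre x (k + 1)))
    (h2 : k + 2 ≤ n → Lev1 G C k E.1 E.2 (pre x (k + 2)))
    (h3 : ∀ j, k + 3 ≤ j → j ≤ n → pre x j ∈ E.2) : UT G C k (lft k E (pre x n)) := by
  induction n with
  | zero => trivial
  | succ n ih =>
    have ih := ih (fun j hj => h0 j (by omega)) (fun h => h1 (by omega)) (fun h => h2 (by omega))
      (fun j hj hj' => h3 j hj (by omega))
    refine ⟨ih, ?_, ?_⟩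
    · simpa [pre] using h0 (n + 1) le_rfl
    · simp only [lft_length, pre_length, lft_map]
      have e : x n :: pre x n = pre x (n + 1) := rfl
      rw [e]
      split_ifs with c1 c2
      · subst c1; simpa [ex] using h1 le_rfl
      · subst c2
        rw [exAt_lft _ _ _ _ (by simp)]
        simpa [ex] using h2 le_rfl
      · refine ⟨by simp [ex, c1, c2], fun h => ?_⟩
        rw [exAt_lft _ _ _ _ (by simp; omega)]
        simpa [ex] using h3 (n + 1) (by omega) le_rfl

theorem UT_small {r : List G.M} (hr : r ∈ G.T) (hl : r.length ≤ k) :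
    UT G C k (lft k (∅, ∅) r) := by
  induction r with
  | nil => trivial
  | cons m r ih =>
    simp only [List.length_cons] at hl
    refine ⟨ih (G.tail_mem _ _ hr) (by omega), by simpa using hr, ?_⟩
    simp only [lft_length]
    rw [if_neg (by omega), if_neg (by omega)]
    exact ⟨by simp [ex, show r.length ≠ k by omega], fun h => by omega⟩

theorem UT_eq_lft {q : List (UM G)} (h : UT G C k q) (hl : q.length ≤ k) :
    q = lft k (∅, ∅) (q.map Prod.fst) := by
  induction q with
  | nil => rfl
  | cons e t ih =>
    simp only [List.length_cons] at hl
    have h3 := h.2.2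
    rw [if_neg (by omega), if_neg (by omega)] at h3
    rw [List.map_cons, lft, ← ih h.1 (by omega)]
    congr 1
    refine Prod.ext rfl ?_
    simp [h3.1, ex, show t.length ≠ k by omega]

/-- data for the switching strategy -/
structure Dat (M : Type) where
  X : Set (List M)
  U : Set (List M)
  e : List M → Set (List M) × Set (List M)
  d : Set (List M) × Set (List M)

def WinSet {M : Type} (b : Bool) (X U : Set (List M)) (q : List M) : Set (List M) :=
  {r | q <:+ r ∧ r ∈ X ∧ ∃ w, Win b X U r w}

def Star {M : Type} (b : Bool) (X U : Set (List M)) (q : List M) : Set (List M) :=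
  {r | r ∈ X ∧ q <:+ r ∧ ∀ t, t <:+ r → t ∉ WinSet b X U q}

noncomputable def wst {M : Type} [Nonempty M] (b : Bool) (X U : Set (List M)) (q : List M) : List M → M :=
  if h : ∃ w, Win b X U q w then h.choose else fun _ => Classical.arbitrary M

theorem wst_spec {M : Type} [Nonempty M] {b : Bool} {X U : Set (List M)} {q : List M}
    (h : ∃ w, Win b X U q w) : Win b X U q (wst b X U q) := by
  rw [wst, dif_pos h]; exact h.choose_spec

noncomputable def sw (k : ℕ) (D : Dat G.M) (b : Bool) (q : List G.M) (s : List (UM G) → UM G)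
    (r : List G.M) : G.M :=
  match firstIn D.U r with
  | some u => (s (lft k (D.e u) r)).1
  | none => match firstIn (WinSet b D.X D.U q) r with
    | some q0 => wst b D.X D.U q0 r
    | none => (s (lft k D.d r)).1

variable (G C k)

noncomputable def trunc (n : ℕ) (s : List (UM G) → UM G) (p : List (UM G)) : UM G :=
  if UT G C k p ∧ p.length ≤ n then s p else (Classical.arbitrary G.M, ∅)

/-- base length -/
def bl (b : Bool) : ℕ := if b = k.bodd then k + 2 else k + 1

def UP (Y : Set (List G.M)) (q : List G.M) : Set (List G.M) := {u | u ∈ Y ∧ q <:+ u ∧ u ∉ C}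

def DQ (s : List (UM G) → UM G) (q u : List G.M) (Y : Set (List G.M)) : Prop :=
  Quasi k.bodd G.T Y q ∧ u ∈ Y ∧ u ∉ C ∧ (s (lft k (Y, ∅) q)).1 :: q <:+ u ∧
    (s (lft k (Y, ∅) q)).2 = ru G ((s (lft k (Y, ∅) q)).1 :: q) u

def UQ (s : List (UM G) → UM G) (q : List G.M) : Set (List G.M) := {u | ∃ Y, DQ G C k s q u Y}

noncomputable def YQ (s : List (UM G) → UM G) (q u : List G.M) : Set (List G.M) :=
  if h : ∃ Y, DQ G C k s q u Y then h.choose else ∅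

noncomputable def dat (b : Bool) (s : List (UM G) → UM G) (q : List G.M) : Dat G.M :=
  if b = k.bodd then
    let Y := (s (lft k (∅, ∅) (q.drop 2))).2
    { X := Y
      U := UP G C Y q
      e := fun u => (Y, ru G q u)
      d := (Y, Star b Y (UP G C Y q) q) }
  else
    { X := G.T
      U := UQ G C k s q
      e := fun u => (YQ G C k s q u, (s (lft k (YQ G C k s q u, ∅) q)).2)
      d := (Star b G.T (UQ G C k s q) q, (s (lft k (Star b G.T (UQ G C k s q) q, ∅) q)).2) }

noncomputable def raw (b : Bool) (s : List (UM G) → UM G) (r : List G.M) : G.M :=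
  if r.length ≤ k then (trunc G C k r.length s (lft k (∅, ∅) r)).1
  else sw k (dat G C k b (trunc G C k (min r.length (k + 1)) s) (r.drop (r.length - bl k b))) b
    (r.drop (r.length - bl k b)) (trunc G C k r.length s) r

noncomputable def phi (b : Bool) (s : List (UM G) → UM G) (r : List G.M) : G.M :=
  if raw G C k b s r :: r ∈ G.T then raw G C k b s r else G.dflt r

variable {G C k}

theorem trunc_congr {n m : ℕ} (hm : m ≤ n) {s s' : List (UM G) → UM G}
    (h : ∀ p ∈ (UA G C k).T, p.length ≤ n → s p = s' p) : trunc G C k m s = trunc G C k m s' := by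
  funext p
  unfold trunc
  split_ifs with h1
  · exact h p h1.1 (h1.2.trans hm)
  · rfl

theorem trunc_eq {n : ℕ} {s : List (UM G) → UM G} {p : List (UM G)} (h : UT G C k p)
    (hl : p.length ≤ n) : trunc G C k n s p = s p := by
  rw [trunc, if_pos ⟨h, hl⟩]

theorem phi_legal (b : Bool) (s : List (UM G) → UM G) : G.Legal (phi G C k b s) := by
  intro r hr
  unfold phi
  split_ifs with h
  · exact h
  · exact G.dflt_legal r hr

theorem phi_dep (b : Bool) (s s' : List (UM G) → UM G) (n : ℕ)
    (h : ∀ p ∈ (UA G C k).T, p.length ≤ n → s p = s' p) (r : List G.M) (hl : r.length ≤ n) :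
    phi G C k b s r = phi G C k b s' r := by
  have : raw G C k b s r = raw G C k b s' r := by
    unfold raw
    rw [trunc_congr hl h, trunc_congr ((min_le_left _ _).trans hl) h]
  unfold phi
  rw [this]

theorem phi_loc (b : Bool) (s : List (UM G) → UM G) (hs : (UA G C k).Legal s) (r : List G.M)
    (hr : r ∈ G.T) (hl : r.length ≤ k) : phi G C k b s r = (s (lft k (∅, ∅) r)).1 := by
  have h1 := UT_small (C := C) hr hl
  have h2 : raw G C k b s r = (s (lft k (∅, ∅) r)).1 := by
    rw [raw, if_pos hl, trunc_eq h1 (by simp)]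
  have h3 := UT_map (hs _ h1)
  rw [List.map_cons, lft_map] at h3
  rw [phi, if_pos (by rwa [h2]), h2]

/-- never reaching `U` excludes reaching the winning set -/
theorem no_win {b : Bool} {X U : Set (List G.M)} (hXT : X ⊆ G.T)
    (hopp : ∀ r ∈ X, r.length.bodd ≠ b → ∀ m, m :: r ∈ G.T → m :: r ∈ X) {q : List G.M}
    {x : ℕ → G.M} (hx : G.IsRun x)
    (hc : ∀ n, q.length ≤ n → n.bodd = b → ∀ q0, firstIn (WinSet b X U q) (pre x n) = some q0 →
      wst b X U q0 (pre x n) :: pre x n ∈ G.T → x n = wst b X U q0 (pre x n))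
    (hU : ∀ n, pre x n ∉ U) (n : ℕ) : pre x n ∉ WinSet b X U q := by
  intro hn
  obtain ⟨q0, hq0⟩ := Option.ne_none_iff_exists'.1 (firstIn_ne_none hn List.suffix_rfl)
  obtain ⟨⟨h1, h2, h3⟩, h4⟩ := firstIn_spec hq0
  obtain ⟨e0, hl0⟩ := eq_pre_of_suffix x h4
  have hw := wst_spec h3
  have hst : ∀ m, q0.length ≤ m → firstIn (WinSet b X U q) (pre x m) = some q0 := by
    intro m hm
    rcases le_total n m with h | h
    · exact firstIn_stable hq0 (pre_suffix x h)
    · have hz : q0 <:+ pre x m := by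
        have := pre_suffix x hm
        rwa [← e0] at this
      obtain ⟨q1, hq1⟩ := Option.ne_none_iff_exists'.1
        (firstIn_ne_none (S := WinSet b X U q) ⟨h1, h2, h3⟩ hz)
      have := firstIn_stable hq1 (pre_suffix x h)
      rw [hq0] at this
      rw [hq1, this]
  have hX : ∀ m, q0.length ≤ m → pre x m ∈ X := by
    intro m hm
    induction m, hm using Nat.le_induction with
    | base => rwa [← e0]
    | succ m hm ih =>
      by_cases hb : m.bodd = b
      · have h5 := hw.1 _ ih
        rw [pre, hc m (h1.length_le.trans hm) hb q0 (hst m hm) (hXT h5)]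
        exact h5
      · exact hopp _ ih (by simpa using hb) _ (hx (m + 1))
  obtain ⟨m, hm, hmU⟩ := hw.2 x e0.symm hX (fun m hm hb =>
    hc m (h1.length_le.trans hm) hb q0 (hst m hm) (hXT (hw.1 _ (hX m hm))))
  exact hU m hmU

theorem star_quasi {b : Bool} {X U : Set (List G.M)} {q : List G.M} (hq : q ∈ X)
    (hX : ∀ r ∈ X, ∃ m, m :: r ∈ X) (hw : q ∉ WinSet b X U q) :
    Quasi (!b) X (Star b X U q) q where
  sub := fun r h => h.1
  root := ⟨hq, List.suffix_rfl, fun t ht h => by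
    have := (h.1.eq_of_length (le_antisymm h.1.length_le ht.length_le))
    exact hw (by rw [← this] at h; exact h)⟩
  above := fun r h => h.2.1
  own := fun r h hb => by
    by_contra hcon
    push Not at hcon
    refine h.2.2 r List.suffix_rfl ⟨h.2.1, h.1, win_opp hX h.1 (fun m hm => ?_)
      (by rw [hb]; cases b <;> simp)⟩
    by_contra hno
    refine hcon m ⟨hm, h.2.1.trans (List.suffix_cons _ _), fun t ht htw => ?_⟩
    rcases List.suffix_cons_iff.1 ht with e | ht'
    · rw [e] at htw; exact hno htw.2.2
    · exact h.2.2 t ht' htw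
  opp := fun r h hb m hm => by
    refine ⟨hm, h.2.1.trans (List.suffix_cons _ _), fun t ht htw => ?_⟩
    rcases List.suffix_cons_iff.1 ht with e | ht'
    · rw [e] at htw
      exact h.2.2 r List.suffix_rfl ⟨h.2.1, h.1, win_own (by cases b <;> simpa using hb) hm htw.2.2⟩
    · exact h.2.2 t ht' htw

end Unr
end BDet
end

section
open scoped ENNReal NNReal Classical

namespace BDet
namespace Unr
variable {G : Arena} {C : Set (List G.M)} {k : ℕ}

theorem drop_pre {M : Type} (x : ℕ → M) {m n : ℕ} (h : m ≤ n) :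
    (pre x n).drop (n - m) = pre x m := by
  have := List.suffix_iff_eq_drop.1 (pre_suffix x h)
  simpa using this.symm

theorem firstIn_pre {M : Type} {S : Set (List M)} {x : ℕ → M} {n m : ℕ} {u : List M}
    (h : firstIn S (pre x n) = some u) (hm : u.length ≤ m) : firstIn S (pre x m) = some u := by
  obtain ⟨h1, h4⟩ := firstIn_spec h
  obtain ⟨e0, hl0⟩ := eq_pre_of_suffix x h4
  rcases le_total n m with h' | h'
  · exact firstIn_stable h (pre_suffix x h')
  · have hz : u <:+ pre x m := by
      have := pre_suffix x hm
      rwa [← e0] at this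
    obtain ⟨q1, hq1⟩ := Option.ne_none_iff_exists'.1 (firstIn_ne_none h1 hz)
    have := firstIn_stable hq1 (pre_suffix x h')
    rw [h] at this
    rw [hq1, this]

theorem firstIn_none {M : Type} {S : Set (List M)} {x : ℕ → M} (h : ∀ n, pre x n ∉ S) (n : ℕ) :
    firstIn S (pre x n) = none := by
  by_contra hne
  obtain ⟨u, hu⟩ := Option.ne_none_iff_exists'.1 hne
  obtain ⟨h1, h4⟩ := firstIn_spec hu
  exact h _ ((eq_pre_of_suffix x h4).1 ▸ h1)

section
variable {b : Bool} {s : List (UM G) → UM G} {x : ℕ → G.M}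

theorem finish (hs : (UA G C k).Legal s)
    {E : Set (List G.M) × Set (List G.M)} (hE : ∀ n, UT G C k (lft k E (pre x n)))
    (h1 : ∀ n, n.bodd = b → x n = (s (lft k E (pre x n))).1)
    (h2 : b = k.bodd → (s (lft k E (pre x k))).2 = E.1)
    (h3 : b ≠ k.bodd → (s (lft k E (pre x (k + 1)))).2 = E.2) :
    ∃ y, (UA G C k).IsRun y ∧ Cons b s y ∧ ∀ n, (y n).1 = x n := by
  refine ⟨lfr k E x, fun n => ?_, fun n hn => ?_, fun n => rfl⟩
  · rw [← lft_pre]; exact hE n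
  · rw [← lft_pre]
    refine Prod.ext (h1 n hn) ?_
    have h4 := (hs _ (hE n)).2.2
    simp only [lft_length, pre_length] at h4
    simp only [lfr, ex]
    by_cases c1 : n = k
    · subst c1; rw [if_pos rfl, h2 hn.symm]
    · by_cases c2 : n = k + 1
      · subst c2; rw [if_neg c1, if_pos rfl, h3 (by rw [← hn]; simp)]
      · rw [if_neg c1, if_neg c2] at h4 ⊢
        exact h4.1.symm

theorem legal_fst (hs : (UA G C k).Legal s) {E : Set (List G.M) × Set (List G.M)} {r : List G.M}
    (h : UT G C k (lft k E r)) : (s (lft k E r)).1 :: r ∈ G.T := by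
  have := (hs _ h).2.1
  rwa [lft_map] at this

theorem legal_mem (hs : (UA G C k).Legal s) {E : Set (List G.M) × Set (List G.M)} {r : List G.M}
    (h : UT G C k (lft k E r)) (hr : k + 2 ≤ r.length) : (s (lft k E r)).1 :: r ∈ E.2 := by
  have h4 := (hs _ h).2.2
  simp only [lft_length] at h4
  rw [if_neg (by omega), if_neg (by omega), lft_map, exAt_lft _ _ _ _ (by omega)] at h4
  simpa [ex] using h4.2 hr

theorem forced (hs : (UA G C k).Legal s) {E : Set (List G.M) × Set (List G.M)} {p u : List G.M}
    {m : ℕ} (hu : u = pre x u.length) (hE2 : E.2 = ru G p u) (hE : UT G C k (lft k E (pre x m)))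
    (hm : k + 2 ≤ m) (hmu : m < u.length) : x m = (s (lft k E (pre x m))).1 := by
  have h1 := legal_mem hs hE (by simpa using hm)
  rw [hE2] at h1
  have h2 : (s (lft k E (pre x m))).1 :: pre x m <:+ u := by
    rcases h1.2.2 with h | h
    · exact h
    · rw [h.eq_of_length (le_antisymm h.length_le (by simpa using hmu))]
  rw [hu] at h2
  have := (eq_pre_of_suffix x h2).1
  simp only [List.length_cons, pre_length, pre, List.cons.injEq] at this
  exact this.1.symm

theorem phi_sw (hx : G.IsRun x) (hc : Cons b (phi G C k b s) x) {n : ℕ} (hn : n.bodd = b)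
    (hb : bl k b ≤ n) {z : G.M} (hz : z :: pre x n ∈ G.T)
    (h : sw k (dat G C k b (trunc G C k (k + 1) s) (pre x (bl k b))) b (pre x (bl k b))
      (trunc G C k n s) (pre x n) = z) : x n = z := by
  have hk : k < n := lt_of_lt_of_le (by unfold bl; split_ifs <;> omega) hb
  have hraw : raw G C k b s (pre x n) = z := by
    rw [raw, if_neg (by simpa using hk)]
    simp only [pre_length]
    rw [drop_pre x hb, min_eq_right (by omega), h]
  rw [hc n hn, phi, hraw, if_pos hz]

theorem phi_small (hs : (UA G C k).Legal s) (hx : G.IsRun x) (hc : Cons b (phi G C k b s) x)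
    {n : ℕ} (hn : n.bodd = b) (hl : n ≤ k) (E : Set (List G.M) × Set (List G.M)) :
    x n = (s (lft k E (pre x n))).1 := by
  rw [lft_small E (∅, ∅) (by simpa using hl), hc n hn]
  exact phi_loc b s hs _ (hx n) (by simpa using hl)

theorem phi_U (hs : (UA G C k).Legal s) (hx : G.IsRun x) (hc : Cons b (phi G C k b s) x) {n : ℕ}
    (hn : n.bodd = b) (hb : bl k b ≤ n) {D : Dat G.M}
    (hD : D = dat G C k b (trunc G C k (k + 1) s) (pre x (bl k b))) {u : List G.M}
    (hu : firstIn D.U (pre x n) = some u) (hT : UT G C k (lft k (D.e u) (pre x n))) :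
    x n = (s (lft k (D.e u) (pre x n))).1 := by
  refine phi_sw hx hc hn hb (legal_fst hs hT) ?_
  rw [← hD, sw, hu]
  dsimp only
  rw [trunc_eq hT (by simp)]

theorem phi_W (hs : (UA G C k).Legal s) (hx : G.IsRun x) (hc : Cons b (phi G C k b s) x) {n : ℕ}
    (hn : n.bodd = b) (hb : bl k b ≤ n) {D : Dat G.M}
    (hD : D = dat G C k b (trunc G C k (k + 1) s) (pre x (bl k b))) (hU : ∀ n, pre x n ∉ D.U)
    {q0 : List G.M}
    (hu : firstIn (WinSet b D.X D.U (pre x (bl k b))) (pre x n) = some q0)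
    (hT : wst b D.X D.U q0 (pre x n) :: pre x n ∈ G.T) :
    x n = wst b D.X D.U q0 (pre x n) := by
  refine phi_sw hx hc hn hb hT ?_
  rw [← hD, sw, firstIn_none hU, hu]

theorem phi_d (hs : (UA G C k).Legal s) (hx : G.IsRun x) (hc : Cons b (phi G C k b s) x) {n : ℕ}
    (hn : n.bodd = b) (hb : bl k b ≤ n) {D : Dat G.M}
    (hD : D = dat G C k b (trunc G C k (k + 1) s) (pre x (bl k b))) (hU : ∀ n, pre x n ∉ D.U)
    (hW : ∀ n, pre x n ∉ WinSet b D.X D.U (pre x (bl k b)))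
    (hT : UT G C k (lft k D.d (pre x n))) :
    x n = (s (lft k D.d (pre x n))).1 := by
  refine phi_sw hx hc hn hb (legal_fst hs hT) ?_
  rw [← hD, sw, firstIn_none hU, firstIn_none hW]
  dsimp only
  rw [trunc_eq hT (by simp)]

theorem star_pre {X U : Set (List G.M)} {q : List G.M} {m : ℕ} (hq : q = pre x m)
    (hW : ∀ n, pre x n ∉ WinSet b X U q) {n : ℕ} (hn : m ≤ n) (hX : pre x n ∈ X) :
    pre x n ∈ Star b X U q :=
  ⟨hX, hq ▸ pre_suffix x hn, fun t ht => by rw [(eq_pre_of_suffix x ht).1]; exact hW _⟩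

theorem runs_P (hs : (UA G C k).Legal s) (hx : G.IsRun x) (hb : b = k.bodd)
    (hc : Cons b (phi G C k b s) x) :
    ∃ y, (UA G C k).IsRun y ∧ Cons b s y ∧ ∀ n, (y n).1 = x n := by
  have hbl : bl k b = k + 2 := by rw [bl, if_pos hb]
  obtain ⟨D, hD⟩ : ∃ D, D = dat G C k b (trunc G C k (k + 1) s) (pre x (bl k b)) := ⟨_, rfl⟩
  set q := pre x (k + 2) with hq
  have hk0 := UT_small (C := C) (k := k) (hx k) (by simp)
  set Y := (s (lft k (∅, ∅) (pre x k))).2 with hY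
  have hDD : D = Dat.mk Y (UP G C Y q) (fun u => (Y, ru G q u))
      (Y, Star b Y (UP G C Y q) q) := by
    rw [hD, dat, if_pos hb, hbl]
    have : (trunc G C k (k + 1) s (lft k (∅, ∅) (List.drop 2 (pre x (k + 2))))).2 = Y := by
      have : List.drop 2 (pre x (k + 2)) = pre x k := rfl
      rw [this, trunc_eq hk0 (by simp)]
    rw [this]
  have hxk := phi_small hs hx hc hb.symm le_rfl (∅, ∅)
  have hYq : Quasi k.bodd G.T Y (pre x (k + 1)) := by
    have := (hs _ hk0).2.2
    simp only [lft_length, pre_length, if_pos] at this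
    rw [lft_map, ← hxk] at this
    exact this
  have hqY : q ∈ Y := hYq.opp _ hYq.root (by simp) _ (hx (k + 2))
  have hpar : ∀ n, n.bodd = b → ¬ n ≤ k → k + 2 ≤ n := by
    intro n hn h
    rcases Nat.lt_or_ge n (k + 2) with h' | h'
    · obtain rfl : n = k + 1 := by omega
      rw [hb] at hn; simp at hn
    · exact h'
  have fin : ∀ E : Set (List G.M) × Set (List G.M), E.1 = Y → (∀ n, UT G C k (lft k E (pre x n))) →
      (∀ n, n.bodd = b → k + 2 ≤ n → x n = (s (lft k E (pre x n))).1) →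
      ∃ y, (UA G C k).IsRun y ∧ Cons b s y ∧ ∀ n, (y n).1 = x n := by
    intro E hE1 hE h1
    refine finish hs hE (fun n hn => ?_) (fun _ => ?_) (fun h => absurd hb h)
    · by_cases hnk : n ≤ k
      · exact phi_small hs hx hc hn hnk E
      · exact h1 n hn (hpar n hn hnk)
    · rw [lft_small E (∅, ∅) (by simp), hE1]
  by_cases hU : ∃ n, pre x n ∈ D.U
  · obtain ⟨n0, hn0⟩ := hU
    obtain ⟨u, hu⟩ := Option.ne_none_iff_exists'.1 (firstIn_ne_none hn0 List.suffix_rfl)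
    obtain ⟨h1, h2⟩ := firstIn_spec hu
    obtain ⟨e0, -⟩ := eq_pre_of_suffix x h2
    have h1' : u ∈ UP G C Y q := by rw [hDD] at h1; exact h1
    have hEe : D.e u = (Y, ru G q u) := by rw [hDD]
    have hT : ∀ n, UT G C k (lft k (Y, ru G q u) (pre x n)) := fun n =>
      UT_pre (fun j _ => hx j) (fun _ => hYq)
        (fun _ => ⟨hqY, Or.inl ⟨u, h1'.1, h1'.2.1, h1'.2.2, rfl⟩⟩)
        (fun j hj _ => ⟨hx j, pre_suffix x (by omega), by
          rcases le_total j u.length with h | h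
          · left; rw [e0]; exact pre_suffix x h
          · right; rw [e0]; exact pre_suffix x h⟩)
    refine fin _ rfl hT (fun n hn hk2 => ?_)
    rcases Nat.lt_or_ge n u.length with h | h
    · exact forced hs e0 rfl (hT n) hk2 h
    · have := phi_U hs hx hc hn (by omega) hD (firstIn_pre hu h) (by rw [hEe]; exact hT n)
      rwa [hEe] at this
  · push Not at hU
    have hX : D.X = Y := by rw [hDD]
    have hDU : D.U = UP G C Y q := by rw [hDD]
    have hDd : D.d = (Y, Star b Y (UP G C Y q) q) := by rw [hDD]
    have hW : ∀ n, pre x n ∉ WinSet b D.X D.U (pre x (bl k b)) :=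
      no_win (by rw [hX]; exact hYq.sub) (by rw [hX, hb]; exact hYq.opp) hx
        (fun n hn hbn q0 h0 hT => phi_W hs hx hc hbn (by simpa using hn) hD hU h0 hT) hU
    have hW' : ∀ n, pre x n ∉ WinSet b Y (UP G C Y q) q := by
      rw [hX, hDU, hbl] at hW; exact hW
    have hSQ := star_quasi (G := G) hqY (quasi_ext hYq) (hW' (k + 2))
    have hL : Lev1 G C k Y (Star b Y (UP G C Y q) q) q := by
      refine ⟨hqY, Or.inr ⟨hb ▸ hSQ, fun r hr => ?_⟩⟩
      by_contra hrC
      exact hr.2.2 r List.suffix_rfl ⟨hr.2.1, hr.1, win_of_mem (quasi_ext hYq) hr.1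
        ⟨hr.1, hr.2.1, hrC⟩⟩
    have hUT : ∀ n, (∀ j, k + 2 ≤ j → j ≤ n → pre x j ∈ Y) →
        UT G C k (lft k (Y, Star b Y (UP G C Y q) q) (pre x n)) := fun n h =>
      UT_pre (fun j _ => hx j) (fun _ => hYq) (fun _ => hL)
        (fun j hj hjn => star_pre hq hW' (by omega) (h j (by omega) hjn))
    have hxn : ∀ n, n.bodd = b → k + 2 ≤ n → (∀ j, k + 2 ≤ j → j ≤ n → pre x j ∈ Y) →
        x n = (s (lft k (Y, Star b Y (UP G C Y q) q) (pre x n))).1 := fun n hn hk2 h => by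
      have := phi_d hs hx hc hn (by omega) hD hU hW (by rw [hDd]; exact hUT n h)
      rwa [hDd] at this
    have hin : ∀ n, ∀ j, k + 2 ≤ j → j ≤ n → pre x j ∈ Y := by
      intro n
      induction n with
      | zero => intro j hj hj'; omega
      | succ n ih =>
        intro j hj hj'
        rcases Nat.lt_or_ge j (n + 1) with h | h
        · exact ih j hj (by omega)
        · obtain rfl : j = n + 1 := by omega
          by_cases h2 : n = k + 1
          · subst h2; exact hqY
          · by_cases hn : n.bodd = b
            · have h3 := legal_mem hs (hUT n ih) (by simp; omega)
              rw [← hxn n hn (by omega) ih] at h3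
              exact h3.1
            · exact hYq.opp _ (ih n (by omega) le_rfl) (by simpa [← hb] using hn) _ (hx (n + 1))
    exact fin _ rfl (fun n => hUT n (hin n)) (fun n hn hk2 => hxn n hn hk2 (hin n))

theorem runs_Q (hs : (UA G C k).Legal s) (hx : G.IsRun x) (hb : b ≠ k.bodd)
    (hc : Cons b (phi G C k b s) x) :
    ∃ y, (UA G C k).IsRun y ∧ Cons b s y ∧ ∀ n, (y n).1 = x n := by
  have hbl : bl k b = k + 1 := by rw [bl, if_neg hb]
  have hb' : (!b) = k.bodd := by revert hb; cases b <;> cases k.bodd <;> simp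
  have hb'' : (!k.bodd) = b := by rw [← hb']; simp
  obtain ⟨D, hD⟩ : ∃ D, D = dat G C k b (trunc G C k (k + 1) s) (pre x (bl k b)) := ⟨_, rfl⟩
  set q := pre x (k + 1) with hq
  set s1 := trunc G C k (k + 1) s with hs1
  have hDD := hD
  rw [dat, if_neg hb, hbl, ← hq] at hDD
  have hUTq : ∀ Y R, Quasi k.bodd G.T Y q → UT G C k (lft k (Y, R) q) := fun Y R hY =>
    UT_pre (fun j _ => hx j) (fun _ => hY) (fun h => by omega) (fun j h h' => by omega)
  have hmid : ∀ Y R, lft k (Y, R) q = lft k (Y, ∅) q := fun Y R =>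
    lft_mid _ _ (by simp [hq]) rfl
  have hs1e : ∀ Y, Quasi k.bodd G.T Y q → s1 (lft k (Y, ∅) q) = s (lft k (Y, ∅) q) := fun Y hY =>
    trunc_eq (hUTq Y ∅ hY) (by simp [hq])
  have fin : ∀ E : Set (List G.M) × Set (List G.M), (∀ n, UT G C k (lft k E (pre x n))) →
      x (k + 1) = (s (lft k E q)).1 → (s (lft k E q)).2 = E.2 →
      (∀ n, n.bodd = b → k + 2 ≤ n → x n = (s (lft k E (pre x n))).1) →
      ∃ y, (UA G C k).IsRun y ∧ Cons b s y ∧ ∀ n, (y n).1 = x n := by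
    intro E hE h0 h2 h1
    refine finish hs hE (fun n hn => ?_) (fun h => absurd h hb) (fun _ => h2)
    by_cases hnk : n ≤ k
    · exact phi_small hs hx hc hn hnk E
    · by_cases h3 : n = k + 1
      · subst h3; exact h0
      · exact h1 n hn (by omega)
  have hXT : ∀ r ∈ G.T, ∃ m, m :: r ∈ G.T := G.ext
  by_cases hU : ∃ n, pre x n ∈ D.U
  · obtain ⟨n0, hn0⟩ := hU
    obtain ⟨u, hu⟩ := Option.ne_none_iff_exists'.1 (firstIn_ne_none hn0 List.suffix_rfl)
    obtain ⟨h1, h2⟩ := firstIn_spec hu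
    obtain ⟨e0, -⟩ := eq_pre_of_suffix x h2
    have h1' : ∃ Y, DQ G C k s1 q u Y := by rw [hDD] at h1; exact h1
    obtain ⟨Y, hYe, hDQ⟩ : ∃ Y, Y = YQ G C k s1 q u ∧ DQ G C k s1 q u Y :=
      ⟨_, rfl, by rw [YQ, dif_pos h1']; exact h1'.choose_spec⟩
    obtain ⟨hYq, huY, huC, hmu, hR⟩ := hDQ
    have hEe : D.e u = (Y, (s1 (lft k (Y, ∅) q)).2) := by rw [hDD, hYe]
    rw [hs1e Y hYq] at hEe hmu hR
    have hm : x (k + 1) = (s (lft k (Y, ∅) q)).1 := by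
      rw [e0] at hmu
      have := (eq_pre_of_suffix x hmu).1
      simp only [List.length_cons, hq, pre_length, pre, List.cons.injEq] at this
      exact this.1.symm
    have hq2 : (s (lft k (Y, ∅) q)).1 :: q = pre x (k + 2) := by rw [← hm]; rfl
    rw [hq2] at hmu hR
    set R := (s (lft k (Y, ∅) q)).2 with hRdef
    have hqY : pre x (k + 2) ∈ Y := hYq.opp _ hYq.root (by simp [hq]) _ (hx (k + 2))
    have hT : ∀ n, UT G C k (lft k (Y, R) (pre x n)) := fun n =>
      UT_pre (fun j _ => hx j) (fun _ => hYq)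
        (fun _ => ⟨hqY, Or.inl ⟨u, huY, hmu, huC, hR⟩⟩)
        (fun j hj _ => by
          show pre x j ∈ R
          rw [hR]
          refine ⟨hx j, pre_suffix x (by omega), ?_⟩
          rcases le_total j u.length with h | h
          · left; rw [e0]; exact pre_suffix x h
          · right; rw [e0]; exact pre_suffix x h)
    refine fin (Y, R) hT ?_ ?_ (fun n hn hk2 => ?_)
    · rw [hmid, hm]
    · rw [hmid]
    rcases Nat.lt_or_ge n u.length with h | h
    · exact forced hs e0 hR (hT n) hk2 h
    · have := phi_U hs hx hc hn (by omega) hD (firstIn_pre hu h) (by rw [hEe]; exact hT n)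
      rwa [hEe] at this
  · push Not at hU
    have hX : D.X = G.T := by rw [hDD]
    have hDU : D.U = UQ G C k s1 q := by rw [hDD]
    set Y := Star b G.T (UQ G C k s1 q) q with hY
    have hDd : D.d = (Y, (s1 (lft k (Y, ∅) q)).2) := by rw [hDD]
    have hW : ∀ n, pre x n ∉ WinSet b D.X D.U (pre x (bl k b)) :=
      no_win (by rw [hX]) (by rw [hX]; exact fun r _ _ m hm => hm) hx
        (fun n hn hbn q0 h0 hT => phi_W hs hx hc hbn (by simpa using hn) hD hU h0 hT) hU
    have hW' : ∀ n, pre x n ∉ WinSet b G.T (UQ G C k s1 q) q := by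
      rw [hX, hDU, hbl] at hW; exact hW
    have hYq : Quasi k.bodd G.T Y q := by
      rw [← hb']; exact star_quasi (G := G) (hx (k + 1)) hXT (hW' (k + 1))
    rw [hs1e Y hYq] at hDd
    set R := (s (lft k (Y, ∅) q)).2 with hRdef
    have hstar : ∀ n, k + 1 ≤ n → pre x n ∈ Y := fun n hn => star_pre hq hW' hn (hx n)
    have hm : x (k + 1) = (s (lft k (Y, ∅) q)).1 := by
      have := phi_d (n := k + 1) hs hx hc (by rw [← hb'']; simp) (by omega) hD hU hW
        (by rw [hDd]; exact hUTq Y R hYq)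
      rw [hDd] at this
      rw [this, ← hmid Y R]
    have hq2 : (s (lft k (Y, ∅) q)).1 :: q = pre x (k + 2) := by rw [← hm]; rfl
    have hL : Lev1 G C k Y R (pre x (k + 2)) := by
      have h4 := (hs (lft k (Y, ∅) q) (hUTq Y ∅ hYq)).2.2
      simp only [lft_length] at h4
      rw [if_neg (by simp [hq]), if_pos (by simp [hq]), lft_map, exAt_lft _ _ _ _ (by simp [hq]), hq2]
        at h4
      simpa [ex] using h4
    have hQ : Quasi b Y R (pre x (k + 2)) := by
      rcases hL with ⟨h1, ⟨u, hu, hpu, huC, hR⟩ | ⟨h2, h3⟩⟩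
      · exfalso
        refine hu.2.2 u List.suffix_rfl ⟨hu.2.1, hu.1, win_of_mem hXT hu.1 ⟨Y, hYq, hu, huC, ?_, ?_⟩⟩
        · rw [hs1e Y hYq, hq2]; exact hpu
        · rw [hs1e Y hYq, hq2]; exact hR
      · rw [← hb'']; exact h2
    have hUT : ∀ n, (∀ j, k + 2 ≤ j → j ≤ n → pre x j ∈ R) →
        UT G C k (lft k (Y, R) (pre x n)) := fun n h =>
      UT_pre (fun j _ => hx j) (fun _ => hYq) (fun _ => hL)
        (fun j hj hjn => h j (by omega) hjn)
    have hxn : ∀ n, n.bodd = b → k + 2 ≤ n → (∀ j, k + 2 ≤ j → j ≤ n → pre x j ∈ R) →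
        x n = (s (lft k (Y, R) (pre x n))).1 := fun n hn hk2 h => by
      have := phi_d hs hx hc hn (by omega) hD hU hW (by rw [hDd]; exact hUT n h)
      rwa [hDd] at this
    have hin : ∀ n, ∀ j, k + 2 ≤ j → j ≤ n → pre x j ∈ R := by
      intro n
      induction n with
      | zero => intro j hj hj'; omega
      | succ n ih =>
        intro j hj hj'
        rcases Nat.lt_or_ge j (n + 1) with h | h
        · exact ih j hj (by omega)
        · obtain rfl : j = n + 1 := by omega
          by_cases h2 : n = k + 1
          · subst h2; exact hQ.root
          · by_cases hn : n.bodd = b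
            · have h3 := legal_mem hs (hUT n ih) (by simp; omega)
              rw [← hxn n hn (by omega) ih] at h3
              exact h3
            · exact hQ.opp _ (ih n (by omega) le_rfl) (by simpa using hn) _ (hstar (n + 1) (by omega))
    refine fin (Y, R) (fun n => hUT n (hin n)) ?_ ?_ (fun n hn hk2 => hxn n hn hk2 (hin n))
    · rw [hmid, hm]
    · rw [hmid]

end

variable (G C k)

noncomputable def cov : Cov k (UA G C k) G where
  π := Prod.fst
  map_mem := fun p hp => UT_map hp
  lift := fun p hp hl => ⟨lft k (∅, ∅) p, UT_small hp hl, lft_map _ _ _⟩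
  uniq := fun q hq q' hq' hl h => by
    have hl' : q'.length = q.length := by
      have := congrArg List.length h
      simpa using this.symm
    rw [UT_eq_lft hq hl, UT_eq_lft hq' (hl'.le.trans hl), h]
  φ := phi G C k
  legal := fun b s _ => phi_legal b s
  dep := fun b s s' n h p _ hl => phi_dep b s s' n h p hl
  loc := fun b s hs q hq hl => by
    rw [phi_loc b s hs _ (UT_map hq) (by rw [List.length_map]; exact hl.le), ← UT_eq_lft hq hl.le]
  runs := fun b s hs x hx hc => by
    by_cases hb : b = k.bodd
    · exact runs_P hs hx hb hc
    · exact runs_Q hs hx hb hc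

end Unr
end BDet
end

section
open scoped ENNReal NNReal Classical
open MeasureTheory

namespace BDet

def Good {M : Type} (A : Set (ℕ → M)) : Prop :=
  ∀ (H : Arena) (π : H.M → M) (k : ℕ), ∃ (H' : Arena) (c : Cov k H' H),
    H'.Decided ((fun y n => π (c.π (y n))) ⁻¹' A)

theorem Arena.Decided.compl {G : Arena} {A : Set (ℕ → G.M)} (h : G.Decided A) : G.Decided Aᶜ := by
  intro x hx
  obtain ⟨n, hn⟩ := h x hx
  exact ⟨n, fun y hy e => not_congr (hn y hy e)⟩

theorem Arena.Decided.congr {G : Arena} {A B : Set (ℕ → G.M)} (h : G.Decided A)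
    (hAB : ∀ x, G.IsRun x → (x ∈ A ↔ x ∈ B)) : G.Decided B := by
  intro x hx
  obtain ⟨n, hn⟩ := h x hx
  exact ⟨n, fun y hy e => (hAB x hx).symm.trans ((hn y hy e).trans (hAB y hy))⟩

/-- sets depending on finitely many coordinates -/
def FinDep (M : Type) : Set (Set (ℕ → M)) :=
  {A | ∃ n, ∀ x y, pre x n = pre y n → (x ∈ A ↔ y ∈ A)}

theorem good_finDep {M : Type} {A : Set (ℕ → M)} (hA : A ∈ FinDep M) : Good A := by
  intro H π k
  refine ⟨H, Cov.id k H, fun x _ => ?_⟩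
  obtain ⟨n, hn⟩ := hA
  refine ⟨n, fun y _ h => hn _ _ ?_⟩
  have h1 := pre_map (fun m => π ((Cov.id k H).π m)) x n
  have h2 := pre_map (fun m => π ((Cov.id k H).π m)) y n
  rw [← h1, ← h2, h]

theorem good_compl {M : Type} {A : Set (ℕ → M)} (hA : Good A) : Good Aᶜ := by
  intro H π k
  obtain ⟨H', c, h⟩ := hA H π k
  exact ⟨H', c, h.compl⟩

theorem good_union {M : Type} {A : ℕ → Set (ℕ → M)} (hA : ∀ i, Good (A i)) : Good (⋃ i, A i) := by
  intro H π k
  choose F c hF using hA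
  let S : ℕ → Σ H : Arena, H.M → M := fun i =>
    Nat.rec (motive := fun _ => Σ H : Arena, H.M → M) ⟨H, π⟩
      (fun i S => ⟨F i S.1 S.2 (k + i), fun m => S.2 ((c i S.1 S.2 (k + i)).π m)⟩) i
  let cc : ∀ i, Cov (k + i) (S (i + 1)).1 (S i).1 := fun i => c i (S i).1 (S i).2 (k + i)
  have hS : ∀ i m, (S (i + 1)).2 m = (S i).2 ((cc i).π m) := fun i m => rfl
  have hdec : ∀ i, (S (i + 1)).1.Decided ((fun y n => (S (i + 1)).2 (y n)) ⁻¹' A i) :=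
    fun i => hF i (S i).1 (S i).2 (k + i)
  have hev : ∀ i (m : Lim.LM (G := fun i => (S i).1) cc),
      (S i).2 (Lim.ev (G := fun i => (S i).1) cc i m) = (S 0).2 (Lim.ev (G := fun i => (S i).1) cc 0 m) := by
    intro i m
    induction i with
    | zero => rfl
    | succ i ih =>
      rw [hS, ← ih]
      exact congrArg (S i).2 (Lim.ev_succ (G := fun i => (S i).1) cc i m)
  let L := Lim.LA (G := fun i => (S i).1) cc
  let A' : ℕ → Set (ℕ → L.M) := fun i => (fun y n => (S 0).2 (Lim.ev (G := fun i => (S i).1) cc 0 (y n))) ⁻¹' A i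
  have hA' : ∀ i, L.Decided (A' i) := by
    intro i
    have := Lim.ev_decided (G := fun i => (S i).1) cc (i + 1) (hdec i)
    refine this.congr fun x _ => ?_
    show (fun n => (S (i + 1)).2 (Lim.ev (G := fun i => (S i).1) cc (i + 1) (x n))) ∈ A i ↔ _
    simp only [hev]
    rfl
  let C : Set (List L.M) := {p | ∃ x, L.IsRun x ∧ x ∉ ⋃ i, A' i ∧ pre x p.length = p}
  have hC : ∀ m p, m :: p ∈ C → p ∈ C := by
    rintro m p ⟨x, h1, h2, h3⟩
    refine ⟨x, h1, h2, ?_⟩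
    simp only [List.length_cons, pre, List.cons.injEq] at h3
    exact h3.2
  have hclo : ∀ x, L.IsRun x → (x ∈ Unr.clo L C ↔ x ∈ (⋃ i, A' i)ᶜ) := by
    intro x hx
    constructor
    · intro h hxA
      obtain ⟨i, hi⟩ := Set.mem_iUnion.1 hxA
      obtain ⟨n, hn⟩ := hA' i x hx
      obtain ⟨y, hy, hyA, e⟩ := h n
      rw [pre_length] at e
      exact hyA (Set.mem_iUnion.2 ⟨i, (hn y hy e).1 hi⟩)
    · intro h n
      exact ⟨x, hx, h, by simp⟩
  refine ⟨Unr.UA L C k, (Unr.cov L C k).comp (Lim.cov (G := fun i => (S i).1) cc), ?_⟩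
  have h1 := (Unr.UA_decided (k := k) hC).compl
  refine h1.congr fun x hx => ?_
  have h2 := hclo _ ((Unr.cov L C k).isRun hx)
  have h3 : x ∈ ((fun y n => (y n).1) ⁻¹' Unr.clo L C)ᶜ ↔
    ¬ ((fun n => (Unr.cov L C k).π (x n)) ∈ Unr.clo L C) := Iff.rfl
  rw [h3, h2, Set.mem_compl_iff, not_not]
  simp only [A', Set.mem_iUnion, Set.mem_preimage]
  rfl

theorem good_of_measurable {M : Type} {A : Set (ℕ → M)}
    (hA : MeasurableSet[MeasurableSpace.generateFrom (FinDep M)] A) : Good A := by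
  induction A, hA using MeasurableSpace.generateFrom_induction with
  | hC t ht _ => exact good_finDep ht
  | empty => exact good_finDep ⟨0, by simp⟩
  | compl t _ ih => exact good_compl ih
  | iUnion f _ ih => exact good_union ih

theorem clopen_determined (G : Arena) (A : Set (ℕ → G.M)) (hA : G.Decided A) :
    (∃ σ, G.Legal σ ∧ ∀ x, G.IsRun x → Cons false σ x → x ∈ A) ∨
    (∃ σ, G.Legal σ ∧ ∀ x, G.IsRun x → Cons true σ x → x ∉ A) := by
  let U : Set (List G.M) := {p | ∀ y, G.IsRun y → pre y p.length = p → y ∈ A}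
  by_cases h : ∃ w, Win false G.T U [] w
  · left
    obtain ⟨w, h1, h2⟩ := h
    refine ⟨w, h1, fun x hx hc => ?_⟩
    obtain ⟨n, -, hn⟩ := h2 x rfl (fun n _ => hx n) (fun n _ hb => hc n hb)
    exact hn x hx (by simp)
  · right
    have hq := Unr.star_quasi (G := G) (b := false) (U := U) (q := []) G.nil_mem G.ext
      (fun h' => h h'.2.2)
    have hσ : ∀ p : List G.M, ∃ m, (p ∈ G.T → m :: p ∈ G.T) ∧
        (p ∈ Unr.Star false G.T U [] → p.length.bodd = true → m :: p ∈ Unr.Star false G.T U []) := by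
      intro p
      by_cases hp : p ∈ Unr.Star false G.T U [] ∧ p.length.bodd = true
      · obtain ⟨m, hm⟩ := hq.own p hp.1 hp.2
        exact ⟨m, fun _ => hm.1, fun _ _ => hm⟩
      · exact ⟨G.dflt p, G.dflt_legal p, fun h1 h2 => absurd ⟨h1, h2⟩ hp⟩
    choose σ h1 h2 using hσ
    refine ⟨σ, h1, fun x hx hc hxA => ?_⟩
    have hS : ∀ n, pre x n ∈ Unr.Star false G.T U [] := by
      intro n
      induction n with
      | zero => exact hq.root
      | succ n ih =>
        by_cases hn : n.bodd = true
        · have := h2 _ ih (by simpa using hn)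
          rw [← hc n hn] at this
          exact this
        · exact hq.opp _ ih (by simpa using hn) _ (hx (n + 1))
    obtain ⟨n, hn⟩ := hA x hx
    have hU : pre x n ∈ U := fun y hy e => (hn y hy (by simpa using e)).1 hxA
    exact (hS n).2.2 _ List.suffix_rfl ⟨List.nil_suffix, hx n, win_of_mem G.ext (hx n) hU⟩

/-- **Borel determinacy** (Martin). -/
theorem borel_determinacy (G : Arena) (A : Set (ℕ → G.M))
    (hA : MeasurableSet[MeasurableSpace.generateFrom (FinDep G.M)] A) :
    (∃ σ, G.Legal σ ∧ ∀ x, G.IsRun x → Cons false σ x → x ∈ A) ∨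
    (∃ σ, G.Legal σ ∧ ∀ x, G.IsRun x → Cons true σ x → x ∉ A) := by
  obtain ⟨H, c, h⟩ := good_of_measurable hA G (fun m => m) 0
  rcases clopen_determined H _ h with ⟨σ, h1, h2⟩ | ⟨σ, h1, h2⟩
  · refine Or.inl ⟨c.φ false σ, c.legal _ _ h1, fun x hx hc => ?_⟩
    obtain ⟨y, hy, hyc, hxy⟩ := c.runs _ _ h1 x hx hc
    have := h2 y hy hyc
    rw [← (funext hxy : (fun n => c.π (y n)) = x)]
    exact this
  · refine Or.inr ⟨c.φ true σ, c.legal _ _ h1, fun x hx hc => ?_⟩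
    obtain ⟨y, hy, hyc, hxy⟩ := c.runs _ _ h1 x hx hc
    have := h2 y hy hyc
    rw [← (funext hxy : (fun n => c.π (y n)) = x)]
    exact this

end BDet
end

section
open scoped ENNReal NNReal Classical
open MeasureTheory

namespace Scarf

variable {V I : Type} [Fintype V] [Fintype I] (e : I → V) (r : I → V → ℕ) (c : V → I)

structure Setup : Prop where
  inj : ∀ i, Function.Injective (r i)
  low : ∀ i v, r i (e i) ≤ r i v
  high : ∀ i j v, j ≠ i → v ∉ Set.range e → r i v < r i (e j)
  col : ∀ i, c (e i) = i
  ne : ∃ v, v ∉ Set.range e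

def Dom (T : Finset V) : Prop := ∀ y, y ∉ Set.range e → ∃ i, ∀ t ∈ T, r i y ≤ r i t

variable {e r c}

theorem Dom.mono {S T : Finset V} (h : Dom e r T) (hS : S ⊆ T) : Dom e r S := by
  intro y hy
  obtain ⟨i, hi⟩ := h y hy
  exact ⟨i, fun t ht => hi t (hS ht)⟩

/-- minimum function -/
theorem exists_min (T : Finset V) (hT : T.Nonempty) :
    ∃ m : I → V, ∀ i, m i ∈ T ∧ ∀ t ∈ T, r i (m i) ≤ r i t := by
  choose m h1 h2 using fun i => T.exists_min_image (r i) hT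
  exact ⟨m, fun i => ⟨h1 i, h2 i⟩⟩

theorem min_surj (hs : Setup e r c) {T : Finset V} (hD : Dom e r T) {m : I → V}
    (hm : ∀ i, m i ∈ T ∧ ∀ t ∈ T, r i (m i) ≤ r i t) : ∀ t ∈ T, ∃ i, m i = t := by
  intro t ht
  by_cases h : t ∈ Set.range e
  · obtain ⟨i, rfl⟩ := h
    exact ⟨i, hs.inj i (le_antisymm ((hm i).2 _ ht) (hs.low i _))⟩
  · obtain ⟨i, hi⟩ := hD t h
    exact ⟨i, hs.inj i (le_antisymm ((hm i).2 _ ht) (hi _ (hm i).1))⟩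

/-- key: completing a door in direction `k`. -/
theorem complete (hs : Setup e r c) {T : Finset V} (hD : Dom e r T) {m : I → V}
    (hm : ∀ i, m i ∈ T ∧ ∀ t ∈ T, r i (m i) ≤ r i t) {k : I}
    (hk : ∀ t ∈ T, ∃ l, l ≠ k ∧ m l = t) (hX : ∃ x ∈ T, x ∉ Set.range e) :
    ∃! w, w ∉ T ∧ Dom e r (insert w T) ∧ ∀ l, l ≠ k → r l (m l) < r l w := by
  have hek : e k ∉ T := by
    intro h
    obtain ⟨l, hl, h2⟩ := hk _ h
    obtain ⟨x, hx, hx'⟩ := hX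
    have := hs.high l k x hl.symm hx'
    have h3 := (hm l).2 x hx
    rw [h2] at h3; omega
  let Y : Finset V := Finset.univ.filter fun w => (w = e k ∨ w ∉ Set.range e) ∧ ∀ l, l ≠ k → r l (m l) < r l w
  have hY : e k ∈ Y := by
    simp only [Y, Finset.mem_filter, Finset.mem_univ, true_and, true_or]
    intro l hl
    obtain ⟨x, hx, hx'⟩ := hX
    exact lt_of_le_of_lt ((hm l).2 x hx) (hs.high l k x hl.symm hx')
  obtain ⟨w, hw, hmax⟩ := Y.exists_max_image (r k) ⟨_, hY⟩
  simp only [Y, Finset.mem_filter, Finset.mem_univ, true_and] at hw hmax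
  have hnotT : ∀ w, (∀ l, l ≠ k → r l (m l) < r l w) → w ∉ T := by
    intro w hw h
    obtain ⟨l, hl, h2⟩ := hk _ h
    have := hw l hl
    rw [h2] at this; omega
  refine ⟨w, ⟨hnotT w hw.2, ?_, hw.2⟩, ?_⟩
  · intro y hy
    by_cases hyY : ∀ l, l ≠ k → r l (m l) < r l y
    · refine ⟨k, fun t ht => ?_⟩
      have h1 := hmax y ⟨Or.inr hy, hyY⟩
      rcases Finset.mem_insert.1 ht with rfl | ht
      · exact h1
      · refine h1.trans ?_
        rcases hw.1 with rfl | hw1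
        · exact hs.low _ _
        · obtain ⟨l, hl⟩ := hD w hw1
          by_cases hlk : l = k
          · subst hlk; exact hl t ht
          · have := hw.2 l hlk
            have := hl _ (hm l).1
            omega
    · push Not at hyY
      obtain ⟨l, hl, h⟩ := hyY
      refine ⟨l, fun t ht => ?_⟩
      rcases Finset.mem_insert.1 ht with rfl | ht
      · exact h.trans (hw.2 l hl).le
      · exact h.trans ((hm l).2 t ht)
  · rintro w' ⟨h1, h2, h3⟩
    have hw' : w' = e k ∨ w' ∉ Set.range e := by
      by_cases h : w' ∈ Set.range e
      · obtain ⟨j, rfl⟩ := h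
        by_cases hj : j = k
        · left; rw [hj]
        · have := h3 j hj
          have := hs.low j (m j)
          omega
      · exact Or.inr h
    have hle := hmax w' ⟨hw', h3⟩
    apply hs.inj k
    refine le_antisymm hle ?_
    rcases hw.1 with rfl | hw1
    · exact hs.low _ _
    · obtain ⟨l, hl⟩ := h2 w hw1
      by_cases hlk : l = k
      · subst hlk; exact hl _ (Finset.mem_insert_self _ _)
      · have := hw.2 l hlk
        have := hl _ (Finset.mem_insert_of_mem (hm l).1)
        omega

/-- a door with a non-slack element is in exactly two rooms -/
theorem door_two (hs : Setup e r c) {T : Finset V} (hD : Dom e r T)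
    (hcard : T.card + 1 = Fintype.card I) (hX : ∃ x ∈ T, x ∉ Set.range e) :
    (Finset.univ.filter fun w => w ∉ T ∧ Dom e r (insert w T)).card = 2 := by
  have hne : T.Nonempty := hX.imp fun x h => h.1
  obtain ⟨m, hm⟩ := exists_min (r := r) T hne
  have hsur := min_surj hs hD hm
  have himg : Finset.univ.image m = T := by
    ext t; simp only [Finset.mem_image, Finset.mem_univ, true_and]
    exact ⟨fun ⟨i, hi⟩ => hi ▸ (hm i).1, hsur t⟩
  -- a coincidence pair
  obtain ⟨i, -, j, -, hij, hmij⟩ := Finset.exists_ne_map_eq_of_card_lt_of_maps_to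
    (s := (Finset.univ : Finset I)) (t := T) (by rw [Finset.card_univ]; omega) (fun i _ => (hm i).1)
  have hinj : ∀ k, (∀ t ∈ T, ∃ l, l ≠ k ∧ m l = t) → Set.InjOn m {l | l ≠ k} := by
    intro k hk
    have h1 : (Finset.univ.erase k).image m = T := by
      ext t; simp only [Finset.mem_image, Finset.mem_erase, Finset.mem_univ, and_true]
      exact ⟨fun ⟨i, _, hi⟩ => hi ▸ (hm i).1, fun h => hk t h⟩
    have h2 : ((Finset.univ.erase k).image m).card = (Finset.univ.erase k).card := by
      rw [h1, Finset.card_erase_of_mem (Finset.mem_univ _), Finset.card_univ]; omega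
    have h3 := Finset.card_image_iff.1 h2
    intro a ha b hb hab
    exact h3 (by simpa using ha) (by simpa using hb) hab
  have hki : ∀ t ∈ T, ∃ l, l ≠ i ∧ m l = t := by
    intro t ht
    obtain ⟨l, hl⟩ := hsur t ht
    by_cases h : l = i
    · exact ⟨j, hij.symm, by rw [← hmij, ← h, hl]⟩
    · exact ⟨l, h, hl⟩
  have hkj : ∀ t ∈ T, ∃ l, l ≠ j ∧ m l = t := by
    intro t ht
    obtain ⟨l, hl⟩ := hsur t ht
    by_cases h : l = j
    · exact ⟨i, hij, by rw [hmij, ← h, hl]⟩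
    · exact ⟨l, h, hl⟩
  obtain ⟨wi, hwi, ui⟩ := complete hs hD hm hki hX
  obtain ⟨wj, hwj, uj⟩ := complete hs hD hm hkj hX
  have hval : ∀ w, w ∉ T → Dom e r (insert w T) → ∃ k, (k = i ∨ k = j) ∧ ∀ l, l ≠ k → r l (m l) < r l w := by
    intro w hw hd
    obtain ⟨m', hm'⟩ := exists_min (r := r) (insert w T) ⟨w, Finset.mem_insert_self _ _⟩
    have hs' := min_surj hs hd hm'
    have hb : Function.Injective m' := by
      have h1 : Finset.univ.image m' = insert w T := by
        ext t; simp only [Finset.mem_image, Finset.mem_univ, true_and]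
        exact ⟨fun ⟨i, hi⟩ => hi ▸ (hm' i).1, hs' t⟩
      have h2 : (Finset.univ.image m').card = (Finset.univ : Finset I).card := by
        rw [h1, Finset.card_insert_of_notMem hw, Finset.card_univ]; omega
      have h3 := Finset.card_image_iff.1 h2
      intro a b hab
      exact h3 (by simp) (by simp) hab
    obtain ⟨k, hk⟩ := hs' w (Finset.mem_insert_self _ _)
    have h4 : ∀ l, l ≠ k → m' l = m l := by
      intro l hl
      have h5 : m' l ∈ T := by
        rcases Finset.mem_insert.1 (hm' l).1 with h | h
        · exact absurd (hb (h.trans hk.symm)) hl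
        · exact h
      exact hs.inj l (le_antisymm ((hm' l).2 _ (Finset.mem_insert_of_mem (hm l).1)) ((hm l).2 _ h5))
    refine ⟨k, ?_, fun l hl => ?_⟩
    · by_contra hcon
      push Not at hcon
      have := hb ((h4 i hcon.1.symm).trans (hmij.trans (h4 j hcon.2.symm).symm))
      exact hij this
    · refine lt_of_le_of_ne ?_ ?_
      · rw [← h4 l hl]; exact (hm' l).2 _ (Finset.mem_insert_self _ _)
      · intro h
        exact hw ((hs.inj l h) ▸ (hm l).1)
  have hne' : wi ≠ wj := by
    intro h
    subst h
    have : ∀ l, r l (m l) < r l wi := by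
      intro l
      by_cases hl : l = i
      · subst hl; exact hwj.2.2 _ hij
      · exact hwi.2.2 _ hl
    by_cases hw : wi ∈ Set.range e
    · obtain ⟨l, rfl⟩ := hw
      have := this l
      have := hs.low l (m l)
      omega
    · obtain ⟨l, hl⟩ := hD wi hw
      have := this l
      have := hl _ (hm l).1
      omega
  have : (Finset.univ.filter fun w => w ∉ T ∧ Dom e r (insert w T)) = {wi, wj} := by
    ext w
    simp only [Finset.mem_filter, Finset.mem_univ, true_and, Finset.mem_insert, Finset.mem_singleton]
    constructor
    · rintro ⟨h1, h2⟩
      obtain ⟨k, hk | hk, h3⟩ := hval w h1 h2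
      · subst hk; exact Or.inl (ui w ⟨h1, h2, h3⟩)
      · subst hk; exact Or.inr (uj w ⟨h1, h2, h3⟩)
    · rintro (rfl | rfl)
      · exact ⟨hwi.1, hwi.2.1⟩
      · exact ⟨hwj.1, hwj.2.1⟩
  rw [this, Finset.card_pair hne']

/-- the slack door is in exactly one room -/
theorem door_one (hs : Setup e r c) (i : I) :
    (Finset.univ.filter fun w => w ∉ (Finset.univ.erase i).image e ∧
      Dom e r (insert w ((Finset.univ.erase i).image e))).card = 1 := by
  obtain ⟨v0, hv0⟩ := hs.ne
  obtain ⟨w, hw, hmax⟩ := (Finset.univ.filter fun w => w ∉ Set.range e).exists_max_image (r i)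
    ⟨v0, by simpa using hv0⟩
  simp only [Finset.mem_filter, Finset.mem_univ, true_and] at hw hmax
  rw [Finset.card_eq_one]
  refine ⟨w, ?_⟩
  ext w'
  simp only [Finset.mem_filter, Finset.mem_univ, true_and, Finset.mem_singleton, Finset.mem_image,
    Finset.mem_erase, and_true]
  constructor
  · rintro ⟨h1, h2⟩
    have key : ∀ y, y ∉ Set.range e → r i y ≤ r i w' := by
      intro y hy
      obtain ⟨l, hl⟩ := h2 y hy
      by_cases hli : l = i
      · subst hli; exact hl _ (Finset.mem_insert_self _ _)
      · have h3 := hl (e l) (Finset.mem_insert_of_mem (by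
          simp only [Finset.mem_image, Finset.mem_erase, Finset.mem_univ, and_true]
          exact ⟨l, hli, rfl⟩))
        have h4 := hs.low l y
        exact absurd ⟨l, hs.inj l (le_antisymm h4 h3)⟩ hy
    have hw' : w' ∉ Set.range e := by
      rintro ⟨j, rfl⟩
      by_cases hj : j = i
      · subst hj
        have := key v0 hv0
        exact hv0 ⟨j, hs.inj j (le_antisymm (hs.low j v0) this)⟩
      · exact h1 ⟨j, hj, rfl⟩
    exact hs.inj i (le_antisymm (hmax _ hw') (key _ hw))
  · rintro rfl
    refine ⟨fun ⟨a, _, h⟩ => hw ⟨a, h⟩, fun y hy => ⟨i, fun t ht => ?_⟩⟩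
    rcases Finset.mem_insert.1 ht with rfl | ht
    · exact hmax y hy
    · obtain ⟨l, hl, rfl⟩ := Finset.mem_image.1 ht
      exact (hs.high i l y (Finset.mem_erase.1 hl).1 hy).le

/-- Sperner count: number of good facets of a room. -/
theorem facets_odd {T : Finset V} (hT : T.card = Fintype.card I) (i0 : I)
    (hc : T.image c = Finset.univ) :
    (T.filter fun t => (T.erase t).image c = Finset.univ.erase i0).card = 1 := by
  have hinj : Set.InjOn c T := by
    apply Finset.card_image_iff.1; rw [hc, Finset.card_univ, hT]
  obtain ⟨t0, ht0, h0⟩ := Finset.mem_image.1 (hc ▸ Finset.mem_univ i0 : i0 ∈ T.image c)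
  rw [Finset.card_eq_one]
  refine ⟨t0, ?_⟩
  ext t
  simp only [Finset.mem_filter, Finset.mem_singleton]
  constructor
  · rintro ⟨h1, h2⟩
    by_contra hne
    have : i0 ∈ (T.erase t).image c := Finset.mem_image.2 ⟨t0, Finset.mem_erase.2 ⟨fun h => hne h.symm, ht0⟩, h0⟩
    rw [h2] at this
    simp at this
  · rintro rfl
    refine ⟨ht0, ?_⟩
    ext i
    simp only [Finset.mem_image, Finset.mem_erase, Finset.mem_univ, and_true]
    constructor
    · rintro ⟨s, ⟨h1, h2⟩, rfl⟩ h3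
      exact h1 (hinj h2 ht0 (h3.trans h0.symm))
    · intro h
      obtain ⟨s, hs, rfl⟩ := Finset.mem_image.1 (hc ▸ Finset.mem_univ i : i ∈ T.image c)
      exact ⟨s, ⟨fun h' => h (by rw [h', h0]), hs⟩, rfl⟩

theorem facets_even {T : Finset V} (hT : T.card = Fintype.card I) (i0 : I)
    (hc : T.image c ≠ Finset.univ) :
    Even (T.filter fun t => (T.erase t).image c = Finset.univ.erase i0).card := by
  by_cases hex : ∃ t ∈ T, (T.erase t).image c = Finset.univ.erase i0
  · obtain ⟨t, ht, h⟩ := hex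
    have hinj : Set.InjOn c (T.erase t) := by
      apply Finset.card_image_iff.1
      rw [h, Finset.card_erase_of_mem ht, Finset.card_erase_of_mem (Finset.mem_univ _), hT, Finset.card_univ]
    have hct : c t ≠ i0 := by
      intro h'
      apply hc
      ext i
      simp only [Finset.mem_univ, iff_true]
      by_cases hi : i = i0
      · exact Finset.mem_image.2 ⟨t, ht, h'.trans hi.symm⟩
      · have : i ∈ (T.erase t).image c := by rw [h]; simpa using hi
        exact Finset.image_subset_image (Finset.erase_subset _ _) this
    have : c t ∈ (T.erase t).image c := by rw [h]; simpa using hct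
    obtain ⟨s, hs, hst⟩ := Finset.mem_image.1 this
    have hs' := Finset.mem_erase.1 hs
    have : (T.filter fun t => (T.erase t).image c = Finset.univ.erase i0) = {t, s} := by
      ext u
      simp only [Finset.mem_filter, Finset.mem_insert, Finset.mem_singleton]
      constructor
      · rintro ⟨h1, h2⟩
        by_contra hcon
        push Not at hcon
        have h3 : c u ∈ Finset.univ.erase i0 := by
          rw [← h]; exact Finset.mem_image_of_mem _ (Finset.mem_erase.2 ⟨hcon.1, h1⟩)
        rw [← h2] at h3
        obtain ⟨w, hw, hwu⟩ := Finset.mem_image.1 h3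
        have hw' := Finset.mem_erase.1 hw
        by_cases hwt : w = t
        · subst hwt
          exact hcon.2 (hinj (Finset.mem_coe.2 (Finset.mem_erase.2 ⟨hcon.1, h1⟩)) hs (hwu.symm.trans hst.symm))
        · exact hw'.1 (hinj (Finset.mem_coe.2 (Finset.mem_erase.2 ⟨hwt, hw'.2⟩))
            (Finset.mem_coe.2 (Finset.mem_erase.2 ⟨hcon.1, h1⟩)) hwu)
      · rintro (rfl | rfl)
        · exact ⟨ht, h⟩
        · refine ⟨hs'.2, ?_⟩
          rw [← h]
          ext i
          simp only [Finset.mem_image, Finset.mem_erase]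
          constructor
          · rintro ⟨w, ⟨h1, h2⟩, rfl⟩
            by_cases hwt : w = t
            · exact ⟨u, ⟨hs'.1, hs'.2⟩, by rw [hwt, hst]⟩
            · exact ⟨w, ⟨hwt, h2⟩, rfl⟩
          · rintro ⟨w, ⟨h1, h2⟩, rfl⟩
            by_cases hwt : w = u
            · exact ⟨t, ⟨hs'.1.symm, ht⟩, by rw [hwt, hst]⟩
            · exact ⟨w, ⟨hwt, h2⟩, rfl⟩
    rw [this, Finset.card_pair hs'.1.symm]
    exact even_two
  · push Not at hex
    rw [Finset.filter_false_of_mem hex]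
    simp

theorem scarf (hs : Setup e r c) (i0 : I) :
    ∃ T : Finset V, T.card = Fintype.card I ∧ Dom e r T ∧ T.image c = Finset.univ := by
  by_contra hno
  push Not at hno
  let R : Finset (Finset V) := Finset.univ.filter fun T => T.card = Fintype.card I ∧ Dom e r T
  let D : Finset (Finset V) := Finset.univ.filter fun S =>
    S.card + 1 = Fintype.card I ∧ Dom e r S ∧ S.image c = Finset.univ.erase i0
  have hcount : ∑ T ∈ R, (T.filter fun t => (T.erase t).image c = Finset.univ.erase i0).card =
      ∑ S ∈ D, (Finset.univ.filter fun w => w ∉ S ∧ Dom e r (insert w S)).card := by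
    rw [← Finset.card_sigma, ← Finset.card_sigma]
    refine Finset.card_bij' (fun p _ => ⟨p.1.erase p.2, p.2⟩) (fun p _ => ⟨insert p.2 p.1, p.2⟩) ?_ ?_ ?_ ?_
    · rintro ⟨T, t⟩ h
      simp only [R, D, Finset.mem_sigma, Finset.mem_filter, Finset.mem_univ, true_and] at h ⊢
      refine ⟨⟨?_, h.1.2.mono (Finset.erase_subset _ _), h.2.2⟩, Finset.notMem_erase _ _, ?_⟩
      · rw [Finset.card_erase_add_one h.2.1]; exact h.1.1
      · rw [Finset.insert_erase h.2.1]; exact h.1.2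
    · rintro ⟨S, w⟩ h
      simp only [R, D, Finset.mem_sigma, Finset.mem_filter, Finset.mem_univ, true_and] at h ⊢
      refine ⟨⟨?_, h.2.2⟩, Finset.mem_insert_self _ _, ?_⟩
      · rw [Finset.card_insert_of_notMem h.2.1]; exact h.1.1
      · rw [Finset.erase_insert h.2.1]; exact h.1.2.2
    · rintro ⟨T, t⟩ h
      simp only [R, Finset.mem_sigma, Finset.mem_filter] at h
      simp [Finset.insert_erase h.2.1]
    · rintro ⟨S, w⟩ h
      simp only [D, Finset.mem_sigma, Finset.mem_filter] at h
      simp [Finset.erase_insert h.2.2.1]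
  have hL : Even (∑ T ∈ R, (T.filter fun t => (T.erase t).image c = Finset.univ.erase i0).card) := by
    apply Finset.even_sum
    intro T hT
    simp only [R, Finset.mem_filter, Finset.mem_univ, true_and] at hT
    exact facets_even hT.1 i0 (hno T hT.1 hT.2)
  have einj : Function.Injective e := fun a b h => by rw [← hs.col a, ← hs.col b, h]
  let S0 : Finset V := (Finset.univ.erase i0).image e
  have hS0c : S0.image c = Finset.univ.erase i0 := by
    rw [Finset.image_image]
    have : c ∘ e = id := funext hs.col
    rw [this, Finset.image_id]
  have hS0 : S0 ∈ D := by
    simp only [D, Finset.mem_filter, Finset.mem_univ, true_and]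
    refine ⟨?_, ?_, hS0c⟩
    · rw [Finset.card_image_of_injective _ einj, Finset.card_erase_add_one (Finset.mem_univ _), Finset.card_univ]
    · intro y hy
      refine ⟨i0, fun t ht => ?_⟩
      obtain ⟨l, hl, rfl⟩ := Finset.mem_image.1 ht
      exact (hs.high i0 l y (Finset.mem_erase.1 hl).1 hy).le
  have hR : Odd (∑ S ∈ D, (Finset.univ.filter fun w => w ∉ S ∧ Dom e r (insert w S)).card) := by
    rw [← Finset.add_sum_erase _ _ hS0, door_one hs i0]
    apply Odd.add_even odd_one
    apply Finset.even_sum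
    intro S hS
    obtain ⟨hne, hS⟩ := Finset.mem_erase.1 hS
    simp only [D, Finset.mem_filter, Finset.mem_univ, true_and] at hS
    rw [door_two hs hS.2.1 hS.1]
    · exact even_two
    · by_contra hcon
      push Not at hcon
      apply hne
      apply Finset.eq_of_subset_of_card_le
      · intro x hx
        obtain ⟨j, rfl⟩ := hcon x hx
        refine Finset.mem_image_of_mem _ (Finset.mem_erase.2 ⟨?_, Finset.mem_univ _⟩)
        have : c (e j) ∈ S.image c := Finset.mem_image_of_mem _ hx
        rw [hS.2.2, hs.col] at this
        exact (Finset.mem_erase.1 this).1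
      · have : S0.card ≤ (Finset.univ.erase i0).card := Finset.card_image_le
        rw [Finset.card_erase_of_mem (Finset.mem_univ _), Finset.card_univ] at this
        omega
  rw [hcount] at hL
  exact (Nat.not_even_iff_odd.2 hR) hL

end Scarf
end

section
open scoped ENNReal NNReal Classical
open MeasureTheory

namespace Scarf

theorem approx {I : Type} [Fintype I] [Nonempty I] (f : (I → ℝ) → I → ℝ)
    (hf : ∀ z ∈ stdSimplex ℝ I, f z ∈ stdSimplex ℝ I) (N : ℕ) (hN : 0 < N) :
    ∃ z : I → I → ℝ, (∀ i, z i ∈ stdSimplex ℝ I) ∧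
      (∀ i, z i i - (Fintype.card I : ℝ) / N ≤ f (z i) i) ∧
      ∀ i j k, |z i k - z j k| ≤ (Fintype.card I : ℝ) / N := by
  have hN' : (0 : ℝ) < N := by exact_mod_cast hN
  let X : Type := {x : I → ℕ // x ∈ Finset.piAntidiag Finset.univ N}
  haveI : Fintype X := inferInstanceAs (Fintype {x : I → ℕ // x ∈ Finset.piAntidiag Finset.univ N})
  have hX : ∀ x : X, ∑ i, x.1 i = N := fun x => (Finset.mem_piAntidiag.1 x.2).1
  have mkX : ∀ x : I → ℕ, ∑ i, x i = N → x ∈ Finset.piAntidiag Finset.univ N := fun x h =>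
    Finset.mem_piAntidiag.2 ⟨h, fun i _ => Finset.mem_univ i⟩
  let sc : X → I → ℝ := fun x i => (x.1 i : ℝ) / N
  have hsc : ∀ x, sc x ∈ stdSimplex ℝ I := by
    intro x
    refine ⟨fun i => by positivity, ?_⟩
    simp only [sc]
    rw [← Finset.sum_div, div_eq_one_iff_eq hN'.ne']
    exact_mod_cast hX x
  have hcol : ∀ x : X, ∃ i, sc x i ≤ f (sc x) i := by
    intro x
    obtain ⟨i, -, hi⟩ := Finset.exists_le_of_sum_le (s := Finset.univ) (f := sc x) (g := f (sc x))
      Finset.univ_nonempty (by rw [(hsc x).2, (hf _ (hsc x)).2])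
    exact ⟨i, hi⟩
  choose col hcol using hcol
  let K := Fintype.card X
  let idx := Fintype.equivFin X
  let idI := Fintype.equivFin I
  let e : I → X ⊕ I := Sum.inr
  let r : I → X ⊕ I → ℕ := fun i v => Sum.elim (fun x => x.1 i * K + idx x + 1)
    (fun j => if j = i then 0 else (N + 1) * K + 1 + idI j) v
  let c : X ⊕ I → I := Sum.elim col id
  have hxi : ∀ (x : X) i, x.1 i ≤ N := fun x i => by
    have := hX x
    have := Finset.single_le_sum (f := x.1) (fun _ _ => Nat.zero_le _) (Finset.mem_univ i)
    omega
  have hb : ∀ (x : X) i, r i (Sum.inl x) < (N + 1) * K + 1 := by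
    intro x i
    have h1 := (idx x).2
    have h2 : x.1 i * K ≤ N * K := Nat.mul_le_mul_right _ (hxi x i)
    simp only [r, Sum.elim_inl]
    rw [add_mul]; omega
  have hrl : ∀ (x y : X) i, r i (Sum.inl x) ≤ r i (Sum.inl y) → x.1 i ≤ y.1 i := by
    intro x y i h
    simp only [r, Sum.elim_inl] at h
    by_contra hcon
    have h1 := (idx y).2
    have h2 : (y.1 i + 1) * K ≤ x.1 i * K := Nat.mul_le_mul_right _ (by omega)
    rw [add_mul] at h2; omega
  have hs : Setup e r c := by
    constructor
    · intro i v w h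
      rcases v with x | j <;> rcases w with y | k
      · have h1 := hrl x y i h.le
        have h2 := hrl y x i h.ge
        have h3 : x.1 i = y.1 i := le_antisymm h1 h2
        simp only [r, Sum.elim_inl, h3] at h
        have : idx x = idx y := Fin.ext (by omega)
        rw [idx.injective this]
      · exfalso
        have := hb x i
        simp only [r, Sum.elim_inl, Sum.elim_inr] at h this
        split_ifs at h <;> omega
      · exfalso
        have := hb y i
        simp only [r, Sum.elim_inl, Sum.elim_inr] at h this
        split_ifs at h <;> omega
      · simp only [r, Sum.elim_inr] at h
        split_ifs at h with h1 h2 h2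
        · rw [h1, h2]
        · omega
        · omega
        · have : idI j = idI k := Fin.ext (by omega)
          rw [idI.injective this]
    · intro i v; simp [r, e]
    · intro i j v hj hv
      rcases v with x | k
      · have := hb x i
        simp only [r, e, Sum.elim_inl, Sum.elim_inr, if_neg hj] at this ⊢
        omega
      · exact absurd ⟨k, rfl⟩ hv
    · intro i; rfl
    · refine ⟨Sum.inl ⟨fun i => if i = Classical.arbitrary I then N else 0, mkX _ (by simp)⟩, ?_⟩
      rintro ⟨j, hj⟩; cases hj
  obtain ⟨T, hTc, hTd, hTi⟩ := scarf hs (Classical.arbitrary I)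
  have hdom : ∀ y : X, ∃ i, Sum.inr i ∉ T ∧ ∀ x : X, Sum.inl x ∈ T → y.1 i ≤ x.1 i := by
    intro y
    obtain ⟨i, hi⟩ := hTd (Sum.inl y) (by rintro ⟨j, hj⟩; cases hj)
    refine ⟨i, fun h => ?_, fun x hx => hrl _ _ _ (hi _ hx)⟩
    have := hi _ h
    simp [r] at this
  obtain ⟨v0, hv0⟩ := hs.ne
  have hpick : ∀ i, Sum.inr i ∉ T → ∃ x : X, Sum.inl x ∈ T ∧ col x = i := by
    intro i hi
    obtain ⟨t, ht, hti⟩ := Finset.mem_image.1 (hTi ▸ Finset.mem_univ i : i ∈ T.image c)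
    rcases t with x | j
    · exact ⟨x, ht, hti⟩
    · simp only [c, Sum.elim_inr, id] at hti
      subst hti; exact absurd ht hi
  have hy0 : ∃ y0 : X, True := by
    rcases v0 with x | j
    · exact ⟨x, trivial⟩
    · exact absurd ⟨j, rfl⟩ hv0
  obtain ⟨y0, -⟩ := hy0
  obtain ⟨i1, hi1, -⟩ := hdom y0
  obtain ⟨x0, hx0, -⟩ := hpick i1 hi1
  let σ : Finset X := Finset.univ.filter fun x => Sum.inl x ∈ T
  have hσ : σ.Nonempty := ⟨x0, by simpa [σ] using hx0⟩
  choose m hm1 hm2 using fun i => σ.exists_min_image (fun x => x.1 i) hσ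
  let C : Finset I := Finset.univ.filter fun i => Sum.inr i ∉ T
  have hsum : N < ∑ i ∈ C, ((m i).1 i + 1) := by
    by_contra hcon
    push Not at hcon
    let S := ∑ i ∈ C, ((m i).1 i + 1)
    let y : I → ℕ := fun i => (if i ∈ C then (m i).1 i + 1 else 0) + if i = i1 then N - S else 0
    have hy : ∑ i, y i = N := by
      have h1 : ∑ i, (if i ∈ C then (m i).1 i + 1 else 0) = S := by
        rw [Finset.sum_ite_mem, Finset.univ_inter]
      have h2 : ∑ i : I, (if i = i1 then N - S else 0) = N - S := by simp
      have h3 : ∑ i, y i = S + (N - S) := by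
        refine (Finset.sum_add_distrib).trans ?_
        exact congrArg₂ (· + ·) h1 h2
      rw [h3]
      have : S ≤ N := hcon
      omega
    obtain ⟨i, hi, h⟩ := hdom ⟨y, mkX y hy⟩
    have h1 := h (m i) (by simpa [σ] using hm1 i)
    have hiC : i ∈ C := by simpa [C] using hi
    simp only [y, hiC, if_true] at h1
    omega
  have hC : ∑ i ∈ C, ((m i).1 i + 1) = ∑ i ∈ C, (m i).1 i + C.card := by
    rw [Finset.sum_add_distrib]; simp
  have hCn : C.card ≤ Fintype.card I := Finset.card_le_univ _
  have hup : ∀ x ∈ σ, ∀ k, (k ∈ C → x.1 k ≤ (m k).1 k + Fintype.card I) ∧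
      (k ∉ C → x.1 k ≤ Fintype.card I) := by
    intro x hx k
    have h1 : ∀ i ∈ C, (m i).1 i ≤ x.1 i := fun i _ => hm2 i x hx
    constructor
    · intro hk
      have h2 : ∑ i ∈ C, x.1 i ≤ N := by
        refine le_trans ?_ (hX x).le; exact Finset.sum_le_sum_of_subset (Finset.subset_univ _)
      rw [← Finset.add_sum_erase _ _ hk] at h2
      rw [hC, ← Finset.add_sum_erase _ _ hk] at hsum
      have h3 : ∑ i ∈ C.erase k, (m i).1 i ≤ ∑ i ∈ C.erase k, x.1 i :=
        Finset.sum_le_sum fun i hi => h1 i (Finset.mem_of_mem_erase hi)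
      omega
    · intro hk
      have h2 : ∑ i ∈ insert k C, x.1 i ≤ N := by
        refine le_trans ?_ (hX x).le; exact Finset.sum_le_sum_of_subset (Finset.subset_univ _)
      rw [Finset.sum_insert hk] at h2
      have h3 : ∑ i ∈ C, (m i).1 i ≤ ∑ i ∈ C, x.1 i := Finset.sum_le_sum h1
      omega
  have hch : ∀ i, ∃ x ∈ σ, (i ∈ C → col x = i) := by
    intro i
    by_cases hi : i ∈ C
    · obtain ⟨x, h1, h2⟩ := hpick i (by simpa [C] using hi)
      exact ⟨x, by simpa [σ] using h1, fun _ => h2⟩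
    · exact ⟨x0, by simpa [σ] using hx0, fun h => absurd h hi⟩
  choose w hw1 hw2 using hch
  refine ⟨fun i => sc (w i), fun i => hsc _, fun i => ?_, fun i j k => ?_⟩
  · by_cases hi : i ∈ C
    · have := hcol (w i)
      rw [hw2 i hi] at this
      have h2 : 0 ≤ (Fintype.card I : ℝ) / N := by positivity
      linarith
    · have h1 := (hup _ (hw1 i) i).2 hi
      have h2 := (hf _ (hsc (w i))).1 i
      have h3 : sc (w i) i ≤ (Fintype.card I : ℝ) / N := by
        simp only [sc]; gcongr
      linarith
  · simp only [sc]
    rw [← sub_div, abs_div, abs_of_pos hN']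
    apply div_le_div_of_nonneg_right _ hN'.le
    rw [abs_sub_le_iff]
    have hi := hup _ (hw1 i) k
    have hj := hup _ (hw1 j) k
    have mi := hm2 k _ (hw1 i)
    have mj := hm2 k _ (hw1 j)
    constructor
    · have : (w i).1 k ≤ (w j).1 k + Fintype.card I := by
        by_cases hk : k ∈ C
        · have := hi.1 hk; omega
        · have := hi.2 hk; omega
      rw [sub_le_iff_le_add']; exact_mod_cast this
    · have : (w j).1 k ≤ (w i).1 k + Fintype.card I := by
        by_cases hk : k ∈ C
        · have := hj.1 hk; omega
        · have := hj.2 hk; omega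
      rw [sub_le_iff_le_add']; exact_mod_cast this

open Filter Topology in
theorem brouwer {I : Type} [Fintype I] [Nonempty I] (f : (I → ℝ) → I → ℝ)
    (hc : ContinuousOn f (stdSimplex ℝ I))
    (hf : ∀ z ∈ stdSimplex ℝ I, f z ∈ stdSimplex ℝ I) : ∃ z ∈ stdSimplex ℝ I, f z = z := by
  choose z hz1 hz2 hz3 using fun N : ℕ => approx f hf (N + 1) (Nat.succ_pos N)
  let i0 := Classical.arbitrary I
  obtain ⟨w, hw, φ, hφ, hlim⟩ := (isCompact_stdSimplex (𝕜 := ℝ) (ι := I)).tendsto_subseq (fun N => hz1 N i0)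
  have hzero : Tendsto (fun N : ℕ => (Fintype.card I : ℝ) / ((φ N + 1 : ℕ) : ℝ)) atTop (𝓝 0) := by
    apply Tendsto.const_div_atTop
    apply tendsto_natCast_atTop_atTop.comp
    exact tendsto_atTop_mono (fun n => Nat.le_succ _) hφ.tendsto_atTop
  have hall : ∀ i, Tendsto (fun N => z (φ N) i) atTop (𝓝 w) := by
    intro i
    rw [tendsto_pi_nhds]
    intro k
    have h1 : Tendsto (fun N => z (φ N) i0 k) atTop (𝓝 (w k)) := (tendsto_pi_nhds.1 hlim) k
    have h2 : Tendsto (fun N => z (φ N) i k - z (φ N) i0 k) atTop (𝓝 0) :=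
      squeeze_zero_norm (fun N => hz3 (φ N) i i0 k) hzero
    have := h1.add h2
    simpa using this
  refine ⟨w, hw, ?_⟩
  have hge : ∀ i, w i ≤ f w i := by
    intro i
    have h1 : Tendsto (fun N => f (z (φ N) i)) atTop (𝓝 (f w)) := by
      have h2 := hc w hw
      exact h2.tendsto.comp (tendsto_nhdsWithin_iff.2 ⟨hall i, Eventually.of_forall fun N => hz1 _ i⟩)
    have h3 := (tendsto_pi_nhds.1 h1) i
    have h4 := ((tendsto_pi_nhds.1 (hall i)) i).sub hzero
    rw [sub_zero] at h4
    exact le_of_tendsto_of_tendsto' h4 h3 fun N => hz2 (φ N) i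
  have hsum : ∑ i, w i = ∑ i, f w i := by rw [hw.2, (hf w hw).2]
  have := (Finset.sum_eq_sum_iff_of_le (fun i _ => hge i)).1 hsum
  funext i
  exact (this i (Finset.mem_univ i)).symm

end Scarf
end

section
open scoped ENNReal NNReal Classical
open MeasureTheory

namespace NashG

variable {I : Type} [Fintype I] [DecidableEq I] {A : I → Type} [∀ i, Fintype (A i)]

/-- multilinear extension -/
noncomputable def U (x : ∀ i, A i → ℝ) (u : (∀ i, A i) → ℝ) : ℝ := ∑ a : ∀ i, A i, (∏ i, x i (a i)) * u a

theorem prod_update (x : ∀ i, A i → ℝ) (a : ∀ i, A i) (i : I) (c : A i) :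
    (∏ j, x j (Function.update a i c j)) = x i c * ∏ j ∈ Finset.univ.erase i, x j (a j) := by
  rw [← Finset.mul_prod_erase _ _ (Finset.mem_univ i)]
  congr 1
  · simp
  · apply Finset.prod_congr rfl
    intro j hj
    rw [Function.update_of_ne (Finset.ne_of_mem_erase hj)]

theorem prod_update' (x : ∀ i, A i → ℝ) (y : ∀ i, A i → ℝ) (a : ∀ i, A i) (i : I)
    (h : ∀ j, j ≠ i → y j = x j) :
    (∏ j, y j (a j)) = y i (a i) * ∏ j ∈ Finset.univ.erase i, x j (a j) := by
  rw [← Finset.mul_prod_erase _ _ (Finset.mem_univ i)]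
  congr 1
  apply Finset.prod_congr rfl
  intro j hj
  rw [h j (Finset.ne_of_mem_erase hj)]

/-- swap equivalence -/
def swapE (i : I) : ((∀ j, A j) × A i) ≃ ((∀ j, A j) × A i) where
  toFun p := (Function.update p.1 i p.2, p.1 i)
  invFun p := (Function.update p.1 i p.2, p.1 i)
  left_inv p := by simp
  right_inv p := by simp

/-- resampling -/
theorem U_resample (x y : ∀ i, A i → ℝ) (i : I) (hx : ∑ c, x i c = 1)
    (h : ∀ j, j ≠ i → y j = x j) (u : (∀ i, A i) → ℝ) :
    U y u = U x (fun a => ∑ c, y i c * u (Function.update a i c)) := by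
  have h1 : U y u = ∑ p : (∀ j, A j) × A i, x i p.2 * ((∏ j, y j (p.1 j)) * u p.1) := by
    rw [Fintype.sum_prod_type]
    simp only [U]
    apply Finset.sum_congr rfl
    intro a _
    rw [← Finset.sum_mul, hx, one_mul]
  have h2 : U x (fun a => ∑ c, y i c * u (Function.update a i c)) =
      ∑ p : (∀ j, A j) × A i, (∏ j, x j (p.1 j)) * (y i p.2 * u (Function.update p.1 i p.2)) := by
    rw [Fintype.sum_prod_type]
    simp only [U, Finset.mul_sum]
  rw [h1, h2]
  refine Fintype.sum_equiv (swapE i) _ _ ?_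
  rintro ⟨a, c⟩
  simp only [swapE, Equiv.coe_fn_mk, Function.update_idem, Function.update_eq_self]
  rw [prod_update x a i c, prod_update' x y a i h]
  ring

theorem U_const (x : ∀ i, A i → ℝ) (hx : ∀ i, ∑ c, x i c = 1) (k : ℝ) : U x (fun _ => k) = k := by
  simp only [U]
  have h := Finset.prod_univ_sum (fun i => (Finset.univ : Finset (A i))) x
  rw [Fintype.piFinset_univ] at h
  rw [← Finset.sum_mul, ← h]
  simp [hx]

theorem U_mono (x : ∀ i, A i → ℝ) (hx : ∀ i c, 0 ≤ x i c) {u w : (∀ i, A i) → ℝ} (h : ∀ a, u a ≤ w a) :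
    U x u ≤ U x w :=
  Finset.sum_le_sum fun a _ => mul_le_mul_of_nonneg_left (h a) (Finset.prod_nonneg fun _ _ => hx _ _)

theorem U_add (x : ∀ i, A i → ℝ) (u w : (∀ i, A i) → ℝ) : U x (fun a => u a + w a) = U x u + U x w := by
  simp only [U, mul_add, Finset.sum_add_distrib]

theorem U_mul (x : ∀ i, A i → ℝ) (k : ℝ) (u : (∀ i, A i) → ℝ) : U x (fun a => k * u a) = k * U x u := by
  simp only [U, Finset.mul_sum]
  exact Finset.sum_congr rfl fun a _ => by ring

theorem U_sum (x : ∀ i, A i → ℝ) {K : Type} (s : Finset K) (u : K → (∀ i, A i) → ℝ) :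
    U x (fun a => ∑ k ∈ s, u k a) = ∑ k ∈ s, U x (u k) := by
  simp only [U, Finset.mul_sum]
  exact Finset.sum_comm

theorem U_avg (x : ∀ i, A i → ℝ) (i : I) (hx : ∑ c, x i c = 1) (u : (∀ i, A i) → ℝ) :
    U x u = ∑ c, x i c * U x (fun a => u (Function.update a i c)) := by
  rw [U_resample x x i hx (fun _ _ => rfl) u, U_sum]
  exact Finset.sum_congr rfl fun c _ => U_mul _ _ _

theorem U_cont (u : (∀ i, A i) → ℝ) : Continuous fun x : ∀ i, A i → ℝ => U x u := by
  unfold U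
  fun_prop

/-- **Nash's theorem** -/
theorem nash [Nonempty I] [∀ i, Nonempty (A i)] (u : I → (∀ i, A i) → ℝ) :
    ∃ x : ∀ i, A i → ℝ, (∀ i, x i ∈ stdSimplex ℝ (A i)) ∧
      ∀ i c, U x (fun a => u i (Function.update a i c)) ≤ U x (u i) := by
  let n : ℝ := Fintype.card I
  have hn : 0 < n := by simp only [n]; exact_mod_cast Fintype.card_pos
  let K := Σ i, A i
  haveI : Nonempty K := ⟨⟨Classical.arbitrary I, Classical.arbitrary _⟩⟩
  let s : (K → ℝ) → I → ℝ := fun z i => ∑ a, z ⟨i, a⟩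
  let X : (K → ℝ) → ∀ i, A i → ℝ := fun z i a =>
    (z ⟨i, a⟩ + max 0 (1 / n - s z i) / Fintype.card (A i)) / max (s z i) (1 / n)
  let g : (∀ i, A i → ℝ) → ∀ i, A i → ℝ := fun x i c =>
    max 0 (U x (fun a => u i (Function.update a i c)) - U x (u i))
  let F : (K → ℝ) → K → ℝ := fun z k =>
    ((X z k.1 k.2 + g (X z) k.1 k.2) / (1 + ∑ c, g (X z) k.1 c)) / n
  have hs : ∀ z ∈ stdSimplex ℝ K, ∑ i, s z i = 1 := by
    intro z hz
    rw [← hz.2, Fintype.sum_sigma]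
  have hmax : ∀ z i, 0 < max (s z i) (1 / n) := fun z i => lt_of_lt_of_le (by positivity) (le_max_right _ _)
  have hX : ∀ z ∈ stdSimplex ℝ K, ∀ i, X z i ∈ stdSimplex ℝ (A i) := by
    intro z hz i
    refine ⟨fun a => ?_, ?_⟩
    · apply div_nonneg _ (hmax z i).le
      exact add_nonneg (hz.1 _) (div_nonneg (le_max_left _ _) (by positivity))
    · simp only [X]
      rw [← Finset.sum_div, Finset.sum_add_distrib, Finset.sum_const, Finset.card_univ, nsmul_eq_mul,
        mul_div_cancel₀ _ (by exact_mod_cast Fintype.card_ne_zero), div_eq_one_iff_eq (hmax z i).ne']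
      change s z i + _ = _
      rcases le_total (s z i) (1 / n) with h | h
      · rw [max_eq_right h, max_eq_right (by linarith)]; ring
      · rw [max_eq_left h, max_eq_left (by linarith)]; ring
  have hg : ∀ x i c, 0 ≤ g x i c := fun x i c => le_max_left _ _
  have hden : ∀ x i, 0 < 1 + ∑ c, g x i c := fun x i =>
    add_pos_of_pos_of_nonneg one_pos (Finset.sum_nonneg fun c _ => hg x i c)
  have hF : ∀ z ∈ stdSimplex ℝ K, F z ∈ stdSimplex ℝ K := by
    intro z hz
    refine ⟨fun k => ?_, ?_⟩
    · exact div_nonneg (div_nonneg (add_nonneg ((hX z hz _).1 _) (hg _ _ _)) (hden _ _).le) hn.le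
    · rw [Fintype.sum_sigma]
      have : ∀ i, ∑ a, F z ⟨i, a⟩ = 1 / n := by
        intro i
        have hFe : ∀ a, F z ⟨i, a⟩ = ((X z i a + g (X z) i a) / (1 + ∑ c, g (X z) i c)) / n := fun a => rfl
        simp only [hFe]
        rw [← Finset.sum_div, ← Finset.sum_div, Finset.sum_add_distrib, (hX z hz i).2,
          div_self (hden _ _).ne']
      simp only [this]
      rw [Finset.sum_const, Finset.card_univ, nsmul_eq_mul, mul_one_div, div_self hn.ne']
  have hsc : Continuous s := by simp only [s]; fun_prop
  have hXc : Continuous X := by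
    refine continuous_pi fun i => continuous_pi fun a => ?_
    refine Continuous.div ?_ ?_ (fun z => (hmax z i).ne')
    · have : Continuous fun z => s z i := (continuous_apply i).comp hsc
      fun_prop
    · have : Continuous fun z => s z i := (continuous_apply i).comp hsc
      fun_prop
  have hgc : ∀ i c, Continuous fun x => g x i c := fun i c =>
    continuous_const.max ((U_cont _).sub (U_cont _))
  have hFc : Continuous F := by
    refine continuous_pi fun k => Continuous.div_const (Continuous.div ?_ ?_ (fun z => (hden _ _).ne')) _
    · exact ((continuous_apply k.2).comp ((continuous_apply k.1).comp hXc)).add ((hgc _ _).comp hXc)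
    · exact continuous_const.add (continuous_finset_sum _ fun c _ => (hgc _ _).comp hXc)
  obtain ⟨z, hz, hfix⟩ := Scarf.brouwer F hFc.continuousOn hF
  have hzF : ∀ i a, z ⟨i, a⟩ = ((X z i a + g (X z) i a) / (1 + ∑ c, g (X z) i c)) / n := by
    intro i a
    exact (congrFun hfix ⟨i, a⟩).symm
  have hsz : ∀ i, s z i = 1 / n := by
    intro i
    simp only [s, hzF]
    rw [← Finset.sum_div, ← Finset.sum_div, Finset.sum_add_distrib, (hX z hz i).2,
          div_self (hden _ _).ne']
  have hXz : ∀ i a, X z i a = n * z ⟨i, a⟩ := by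
    intro i a
    simp only [X, hsz]
    simp
    ring
  refine ⟨X z, hX z hz, fun i => ?_⟩
  have hX1 : ∀ a, X z i a * (∑ c, g (X z) i c) = g (X z) i a := by
    intro a
    have h1 := hXz i a
    rw [hzF, mul_div_cancel₀ _ hn.ne', eq_div_iff (hden _ _).ne'] at h1
    linarith
  have havg := U_avg (X z) i (hX z hz i).2 (u i)
  -- some action in the support has no gain
  have hex : ∃ c, 0 < X z i c ∧ U (X z) (fun a => u i (Function.update a i c)) ≤ U (X z) (u i) := by
    by_contra hcon
    push Not at hcon
    have h0 : U (X z) (u i) = ∑ c, X z i c * U (X z) (u i) := by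
      rw [← Finset.sum_mul, (hX z hz i).2, one_mul]
    have hpos : ∃ c, 0 < X z i c := by
      by_contra h
      push Not at h
      have := (hX z hz i).2
      have h2 : ∑ c, X z i c ≤ 0 := Finset.sum_nonpos fun c _ => h c
      linarith
    obtain ⟨c0, hc0⟩ := hpos
    have : ∑ c, X z i c * U (X z) (u i) < ∑ c, X z i c * U (X z) (fun a => u i (Function.update a i c)) := by
      apply Finset.sum_lt_sum
      · intro c _
        rcases ((hX z hz i).1 c).eq_or_lt with h | h
        · rw [← h]; simp
        · exact mul_le_mul_of_nonneg_left (hcon c h).le h.le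
      · exact ⟨c0, Finset.mem_univ _, mul_lt_mul_of_pos_left (hcon c0 hc0) hc0⟩
    linarith
  obtain ⟨c0, hc0, hle⟩ := hex
  have hsum0 : ∑ c, g (X z) i c = 0 := by
    have h1 := hX1 c0
    have h2 : g (X z) i c0 = 0 := max_eq_left (by linarith)
    rw [h2] at h1
    rcases mul_eq_zero.1 h1 with h | h
    · linarith
    · exact h
  intro c
  have h3 := (Finset.sum_eq_zero_iff_of_nonneg (fun c _ => hg (X z) i c)).1 hsum0 c (Finset.mem_univ _)
  have h4 : U (X z) (fun a => u i (Function.update a i c)) - U (X z) (u i) ≤ g (X z) i c := le_max_right _ _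
  linarith

end NashG
end

section
open scoped ENNReal NNReal Classical
open MeasureTheory

namespace StochGame
variable {G : StochGame}

abbrev Ev (G : StochGame) := G.ActionProfile × G.S

/-- append an event -/
abbrev sn (h : G.History) (e : G.Ev) : G.History := snocH h e.1 e.2

/-- prefix of a run -/
def pf (r : G.Run) (n : ℕ) : G.History := (r.1, (List.range n).map r.2)

/-- length -/
abbrev len (h : G.History) : ℕ := h.2.length

theorem pf_len (r : G.Run) (n : ℕ) : (pf r n).2.length = n := by simp [pf]

theorem pf_succ (r : G.Run) (n : ℕ) : pf r (n + 1) = sn (pf r n) (r.2 n) := by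
  simp [pf, snocH, List.range_succ]

theorem sn_len (h : G.History) (e : G.Ev) : (sn h e).2.length = h.2.length + 1 := by simp [snocH]

theorem mem_cyl {r : G.Run} {h : G.History} : r ∈ cyl h ↔ pf r h.2.length = h := by
  obtain ⟨s, l⟩ := h
  simp only [cyl, pf, Set.mem_setOf_eq, Prod.mk.injEq]
  refine and_congr_right fun _ => ?_
  constructor
  · intro h
    apply List.ext_get
    · simp
    · intro n h1 h2
      simpa using h n h2
  · intro h k hk
    have := congrArg (fun l => l[k]?) h
    simp only [List.getElem?_map, List.getElem?_range hk, Option.map_some, List.getElem?_eq_getElem hk] at this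
    simpa using this

theorem lastState_sn (h : G.History) (e : G.Ev) : lastState (sn h e) = e.2 := by
  simp [lastState, snocH]

theorem sn_inj {h h' : G.History} {e e' : G.Ev} (H : sn h e = sn h' e') : h = h' ∧ e = e' := by
  simp only [snocH, Prod.mk.injEq] at H
  have := List.append_inj' H.2 rfl
  simp only [List.cons.injEq, and_true] at this
  exact ⟨Prod.ext H.1 this.1, this.2⟩

instance : Countable G.History := by unfold History; infer_instance

theorem cyl_sn_subset (h : G.History) (e : G.Ev) : cyl (sn h e) ⊆ cyl h := by
  intro r hr
  rw [mem_cyl, sn_len, pf_succ] at hr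
  rw [mem_cyl]; exact (sn_inj hr).1

theorem pf_mono_eq {r r' : G.Run} {n m : ℕ} (hnm : n ≤ m) (h : pf r m = pf r' m) : pf r n = pf r' n := by
  induction m, hnm using Nat.le_induction with
  | base => exact h
  | succ m _ ih =>
    rw [pf_succ, pf_succ] at h
    exact ih (sn_inj h).1

instance : DiscreteMeasurableSpace G.S := ⟨fun _ => trivial⟩
instance : DiscreteMeasurableSpace G.ActionProfile := ⟨fun _ => trivial⟩

theorem measurableSet_cyl (h : G.History) : MeasurableSet (cyl h) := by
  have : cyl h = (fun r : G.Run => r.1) ⁻¹' {h.1} ∩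
      ⋂ k : Fin h.2.length, (fun r : G.Run => r.2 k) ⁻¹' {h.2.get k} := by
    ext r
    simp only [cyl, Set.mem_setOf_eq, Set.mem_inter_iff, Set.mem_preimage, Set.mem_singleton_iff,
      Set.mem_iInter]
    exact and_congr_right fun _ => ⟨fun h k => h k k.2, fun h k hk => h ⟨k, hk⟩⟩
  rw [this]
  refine (measurable_fst (MeasurableSet.of_discrete)).inter (MeasurableSet.iInter fun k => ?_)
  exact ((measurable_pi_apply _).comp measurable_snd) (measurableSet_singleton _)

theorem measurable_pf {β : Type*} [MeasurableSpace β] (n : ℕ) (V : G.History → β) :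
    Measurable fun r : G.Run => V (pf r n) := by
  intro B _
  have : (fun r : G.Run => V (pf r n)) ⁻¹' B = ⋃ h : {h : G.History // V h ∈ B ∧ h.2.length = n}, cyl h.1 := by
    ext r
    simp only [Set.mem_preimage, Set.mem_iUnion]
    constructor
    · intro h; exact ⟨⟨pf r n, h, pf_len r n⟩, mem_cyl.2 (by simp only [pf_len])⟩
    · rintro ⟨⟨h, h1, h2⟩, h3⟩
      rw [mem_cyl] at h3
      simp only [h2] at h3
      rw [h3]; exact h1
  rw [this]
  exact MeasurableSet.iUnion fun h => measurableSet_cyl _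

theorem run_le (m : MeasurableSpace G.Run) (hc : ∀ h : G.History, MeasurableSet[m] (cyl h)) :
    Prod.instMeasurableSpace ≤ m := by
  have h1 : @Measurable G.Run G.S m _ (fun r => r.1) := by
    refine @measurable_to_countable' _ _ _ _ m _ fun s => ?_
    convert hc (s, [])
    ext r; simp [cyl]
  have h2 : ∀ n, @Measurable G.Run G.Ev m _ (fun r => r.2 n) := by
    intro n
    refine @measurable_to_countable' _ _ _ _ m _ fun e => ?_
    have : (fun r : G.Run => r.2 n) ⁻¹' {e} = ⋃ h : {h : G.History // h.2.length = n}, cyl (sn h.1 e) := by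
      ext r
      simp only [Set.mem_preimage, Set.mem_iUnion, Set.mem_singleton_iff]
      constructor
      · intro h
        refine ⟨⟨pf r n, pf_len r n⟩, ?_⟩
        rw [mem_cyl, sn_len, pf_len, pf_succ, h]
      · rintro ⟨⟨h, rfl⟩, h3⟩
        rw [mem_cyl, sn_len, pf_succ] at h3
        exact (sn_inj h3).2
    rw [this]
    exact MeasurableSet.iUnion fun h => hc _
  have h3 : @Measurable G.Run G.Run m Prod.instMeasurableSpace (fun r => (r.1, fun n => r.2 n)) :=
    Measurable.prodMk h1 (@measurable_pi_lambda _ _ _ m _ _ h2)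
  intro s hs
  exact h3 hs

theorem run_generate : (inferInstance : MeasurableSpace G.Run) ≤
    MeasurableSpace.generateFrom {s | ∃ h : G.History, cyl h = s} :=
  run_le _ fun h => MeasurableSpace.measurableSet_generateFrom ⟨h, rfl⟩

theorem cyl_cases (h h' : G.History) : (∃ l, h' = catH h l) ∨ cyl h ⊆ cyl h' ∨ Disjoint (cyl h') (cyl h) := by
  by_cases hd : Disjoint (cyl h') (cyl h)
  · exact Or.inr (Or.inr hd)
  · rw [Set.not_disjoint_iff] at hd
    obtain ⟨r, h1, h2⟩ := hd
    rw [mem_cyl] at h1 h2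
    rcases le_total h'.2.length h.2.length with hle | hle
    · right; left
      intro r' hr'
      rw [mem_cyl] at hr' ⊢
      rw [← h1, pf_len]
      exact pf_mono_eq hle (hr'.trans h2.symm)
    · left
      refine ⟨(List.range' h.2.length (h'.2.length - h.2.length)).map r.2, ?_⟩
      have h3 : List.range h'.2.length = List.range h.2.length ++ List.range' h.2.length (h'.2.length - h.2.length) := by
        rw [List.range_eq_range', List.range_eq_range']
        have := @List.range'_append 0 h.2.length (h'.2.length - h.2.length) 1
        simp only [one_mul, zero_add] at this
        rw [this]; congr 1; omega
      rw [← h1]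
      conv_lhs => rw [pf, h3, List.map_append]
      rw [catH]
      conv_rhs => enter [1]; rw [← h2]
      conv_rhs => enter [2]; rw [← h2]
      simp [pf]

theorem isPiSystem_cyl : IsPiSystem {s | ∃ h : G.History, cyl h = s} := by
  rintro _ ⟨h, rfl⟩ _ ⟨h', rfl⟩ hne
  rcases le_total h.2.length h'.2.length with hle | hle
  · refine ⟨h', ?_⟩
    symm; apply Set.inter_eq_right.2
    obtain ⟨r, h1, h2⟩ := hne
    intro r' hr'
    rw [mem_cyl] at *
    rw [← h1, pf_len]
    exact pf_mono_eq hle (hr'.trans h2.symm)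
  · refine ⟨h, ?_⟩
    symm; apply Set.inter_eq_left.2
    obtain ⟨r, h1, h2⟩ := hne
    intro r' hr'
    rw [mem_cyl] at *
    rw [← h2, pf_len]
    exact pf_mono_eq hle (hr'.trans h1.symm)

theorem catH_nil (h : G.History) : catH h [] = h := by simp [catH]

theorem catH_cons (h : G.History) (e : G.Ev) (l : List G.Ev) : catH h (e :: l) = catH (sn h e) l := by
  simp [catH, snocH]

/-- uniqueness of measures with prescribed cylinder probabilities above `h` -/
theorem ext_of_cyl {μ ν : Measure G.Run} [IsProbabilityMeasure μ] [IsProbabilityMeasure ν] (h : G.History)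
    (h1 : μ (cyl h) = 1) (H : ∀ l, μ (cyl (catH h l)) = ν (cyl (catH h l))) : μ = ν := by
  have h2 : ν (cyl h) = 1 := by have := H []; rw [catH_nil, h1] at this; exact this.symm
  refine ext_of_generate_finite _ (le_antisymm run_generate ?_) isPiSystem_cyl ?_ (by simp)
  · apply MeasurableSpace.generateFrom_le
    rintro _ ⟨h, rfl⟩; exact measurableSet_cyl h
  · rintro _ ⟨h', rfl⟩
    rcases cyl_cases h h' with ⟨l, rfl⟩ | hs | hd
    · exact H l
    · have a1 : μ (cyl h') = 1 := le_antisymm prob_le_one (h1 ▸ measure_mono hs)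
      have a2 : ν (cyl h') = 1 := le_antisymm prob_le_one (h2 ▸ measure_mono hs)
      rw [a1, a2]
    · have key : ∀ (ρ : Measure G.Run) [IsProbabilityMeasure ρ], ρ (cyl h) = 1 → ρ (cyl h') = 0 := by
        intro ρ _ hρ
        have := (prob_compl_eq_zero_iff (measurableSet_cyl h)).2 hρ
        exact measure_mono_null (fun r hr => Set.disjoint_left.1 hd hr) this
      rw [key μ h1, key ν h2]

end StochGame
end

section
open scoped ENNReal NNReal Classical
open MeasureTheory

namespace StochGame
variable {G : StochGame}

/-- expectation with respect to a `PMF`. -/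
noncomputable def ny {T : Type} (p : PMF T) (d : T → ℝ) : ℝ := ∑' t, (p t).toReal * d t

section ny
variable {T : Type} (p : PMF T)

theorem ny_hasSum : HasSum (fun t => (p t).toReal) 1 := by
  have h := ENNReal.summable_toReal p.tsum_coe_ne_top
  have h2 := ENNReal.tsum_toReal_eq (fun t => p.apply_ne_top t)
  rw [p.tsum_coe] at h2
  have := h.hasSum
  rw [← h2] at this
  simpa using this

theorem ny_summable {d : T → ℝ} {C : ℝ} (h : ∀ t, |d t| ≤ C) : Summable fun t => (p t).toReal * d t := by
  refine Summable.of_norm_bounded (g := fun t => (p t).toReal * C) ((ny_hasSum p).summable.mul_right C) fun t => ?_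
  rw [Real.norm_eq_abs, abs_mul, abs_of_nonneg ENNReal.toReal_nonneg]
  exact mul_le_mul_of_nonneg_left (h t) ENNReal.toReal_nonneg

theorem ny_const (k : ℝ) : ny p (fun _ => k) = k := by
  rw [ny, tsum_mul_right, (ny_hasSum p).tsum_eq, one_mul]

theorem ny_add {d d' : T → ℝ} {C C' : ℝ} (h : ∀ t, |d t| ≤ C) (h' : ∀ t, |d' t| ≤ C') :
    ny p (fun t => d t + d' t) = ny p d + ny p d' := by
  simp only [ny, mul_add]
  exact (ny_summable p h).tsum_add (ny_summable p h')

theorem ny_mul (k : ℝ) (d : T → ℝ) : ny p (fun t => k * d t) = k * ny p d := by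
  simp only [ny]
  rw [← tsum_mul_left]
  congr 1; funext t; ring

theorem ny_mono' {d d' : T → ℝ} {C C' : ℝ} (h : ∀ t, |d t| ≤ C) (h' : ∀ t, |d' t| ≤ C')
    (hle : ∀ t, p t ≠ 0 → d t ≤ d' t) : ny p d ≤ ny p d' := by
  refine (ny_summable p h).tsum_le_tsum (fun t => ?_) (ny_summable p h')
  by_cases ht : p t = 0
  · simp [ht]
  · exact mul_le_mul_of_nonneg_left (hle t ht) ENNReal.toReal_nonneg

theorem ny_mono {d d' : T → ℝ} {C C' : ℝ} (h : ∀ t, |d t| ≤ C) (h' : ∀ t, |d' t| ≤ C')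
    (hle : ∀ t, d t ≤ d' t) : ny p d ≤ ny p d' := ny_mono' p h h' fun t _ => hle t

theorem ny_abs {d : T → ℝ} {C : ℝ} (h : ∀ t, |d t| ≤ C) : |ny p d| ≤ C := by
  rw [abs_le]
  constructor
  · rw [← ny_const p (-C)]
    exact ny_mono p (C := |C|) (fun t => by rw [abs_neg]) h fun t => (abs_le.1 (h t)).1
  · rw [← ny_const p C]
    exact ny_mono p (C' := |C|) h (fun t => le_rfl) fun t => (abs_le.1 (h t)).2
end ny

/-- one-shot expectation at state `s`, mixed profile `x`, continuation `d`. -/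
noncomputable def os (s : G.S) (x : ∀ i, G.A i → ℝ) (d : G.Ev → ℝ) : ℝ :=
  NashG.U x (fun a => ny (G.trans s a) (fun t => d (a, t)))

/-- mixed profile at history -/
noncomputable def xr (σ : G.Profile) (h : G.History) : ∀ i, G.A i → ℝ := fun i c => (σ i h c).toReal

/-- mixed profiles as reals -/
def Mix (G : StochGame) : Set (∀ i, G.A i → ℝ) := {x | ∀ i, x i ∈ stdSimplex ℝ (G.A i)}

theorem xr_mix (σ : G.Profile) (h : G.History) : xr σ h ∈ Mix G := by
  intro i
  refine ⟨fun c => ENNReal.toReal_nonneg, ?_⟩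
  have := ny_hasSum (σ i h)
  rw [← this.tsum_eq, tsum_fintype]; rfl

section os
variable {s : G.S} {x : ∀ i, G.A i → ℝ} (hx : x ∈ Mix G)
include hx

theorem os_const (k : ℝ) : os s x (fun _ => k) = k := by
  simp only [os, ny_const]
  exact NashG.U_const x (fun i => (hx i).2) k

theorem os_mono' {d d' : G.Ev → ℝ} {C C' : ℝ} (h : ∀ t, |d t| ≤ C) (h' : ∀ t, |d' t| ≤ C')
    (hle : ∀ t, G.trans s t.1 t.2 ≠ 0 → d t ≤ d' t) : os s x d ≤ os s x d' :=
  NashG.U_mono x (fun i => (hx i).1) fun a => ny_mono' _ (fun _ => h _) (fun _ => h' _) fun _ h => hle _ h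

theorem os_mono {d d' : G.Ev → ℝ} {C C' : ℝ} (h : ∀ t, |d t| ≤ C) (h' : ∀ t, |d' t| ≤ C')
    (hle : ∀ t, d t ≤ d' t) : os s x d ≤ os s x d' := os_mono' hx h h' fun t _ => hle t

theorem os_abs {d : G.Ev → ℝ} {C : ℝ} (h : ∀ t, |d t| ≤ C) : |os s x d| ≤ C := by
  rw [abs_le]
  constructor
  · rw [← os_const (s := s) hx (-C)]
    exact os_mono hx (C := |C|) (fun t => by rw [abs_neg]) h fun t => (abs_le.1 (h t)).1
  · rw [← os_const (s := s) hx C]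
    exact os_mono hx (C' := |C|) h (fun t => le_rfl) fun t => (abs_le.1 (h t)).2
end os

theorem os_add {s : G.S} {x : ∀ i, G.A i → ℝ} {d d' : G.Ev → ℝ} {C C' : ℝ} (h : ∀ t, |d t| ≤ C) (h' : ∀ t, |d' t| ≤ C') :
    os s x (fun t => d t + d' t) = os s x d + os s x d' := by
  simp only [os]
  rw [← NashG.U_add]
  congr 1; funext a; exact ny_add _ (fun _ => h _) (fun _ => h' _)

theorem os_mul {s : G.S} {x : ∀ i, G.A i → ℝ} (k : ℝ) (d : G.Ev → ℝ) : os s x (fun t => k * d t) = k * os s x d := by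
  simp only [os]
  rw [← NashG.U_mul]
  congr 1; funext a; exact ny_mul _ _ _

/-- step weight -/
noncomputable def sw (σ : G.Profile) (h : G.History) (e : G.Ev) : ℝ≥0∞ :=
  (∏ i, σ i h (e.1 i)) * G.trans (lastState h) e.1 e.2

theorem sw_sum (σ : G.Profile) (h : G.History) : ∑' e, sw σ h e = 1 := by
  rw [ENNReal.tsum_prod']
  simp only [sw]
  simp only [ENNReal.tsum_mul_left, PMF.tsum_coe, mul_one]
  rw [tsum_fintype]
  have h1 := Finset.prod_univ_sum (fun i => (Finset.univ : Finset (G.A i))) (fun i c => σ i h c)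
  rw [Fintype.piFinset_univ] at h1
  rw [← h1]
  apply Finset.prod_eq_one
  intro i _
  rw [← (σ i h).tsum_coe, tsum_fintype]

theorem sw_toReal (σ : G.Profile) (h : G.History) (e : G.Ev) : (sw σ h e).toReal =
    (∏ i, xr σ h i (e.1 i)) * (G.trans (lastState h) e.1 e.2).toReal := by
  rw [sw, ENNReal.toReal_mul, ENNReal.toReal_prod]; rfl

theorem os_hasSum {σ : G.Profile} {h : G.History} {d : G.Ev → ℝ} {D : ℝ}
    (H : HasSum (fun e => (sw σ h e).toReal * d e) D) {C : ℝ} (hd : ∀ e, |d e| ≤ C) :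
    D = os (lastState h) (xr σ h) d := by
  have h2 := H.prod_fiberwise (g := fun a => (∏ i, xr σ h i (a i)) * ny (G.trans (lastState h) a) (fun t => d (a, t)))
    (fun a => by
      simp only [sw_toReal, mul_assoc]
      exact (ny_summable _ (fun _ => hd _)).hasSum.mul_left _)
  rw [← h2.tsum_eq, tsum_fintype]
  rfl

variable {P : G.History → G.Profile → Measure G.Run} (hP : IsInducedFamily G P)
include hP

theorem P_cyl_self (h : G.History) (σ : G.Profile) : P h σ (cyl h) = 1 := by
  have := hP.2 h σ []
  rwa [catH_nil] at this

theorem P_cyl_sn (h : G.History) (σ : G.Profile) (e e' : G.Ev) (l : List G.Ev) (hne : e ≠ e') :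
    P (sn h e) σ (cyl (catH h (e' :: l))) = 0 := by
  haveI := hP.1 (sn h e) σ
  have h1 := (prob_compl_eq_zero_iff (measurableSet_cyl (sn h e))).2 (P_cyl_self hP (sn h e) σ)
  have hsub : cyl (catH h (e' :: l)) ⊆ (cyl (sn h e))ᶜ := by
   intro r hr hr2
   have h2 : r ∈ cyl (sn h e') := by
     rw [catH_cons] at hr
     exact ⟨hr.1, fun k hk => by
      have := hr.2 k (lt_of_lt_of_le hk (by simp [catH]))
      rw [this]
      simp only [catH, List.get_eq_getElem]
      rw [List.getElem_append_left hk]⟩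
   rw [mem_cyl, sn_len] at h2 hr2
   exact hne (sn_inj (hr2.symm.trans h2)).2
  exact measure_mono_null hsub h1

theorem P_eq (h : G.History) (σ : G.Profile) (μ : Measure G.Run) [IsProbabilityMeasure μ]
    (H : ∀ l, μ (cyl (catH h l)) = contProb σ h l) : μ = P h σ := by
  haveI := hP.1 h σ
  refine ext_of_cyl h ?_ fun l => ?_
  · have := H []; rwa [catH_nil] at this
  · rw [H, hP.2]

theorem P_sum (h : G.History) (σ : G.Profile) :
    Measure.sum (fun e => sw σ h e • P (sn h e) σ) = P h σ := by
  haveI := fun e => hP.1 (sn h e) σ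
  haveI : IsProbabilityMeasure (Measure.sum (fun e => sw σ h e • P (sn h e) σ)) := by
    constructor
    rw [Measure.sum_apply _ MeasurableSet.univ]
    simp [sw_sum]
  refine P_eq hP h σ _ fun l => ?_
  rw [Measure.sum_apply _ (measurableSet_cyl _)]
  simp only [Measure.smul_apply, smul_eq_mul]
  cases l with
  | nil =>
    have : ∀ e, P (sn h e) σ (cyl (catH h [])) = 1 := fun e => by
      rw [catH_nil]
      exact le_antisymm prob_le_one ((P_cyl_self hP (sn h e) σ).symm ▸ measure_mono (cyl_sn_subset h e))
    simp only [this, mul_one, sw_sum, contProb]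
  | cons e' l =>
    rw [tsum_eq_single e' (fun e hne => by rw [P_cyl_sn hP h σ e e' l hne, mul_zero])]
    rw [catH_cons, hP.2]
    rfl

theorem P_integrable (h : G.History) (σ : G.Profile) {g : G.Run → ℝ} (hg : Measurable g) {C : ℝ}
    (hC : ∀ r, |g r| ≤ C) : Integrable g (P h σ) := by
  haveI := hP.1 h σ
  exact Integrable.of_bound hg.aestronglyMeasurable C (Filter.Eventually.of_forall fun r => by simpa using hC r)

theorem E_abs (h : G.History) (σ : G.Profile) {g : G.Run → ℝ} {C : ℝ}
    (hC : ∀ r, |g r| ≤ C) : |∫ r, g r ∂(P h σ)| ≤ C := by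
  haveI := hP.1 h σ
  have := norm_integral_le_of_norm_le_const (μ := P h σ) (f := g) (C := C) (Filter.Eventually.of_forall fun r => by simpa using hC r)
  simpa using this

/-- one-step disintegration -/
theorem E_step (h : G.History) (σ : G.Profile) {g : G.Run → ℝ} (hg : Measurable g) {C : ℝ}
    (hC : ∀ r, |g r| ≤ C) :
    ∫ r, g r ∂(P h σ) = os (lastState h) (xr σ h) (fun e => ∫ r, g r ∂(P (sn h e) σ)) := by
  refine os_hasSum ?_ (fun e => E_abs hP (sn h e) σ hC)
  have h1 := P_integrable hP h σ hg hC
  have h2 := hasSum_integral_measure (f := g) (μ := fun e => sw σ h e • P (sn h e) σ) (by rw [P_sum hP]; exact h1)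
  rw [P_sum hP] at h2
  simpa only [integral_smul_measure, smul_eq_mul] using h2

/-- almost surely the run passes through the root. -/
theorem ae_cyl (h : G.History) (σ : G.Profile) : ∀ᵐ r ∂(P h σ), pf r h.2.length = h := by
  haveI := hP.1 h σ
  have h1 := (prob_compl_eq_zero_iff (measurableSet_cyl h)).2 (P_cyl_self hP h σ)
  rw [ae_iff]
  convert h1 using 2
  ext r; simp only [Set.mem_setOf_eq, Set.mem_compl_iff, mem_cyl]

/-- tower property -/
theorem E_tower (σ : G.Profile) {g : G.Run → ℝ} (hg : Measurable g) {C : ℝ}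
    (hC : ∀ r, |g r| ≤ C) (k : ℕ) : ∀ h : G.History,
    ∫ r, g r ∂(P h σ) = ∫ r, (∫ r', g r' ∂(P (pf r (h.2.length + k)) σ)) ∂(P h σ) := by
  induction k with
  | zero =>
    intro h
    haveI := hP.1 h σ
    refine Eq.symm ((integral_congr_ae (g := fun _ => ∫ r', g r' ∂(P h σ)) ?_).trans (by simp))
    · filter_upwards [ae_cyl hP h σ] with r hr
      rw [add_zero, hr]
  | succ k ih =>
    intro h
    rw [E_step hP h σ hg hC]
    rw [E_step hP h σ (measurable_pf _ (fun h' => ∫ r', g r' ∂(P h' σ))) (fun r => E_abs hP _ σ hC)]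
    congr 1
    funext e
    rw [ih (sn h e)]
    simp only [sn_len]
    congr 1
    funext r
    rw [show h.2.length + 1 + k = h.2.length + (k + 1) by omega]

/-- operator lemma -/
theorem E_op (σ : G.Profile) {Ψ : G.History → ℝ} {C : ℝ} (hC : ∀ h, |Ψ h| ≤ C) (h : G.History) {n : ℕ}
    (hn : h.2.length ≤ n) :
    ∫ r, Ψ (pf r (n + 1)) ∂(P h σ) =
      ∫ r, os (lastState (pf r n)) (xr σ (pf r n)) (fun e => Ψ (sn (pf r n) e)) ∂(P h σ) := by
  obtain ⟨k, rfl⟩ := Nat.exists_eq_add_of_le hn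
  rw [E_tower hP σ (measurable_pf _ Ψ) (fun r => hC _) k h]
  congr 1
  funext r
  set h' := pf r (h.2.length + k) with hh'
  have hl : h'.2.length = h.2.length + k := pf_len _ _
  rw [E_step hP h' σ (measurable_pf _ Ψ) (fun r => hC _)]
  congr 1
  funext e
  haveI := hP.1 (sn h' e) σ
  rw [integral_congr_ae (g := fun _ => Ψ (sn h' e))]
  · simp
  · filter_upwards [ae_cyl hP (sn h' e) σ] with r' hr'
    rw [sn_len, hl] at hr'
    rw [hr']

end StochGame
end

section
open scoped ENNReal NNReal Classical
open MeasureTheory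

namespace StochGame
variable {G : StochGame}

/-- truncation -/
def tk (h : G.History) (k : ℕ) : G.History := (h.1, h.2.take k)

theorem tk_pf (r : G.Run) {k n : ℕ} (hk : k ≤ n) : tk (pf r n) k = pf r k := by
  simp only [tk, pf, List.map_take]
  rw [← List.map_take, List.take_range, min_eq_left hk]

theorem tk_self (h : G.History) {k : ℕ} (hk : h.2.length ≤ k) : tk h k = h := by
  simp only [tk]; rw [List.take_of_length_le hk]

theorem tk_sn (h : G.History) (e : G.Ev) {k : ℕ} (hk : k ≤ h.2.length) : tk (sn h e) k = tk h k := by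
  simp only [tk, snocH]; rw [List.take_append_of_le_length hk]

theorem tk_tk (h : G.History) {j k : ℕ} (hk : j ≤ k) : tk (tk h k) j = tk h j := by
  simp only [tk, List.take_take, min_eq_left hk]

theorem tk_len (h : G.History) {k : ℕ} (hk : k ≤ h.2.length) : (tk h k).2.length = k := by
  simp [tk, hk]

theorem tk_succ (h : G.History) {k : ℕ} (hk : k < h.2.length) : tk h (k + 1) = sn (tk h k) (h.2.get ⟨k, hk⟩) := by
  simp only [tk, snocH, Prod.mk.injEq, true_and]
  rw [List.take_succ_eq_append_getElem hk]; rfl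

theorem Ext_refl (h : G.History) : Ext h h := ⟨rfl, List.prefix_rfl⟩

theorem Ext_trans {h h' h'' : G.History} (a : Ext h h') (b : Ext h' h'') : Ext h h'' :=
  ⟨a.1.trans b.1, a.2.trans b.2⟩

theorem Ext_sn (h : G.History) (e : G.Ev) : Ext h (sn h e) := ⟨rfl, List.prefix_append _ _⟩

theorem Ext_len {h h' : G.History} (a : Ext h h') : h.2.length ≤ h'.2.length := a.2.length_le

theorem Ext_iff {h h' : G.History} : Ext h h' ↔ h.2.length ≤ h'.2.length ∧ tk h' h.2.length = h := by
  constructor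
  · rintro ⟨h1, h2⟩
    refine ⟨h2.length_le, ?_⟩
    simp only [tk, ← h1]
    rw [← List.prefix_iff_eq_take.1 h2]
  · rintro ⟨h1, h2⟩
    have h3 := congrArg Prod.fst h2
    have h4 := congrArg Prod.snd h2
    simp only [tk] at h3 h4
    exact ⟨h3.symm, List.prefix_iff_eq_take.2 h4.symm⟩

theorem Ext_tk (h : G.History) (k : ℕ) : Ext (tk h k) h := ⟨rfl, List.take_prefix _ _⟩

theorem Ext_tk' {h h' : G.History} (a : Ext h h') {k : ℕ} (hk : h.2.length ≤ k) : Ext h (tk h' k) := by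
  rw [Ext_iff] at *
  constructor
  · simp only [tk, List.length_take]; omega
  · rw [tk_tk _ hk, a.2]

theorem Ext_pf {h : G.History} {r : G.Run} {n : ℕ} (hr : pf r h.2.length = h) (hn : h.2.length ≤ n) :
    Ext h (pf r n) := by
  rw [Ext_iff, pf_len, tk_pf r hn]; exact ⟨hn, hr⟩

theorem Ext_cases {h h' : G.History} (a : Ext h h') : h' = h ∨ ∃ h'' e, h' = sn h'' e ∧ Ext h h'' := by
  rcases (Ext_len a).eq_or_lt with hl | hl
  · left
    rw [Ext_iff] at a
    rw [← a.2, tk_self _ hl.ge]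
  · right
    have hp : h'.2.length - 1 < h'.2.length := by omega
    refine ⟨tk h' (h'.2.length - 1), h'.2.get ⟨_, hp⟩, ?_, Ext_tk' a (by omega)⟩
    rw [← tk_succ h' hp]
    exact (tk_self _ (by omega)).symm

theorem Ext_sn_iff {h h' : G.History} {e : G.Ev} (a : Ext h (sn h' e)) : h = sn h' e ∨ Ext h h' := by
  rcases Ext_cases a with h1 | ⟨h'', e', h1, h2⟩
  · exact Or.inl h1.symm
  · right; rw [(sn_inj h1).1]; exact h2

/-- one-shot value when player `i` uses the pure action `c` -/
noncomputable def osA (s : G.S) (x : ∀ i, G.A i → ℝ) (i : G.I) (c : G.A i) (d : G.Ev → ℝ) : ℝ :=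
  NashG.U x (fun a => ny (G.trans s (Function.update a i c)) (fun t => d (Function.update a i c, t)))

theorem os_resample {s : G.S} {x y : ∀ i, G.A i → ℝ} {i : G.I} (hx : x ∈ Mix G)
    (h : ∀ j, j ≠ i → y j = x j) (d : G.Ev → ℝ) : os s y d = ∑ c, y i c * osA s x i c d := by
  rw [os, NashG.U_resample x y i (hx i).2 h, NashG.U_sum]
  congr 1; funext c; rw [osA, NashG.U_mul]

theorem os_dev_le {s : G.S} {x y : ∀ i, G.A i → ℝ} {i : G.I} (hx : x ∈ Mix G) (hy : y ∈ Mix G)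
    (h : ∀ j, j ≠ i → y j = x j) {d : G.Ev → ℝ} {w : ℝ} (H : ∀ c, osA s x i c d ≤ w) : os s y d ≤ w := by
  rw [os_resample hx h]
  calc _ ≤ ∑ c, y i c * w := Finset.sum_le_sum fun c _ => mul_le_mul_of_nonneg_left (H c) ((hy i).1 c)
    _ = w := by rw [← Finset.sum_mul, (hy i).2, one_mul]

variable {P : G.History → G.Profile → Measure G.Run} (hP : IsInducedFamily G P)
include hP

omit hP in
theorem contProb_congr {σ σ' : G.Profile} (l : List G.Ev) : ∀ h : G.History,
    (∀ i h', Ext h h' → σ i h' = σ' i h') → contProb σ h l = contProb σ' h l := by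
  induction l with
  | nil => intro h _; rfl
  | cons e l ih =>
    intro h H
    obtain ⟨a, s⟩ := e
    simp only [contProb]
    rw [ih (snocH h a s) (fun i h' hh => H i h' (Ext_trans (Ext_sn h (a, s)) hh))]
    congr 2
    exact Finset.prod_congr rfl fun i _ => by rw [H i h (Ext_refl h)]

theorem P_congr {σ σ' : G.Profile} (h : G.History) (H : ∀ i h', Ext h h' → σ i h' = σ' i h') :
    P h σ = P h σ' := by
  haveI := hP.1 h σ
  refine P_eq hP h σ' _ fun l => ?_
  rw [hP.2, contProb_congr l h H]

theorem E_ind (σ : G.Profile) {g : G.Run → ℝ} (hg : Measurable g) {C : ℝ}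
    (hC : ∀ r, |g r| ≤ C) {Φ : G.History → ℝ} {K : ℝ} (hK : ∀ h, |Φ h| ≤ K) (h : G.History) {n : ℕ}
    (hn : h.2.length ≤ n) :
    ∫ r, Φ (pf r n) * g r ∂(P h σ) = ∫ r, Φ (pf r n) * (∫ r', g r' ∂(P (pf r n) σ)) ∂(P h σ) := by
  obtain ⟨k, rfl⟩ := Nat.exists_eq_add_of_le hn
  have hb : ∀ r, |Φ (pf r (h.2.length + k)) * g r| ≤ K * C := fun r => by
    rw [abs_mul]; exact mul_le_mul (hK _) (hC _) (abs_nonneg _) ((abs_nonneg _).trans (hK h))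
  rw [E_tower hP σ (g := fun r => Φ (pf r (h.2.length + k)) * g r) ((measurable_pf _ Φ).mul hg) hb k h]
  congr 1; funext r
  rw [← integral_const_mul]
  refine integral_congr_ae ?_
  filter_upwards [ae_cyl hP (pf r (h.2.length + k)) σ] with r' hr'
  rw [pf_len] at hr'
  simp only [hr']

/-- bounded sub-martingales converge -/
theorem sub_conv (σ : G.Profile) (h : G.History) {V : G.History → ℝ} {C : ℝ} (hV : ∀ h, |V h| ≤ C)
    (H : ∀ h', Ext h h' → V h' ≤ os (lastState h') (xr σ h') (fun e => V (sn h' e))) :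
    ∀ᵐ r ∂(P h σ), ∃ l, Filter.Tendsto (fun n => V (pf r n)) Filter.atTop (nhds l) := by
  haveI := hP.1 h σ
  set L := h.2.length with hL
  letI mH : MeasurableSpace G.History := ⊤
  let ℱ : Filtration ℕ (inferInstance : MeasurableSpace G.Run) :=
    { seq := fun n => MeasurableSpace.comap (fun r => pf r (L + n)) ⊤
      mono' := by
        intro n m hnm S hS
        obtain ⟨T, _, rfl⟩ := hS
        refine ⟨{h' | tk h' (L + n) ∈ T}, trivial, ?_⟩
        ext r
        simp only [Set.mem_preimage, Set.mem_setOf_eq]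
        rw [tk_pf r (by omega)]
      le' := by
        intro n
        rintro S ⟨T, hT, rfl⟩
        exact measurable_pf (L + n) (fun h => h) hT }
  have hIntg : ∀ n, Integrable (fun r => V (pf r (L + n))) (P h σ) := fun n =>
    P_integrable hP h σ (measurable_pf _ V) (fun r => hV _)
  have hsub : Submartingale (fun n r => V (pf r (L + n))) ℱ (P h σ) := by
    refine submartingale_of_setIntegral_le_succ (fun n => ?_) hIntg ?_
    · refine Measurable.stronglyMeasurable ?_
      intro B _
      exact ⟨V ⁻¹' B, trivial, rfl⟩
    · rintro n S ⟨T, hT, rfl⟩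
      have hm : MeasurableSet ((fun r : G.Run => pf r (L + n)) ⁻¹' T) := measurable_pf (L + n) (fun h => h) hT
      rw [← integral_indicator hm, ← integral_indicator hm]
      let Ψ : G.History → ℝ := fun h' => if tk h' (L + n) ∈ T then V h' else 0
      have hΨ : ∀ h, |Ψ h| ≤ C := fun h => by
        simp only [Ψ]; split_ifs
        · exact hV h
        · simpa using (abs_nonneg _).trans (hV h)
      have h2 := E_op hP σ hΨ h (n := L + n) (by omega)
      have h3 : ∀ r : G.Run, Set.indicator ((fun r : G.Run => pf r (L + n)) ⁻¹' T) (fun r => V (pf r (L + (n+1)))) r = Ψ (pf r (L + n + 1)) := by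
        intro r
        simp only [Set.indicator, Set.mem_preimage, Ψ]
        rw [tk_pf r (by omega)]; rfl
      rw [integral_congr_ae (Filter.Eventually.of_forall h3), h2]
      refine integral_mono_ae ((hIntg n).indicator hm) (P_integrable hP h σ (measurable_pf _ (fun h' => os (lastState h') (xr σ h') (fun e => Ψ (sn h' e)))) (C := C) fun r => os_abs (xr_mix _ _) fun e => hΨ _) ?_
      filter_upwards [ae_cyl hP h σ] with r hr
      simp only [Set.indicator, Set.mem_preimage]
      have h4 : ∀ e, tk (sn (pf r (L + n)) e) (L + n) = pf r (L + n) := fun e => by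
        rw [tk_sn _ _ (by rw [pf_len]), tk_pf _ le_rfl]
      simp only [Ψ, h4]
      by_cases hT : pf r (L + n) ∈ T
      · simp only [hT, if_true]
        exact H _ (Ext_pf hr (by omega))
      · simp only [hT, if_false]
        rw [os_const (xr_mix _ _)]
  have hb : ∀ n, eLpNorm (fun r => V (pf r (L + n))) 1 (P h σ) ≤ (Real.toNNReal C : ℝ≥0∞) := by
    intro n
    refine (eLpNorm_le_of_ae_bound (C := C) (Filter.Eventually.of_forall fun r => by simpa using hV _)).trans ?_
    simp [ENNReal.ofReal]
  have := hsub.exists_ae_tendsto_of_bdd hb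
  filter_upwards [this] with r ⟨l, hl⟩
  refine ⟨l, ?_⟩
  have : (fun n => V (pf r (L + n))) = fun n => (fun n => V (pf r n)) (n + L) := by
    funext n; simp only [add_comm]
  rw [this] at hl
  exact (Filter.tendsto_add_atTop_iff_nat L).1 hl

end StochGame
end

section
open scoped ENNReal NNReal Classical
open MeasureTheory Filter

namespace StochGame
variable {G : StochGame}

/-- not yet exited (strictly before or at the current history), counting from length `L` -/
def Alive (Ex : Set G.History) (L : ℕ) (h' : G.History) : Prop :=
  ∀ k, L ≤ k → k ≤ h'.2.length → tk h' k ∉ Ex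

theorem Alive_sn {Ex : Set G.History} {L : ℕ} {h' : G.History} {e : G.Ev} (hL : L ≤ h'.2.length) :
    Alive Ex L (sn h' e) ↔ Alive Ex L h' ∧ sn h' e ∉ Ex := by
  constructor
  · intro H
    refine ⟨fun k h1 h2 => ?_, ?_⟩
    · rw [← tk_sn h' e h2]; exact H k h1 (by rw [sn_len]; omega)
    · have := H (h'.2.length + 1) (by omega) (by rw [sn_len])
      rwa [tk_self _ (by rw [sn_len])] at this
  · rintro ⟨h1, h2⟩ k h3 h4
    rw [sn_len] at h4
    rcases Nat.lt_or_ge h'.2.length k with h5 | h5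
    · rwa [tk_self _ (by rw [sn_len]; omega)]
    · rw [tk_sn h' e h5]; exact h1 k h3 h5

theorem Alive_pf {Ex : Set G.History} {L : ℕ} {r : G.Run} {n : ℕ} :
    Alive Ex L (pf r n) ↔ ∀ k, L ≤ k → k ≤ n → pf r k ∉ Ex := by
  simp only [Alive, pf_len]
  refine forall_congr' fun k => forall_congr' fun _ => forall_congr' fun hk => ?_
  rw [tk_pf r hk]

variable {P : G.History → G.Profile → Measure G.Run} (hP : IsInducedFamily G P)
include hP

theorem E_sub_mono (σ : G.Profile) (h : G.History) {V : G.History → ℝ} {C : ℝ} (hV : ∀ h, |V h| ≤ C)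
    (H : ∀ h', Ext h h' → os (lastState h') (xr σ h') (fun e => V (sn h' e)) ≤ V h') (k : ℕ) :
    ∫ r, V (pf r (h.2.length + k)) ∂(P h σ) ≤ V h := by
  haveI := hP.1 h σ
  induction k with
  | zero =>
    refine le_of_eq ((integral_congr_ae (g := fun _ => V h) ?_).trans (by simp))
    filter_upwards [ae_cyl hP h σ] with r hr
    rw [add_zero, hr]
  | succ k ih =>
    refine le_trans ?_ ih
    rw [← add_assoc, E_op hP σ hV h (by omega)]
    refine integral_mono_ae (P_integrable hP h σ (measurable_pf _ (fun h' => os (lastState h') (xr σ h') (fun e => V (sn h' e)))) (C := C) fun r => os_abs (xr_mix _ _) fun e => hV _) (P_integrable hP h σ (measurable_pf _ V) fun r => hV _) ?_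
    filter_upwards [ae_cyl hP h σ] with r hr
    exact H _ (Ext_pf hr (by omega))

/-- The verification lemma. -/
theorem VL (σ : G.Profile) (h : G.History) {f : G.Run → ℝ} (hf : Measurable f) {C : ℝ} (hfC : ∀ r, |f r| ≤ C)
    {V : G.History → ℝ} (hV : ∀ h, |V h| ≤ C) (Ex : Set G.History)
    (h1 : ∀ h', Ext h h' → Alive Ex h.2.length h' →
      os (lastState h') (xr σ h') (fun e => V (sn h' e)) ≤ V h')
    (h2 : ∀ h', Ext h h' → h' ∈ Ex → (∀ k, h.2.length ≤ k → k < h'.2.length → tk h' k ∉ Ex) →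
      ∫ r, f r ∂(P h' σ) ≤ V h')
    (h3 : ∀ᵐ r ∂(P h σ), (∀ n, h.2.length ≤ n → pf r n ∉ Ex) → ∀ δ > 0, ∃ᶠ n in atTop, f r ≤ V (pf r n) + δ) :
    ∫ r, f r ∂(P h σ) ≤ V h := by
  haveI := hP.1 h σ
  set L := h.2.length with hL
  let W : G.History → ℝ := fun h' => if Alive Ex L h' then V h' else ∫ r, f r ∂(P h' σ)
  have hW : ∀ h', |W h'| ≤ C := fun h' => by
    simp only [W]; split_ifs
    · exact hV h'
    · exact E_abs hP h' σ hfC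
  have hsup : ∀ h', Ext h h' → os (lastState h') (xr σ h') (fun e => W (sn h' e)) ≤ W h' := by
    intro h' hh'
    have hl := Ext_len hh'
    by_cases ha : Alive Ex L h'
    · have e1 : W h' = V h' := by simp only [W, ha, if_true]
      rw [e1]
      refine le_trans (os_mono (xr_mix _ _) (fun e => hW _) (fun e => hV _) fun e => ?_) (h1 h' hh' ha)
      simp only [W]
      by_cases hb : Alive Ex L (sn h' e)
      · simp only [hb, if_true, le_refl]
      · simp only [hb, if_false]
        have hx : sn h' e ∈ Ex := by
          by_contra hx; exact hb ((Alive_sn hl).2 ⟨ha, hx⟩)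
        refine h2 _ (Ext_trans hh' (Ext_sn _ _)) hx fun k hk1 hk2 => ?_
        rw [sn_len] at hk2
        rw [tk_sn _ _ (by omega)]
        exact ha k hk1 (by omega)
    · have e1 : W h' = ∫ r, f r ∂(P h' σ) := by simp only [W, ha, if_false]
      have e2 : ∀ e, W (sn h' e) = ∫ r, f r ∂(P (sn h' e) σ) := fun e => by
        have : ¬ Alive Ex L (sn h' e) := fun hb => ha ((Alive_sn hl).1 hb).1
        simp only [W, this, if_false]
      rw [e1]; simp only [e2]
      rw [← E_step hP h' σ hf hfC]
  have hWh : W h ≤ V h := by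
    simp only [W]
    split_ifs with ha
    · exact le_rfl
    · have hx : h ∈ Ex := by
        by_contra hx
        refine ha fun k hk1 hk2 => ?_
        rwa [tk_self _ hk1]
      exact h2 h (Ext_refl h) hx fun k hk1 hk2 => by omega
  have hmono := E_sub_mono hP σ h hW hsup
  have hconv : ∀ᵐ r ∂(P h σ), ∃ l, Tendsto (fun n => W (pf r n)) atTop (nhds l) := by
    have := sub_conv hP σ h (V := fun h => (-1) * W h) (C := C) (fun h => by simpa using hW h) (fun h' hh' => by
      rw [os_mul]; linarith [hsup h' hh'])
    filter_upwards [this] with r ⟨l, hl⟩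
    exact ⟨-l, by simpa using hl.neg⟩
  let ind : G.History → ℝ := fun h' => if Alive Ex L h' then 1 else 0
  have hind : ∀ h', |ind h'| ≤ 1 := fun h' => by simp only [ind]; split_ifs <;> simp
  have hind' : ∀ h', |1 - ind h'| ≤ 1 := fun h' => by simp only [ind]; split_ifs <;> simp
  let F : ℕ → G.Run → ℝ := fun n r => ind (pf r (L + n)) * (f r - W (pf r (L + n)))
  have hFm : ∀ n, Measurable (F n) := fun n => (measurable_pf _ ind).mul (hf.sub (measurable_pf _ W))
  have hFb : ∀ n r, |F n r| ≤ 1 * (2 * C) := fun n r => by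
    simp only [F]; rw [abs_mul]
    refine mul_le_mul (hind _) ?_ (abs_nonneg _) (by norm_num)
    have a := abs_le.1 (hfC r); have b := abs_le.1 (hW (pf r (L + n)))
    rw [abs_le]; constructor <;> linarith
  have hkey : ∀ n, ∫ r, f r ∂(P h σ) ≤ V h + ∫ r, F n r ∂(P h σ) := by
    intro n
    have i1 := P_integrable hP h σ hf hfC
    have i2 := P_integrable hP h σ (measurable_pf (L + n) W) fun r => hW _
    have i3 := P_integrable hP h σ (hFm n) (hFb n)
    have e1 := E_ind hP σ hf hfC hind' h (n := L + n) (by omega)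
    have e2 : ∫ r, (1 - ind (pf r (L + n))) * (∫ r', f r' ∂(P (pf r (L + n)) σ)) ∂(P h σ)
        = ∫ r, (1 - ind (pf r (L + n))) * W (pf r (L + n)) ∂(P h σ) := by
      congr 1; funext r
      simp only [ind, W]; split_ifs <;> simp
    rw [e2] at e1
    have e3 : ∫ r, (f r - W (pf r (L + n))) ∂(P h σ) = ∫ r, F n r ∂(P h σ) := by
      have e4 : ∀ r, F n r = (f r - W (pf r (L + n))) - ((1 - ind (pf r (L + n))) * f r - (1 - ind (pf r (L + n))) * W (pf r (L + n))) := by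
        intro r; simp only [F]; ring
      have j1 : Integrable (fun r => (1 - ind (pf r (L + n))) * f r) (P h σ) :=
        P_integrable hP h σ ((measurable_pf _ (fun h => 1 - ind h)).mul hf) (C := 1 * C) fun r => by
          rw [abs_mul]; exact mul_le_mul (hind' _) (hfC _) (abs_nonneg _) (by norm_num)
      have j2 : Integrable (fun r => (1 - ind (pf r (L + n))) * W (pf r (L + n))) (P h σ) :=
        P_integrable hP h σ (measurable_pf _ (fun h => (1 - ind h) * W h)) (C := 1 * C) fun r => by
          rw [abs_mul]; exact mul_le_mul (hind' _) (hW _) (abs_nonneg _) (by norm_num)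
      simp only [e4]
      have j3 := integral_sub (i1.sub i2) (j1.sub j2)
      simp only [Pi.sub_apply] at j3
      rw [j3, integral_sub j1 j2, e1, sub_self, sub_zero]
    rw [integral_sub i1 i2] at e3
    linarith [hmono n]
  -- limit
  let Flim : G.Run → ℝ := fun r => if h : ∃ l, Tendsto (fun n => F n r) atTop (nhds l) then h.choose else 0
  have hlim : ∀ᵐ r ∂(P h σ), Tendsto (fun n => F n r) atTop (nhds (Flim r)) ∧ Flim r ≤ 0 := by
    filter_upwards [hconv, h3] with r ⟨l, hl⟩ hr
    have hl' : Tendsto (fun n => W (pf r (L + n))) atTop (nhds l) := by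
      have := (tendsto_add_atTop_iff_nat L).2 hl
      simpa only [add_comm] using this
    have hex : ∃ m, m ≤ 0 ∧ Tendsto (fun n => F n r) atTop (nhds m) := by
      by_cases hn : ∀ n, L ≤ n → pf r n ∉ Ex
      · have ha : ∀ n, Alive Ex L (pf r n) := fun n => Alive_pf.2 fun k hk _ => hn k hk
        have e1 : ∀ n, F n r = f r - W (pf r (L + n)) := fun n => by simp only [F, ind, ha, if_true, one_mul]
        refine ⟨f r - l, ?_, ?_⟩
        · rw [sub_nonpos]
          refine le_of_forall_pos_le_add fun δ hδ => ?_
          have e2 : (fun n => W (pf r n)) = fun n => V (pf r n) := by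
            funext n; simp only [W, ha, if_true]
          rw [e2] at hl
          by_contra hc
          push Not at hc
          have : ∀ᶠ n in atTop, V (pf r n) < l + δ / 2 := hl.eventually (gt_mem_nhds (by linarith))
          obtain ⟨n, h5, h6⟩ := ((hr hn (δ / 2) (by linarith)).and_eventually this).exists
          linarith
        · simp only [e1]
          exact tendsto_const_nhds.sub hl'
      · push Not at hn
        obtain ⟨n, h5, h6⟩ := hn
        refine ⟨0, le_rfl, tendsto_const_nhds.congr' ?_⟩
        filter_upwards [eventually_ge_atTop n] with m hm
        have : ¬ Alive Ex L (pf r (L + m)) := fun hb => Alive_pf.1 hb n h5 (by omega) h6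
        simp only [F, ind, this, if_false, zero_mul]
    obtain ⟨m, hm, hm2⟩ := hex
    have hex2 : ∃ l, Tendsto (fun n => F n r) atTop (nhds l) := ⟨m, hm2⟩
    have e : Flim r = m := by
      simp only [Flim, hex2, dif_pos]
      exact tendsto_nhds_unique hex2.choose_spec hm2
    rw [e]; exact ⟨hm2, hm⟩
  have hT := tendsto_integral_of_dominated_convergence (μ := P h σ) (F := F) (f := Flim) (fun _ => 1 * (2 * C))
    (fun n => (hFm n).aestronglyMeasurable) (integrable_const _)
    (fun n => Eventually.of_forall fun r => by simpa using hFb n r) (hlim.mono fun r hr => hr.1)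
  have hle : ∫ r, Flim r ∂(P h σ) ≤ 0 := integral_nonpos_of_ae (hlim.mono fun r hr => hr.2)
  have := ge_of_tendsto' (hT.const_add (V h)) hkey
  linarith

/-- summability of non-negative increments -/
theorem drift_summable (σ : G.Profile) (h : G.History) {V A B : G.History → ℝ} {C : ℝ} (hV : ∀ h, |V h| ≤ C)
    (hA : ∀ h, |A h| ≤ C) (hB : ∀ h, |B h| ≤ C) (hA0 : ∀ h, 0 ≤ A h) (hB0 : ∀ h, 0 ≤ B h)
    (H : ∀ h', Ext h h' → V h' + B h' ≤ os (lastState h') (xr σ h') (fun e => V (sn h' e) - A (sn h' e))) :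
    ∀ᵐ r ∂(P h σ), Summable (fun n => B (pf r n) + A (pf r (n + 1))) := by
  haveI := hP.1 h σ
  set L := h.2.length with hL
  let g : ℕ → G.Run → ℝ := fun n r => B (pf r (L + n)) + A (pf r (L + n + 1))
  have hgm : ∀ n, Measurable (g n) := fun n => (measurable_pf _ B).add (measurable_pf _ A)
  have hg0 : ∀ n r, 0 ≤ g n r := fun n r => add_nonneg (hB0 _) (hA0 _)
  have hgb : ∀ n r, |g n r| ≤ C + C := fun n r => (abs_add_le _ _).trans (add_le_add (hB _) (hA _))
  have hgi : ∀ n, Integrable (g n) (P h σ) := fun n => P_integrable hP h σ (hgm n) (hgb n)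
  have hVi : ∀ n, Integrable (fun r => V (pf r n)) (P h σ) := fun n => P_integrable hP h σ (measurable_pf _ V) fun r => hV _
  have hAi : ∀ n, Integrable (fun r => A (pf r n)) (P h σ) := fun n => P_integrable hP h σ (measurable_pf _ A) fun r => hA _
  have hBi : ∀ n, Integrable (fun r => B (pf r n)) (P h σ) := fun n => P_integrable hP h σ (measurable_pf _ B) fun r => hB _
  have hstep : ∀ n, ∫ r, g n r ∂(P h σ) ≤ ∫ r, V (pf r (L + n + 1)) ∂(P h σ) - ∫ r, V (pf r (L + n)) ∂(P h σ) := by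
    intro n
    have hVA : ∀ h, |V h - A h| ≤ C + C := fun h => (abs_sub _ _).trans (add_le_add (hV _) (hA _))
    have e := E_op hP σ hVA h (n := L + n) (by omega)
    have h1 : ∫ r, (V (pf r (L + n)) + B (pf r (L + n))) ∂(P h σ) ≤ ∫ r, V (pf r (L + n + 1)) - A (pf r (L + n + 1)) ∂(P h σ) := by
      rw [e]
      refine integral_mono_ae ((hVi _).add (hBi _)) (P_integrable hP h σ (measurable_pf _ (fun h' => os (lastState h') (xr σ h') (fun e => V (sn h' e) - A (sn h' e)))) (C := C + C) fun r => os_abs (xr_mix _ _) fun e => hVA _) ?_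
      filter_upwards [ae_cyl hP h σ] with r hr
      exact H _ (Ext_pf hr (by omega))
    rw [integral_add (hVi _) (hBi _), integral_sub (hVi _) (hAi _)] at h1
    simp only [g]
    rw [integral_add (hBi _) (hAi _)]
    linarith
  have hsum : ∀ n, ∑ k ∈ Finset.range n, ∫ r, g k r ∂(P h σ) ≤ 2 * C := by
    intro n
    have : ∑ k ∈ Finset.range n, ∫ r, g k r ∂(P h σ) ≤ ∫ r, V (pf r (L + n)) ∂(P h σ) - ∫ r, V (pf r (L + 0)) ∂(P h σ) := by
      rw [← Finset.sum_range_sub (fun n => ∫ r, V (pf r (L + n)) ∂(P h σ))]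
      exact Finset.sum_le_sum fun k _ => hstep k
    have a := abs_le.1 (E_abs hP h σ (g := fun r => V (pf r (L + n))) fun r => hV _)
    have b := abs_le.1 (E_abs hP h σ (g := fun r => V (pf r (L + 0))) fun r => hV _)
    linarith
  have hlin : ∫⁻ r, ∑' n, ENNReal.ofReal (g n r) ∂(P h σ) ≠ ⊤ := by
    rw [lintegral_tsum fun n => (hgm n).ennreal_ofReal.aemeasurable]
    have : ∀ n, ∫⁻ r, ENNReal.ofReal (g n r) ∂(P h σ) = ENNReal.ofReal (∫ r, g n r ∂(P h σ)) := fun n =>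
      (ofReal_integral_eq_lintegral_ofReal (hgi n) (Eventually.of_forall (hg0 n))).symm
    simp only [this]
    refine ne_top_of_le_ne_top (ENNReal.ofReal_ne_top (r := 2 * C)) ?_
    refine ENNReal.tsum_le_of_sum_range_le fun n => ?_
    rw [← ENNReal.ofReal_sum_of_nonneg fun k _ => integral_nonneg (hg0 k)]
    exact ENNReal.ofReal_le_ofReal (hsum n)
  have hae := ae_lt_top (Measurable.ennreal_tsum fun n => (hgm n).ennreal_ofReal) hlin
  filter_upwards [hae] with r hr
  have h1 := ENNReal.summable_toReal hr.ne
  have h2 : Summable (fun n => g n r) := by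
    refine h1.congr fun n => ?_
    rw [ENNReal.toReal_ofReal (hg0 n r)]
  refine (summable_nat_add_iff L).1 (h2.congr fun n => ?_)
  simp only [g, add_comm n L]

end StochGame
end

section
open scoped ENNReal NNReal Classical
open MeasureTheory Filter

namespace StochGame
variable {G : StochGame}

theorem lastState_cons (s : G.S) (e : G.Ev) (l : List G.Ev) :
    lastState (G := G) (s, e :: l) = lastState (G := G) (e.2, l) := by
  cases l with
  | nil => simp [lastState]
  | cons e' l =>
    simp only [lastState, List.getLast?_cons_cons]
    rw [List.getLast?_eq_some_getLast (List.cons_ne_nil e' l)]; rfl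

theorem lastState_cat (h : G.History) (l : List G.Ev) :
    lastState (G := G) (lastState h, l) = lastState (catH h l) := by
  rcases List.eq_nil_or_concat l with rfl | ⟨l', e, rfl⟩
  · rw [catH_nil]; simp [lastState]
  · simp [lastState, catH]

theorem ValidFrom_snoc (l : List G.Ev) (e : G.Ev) : ∀ s : G.S,
    ValidFrom G s (l ++ [e]) ↔ ValidFrom G s l ∧ G.trans (lastState (G := G) (s, l)) e.1 e.2 ≠ 0 := by
  induction l with
  | nil => intro s; simp [ValidFrom, lastState]
  | cons e' l ih =>
    intro s
    obtain ⟨a, t⟩ := e'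
    simp only [List.cons_append, ValidFrom, ih, lastState_cons, and_assoc]

theorem Valid_sn (h : G.History) (e : G.Ev) :
    Valid (sn h e) ↔ Valid h ∧ G.trans (lastState h) e.1 e.2 ≠ 0 := ValidFrom_snoc h.2 e h.1

theorem lastState_pf (r : G.Run) (n : ℕ) : lastState (pf r n) = stateAt r n := by
  cases n with
  | zero => simp [pf, lastState, stateAt]
  | succ n => rw [pf_succ, lastState_sn]; rfl

theorem RunValid_iff (r : G.Run) : RunValid r ↔ ∀ n, Valid (pf r n) := by
  constructor
  · intro H n
    induction n with
    | zero => simp [Valid, pf, ValidFrom]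
    | succ n ih => rw [pf_succ, Valid_sn, lastState_pf]; exact ⟨ih, H n⟩
  · intro H n
    have := H (n + 1)
    rw [pf_succ, Valid_sn, lastState_pf] at this
    exact this.2

theorem Valid_tk {h : G.History} (hv : Valid h) (k : ℕ) : Valid (tk h k) := by
  rcases Nat.lt_or_ge k h.2.length with hk | hk
  · obtain ⟨s, l⟩ := h
    simp only [Valid, tk] at *
    rw [← List.take_append_drop k l] at hv
    generalize l.take k = a at *
    generalize l.drop k = b at *
    clear hk
    induction a generalizing s with
    | nil => trivial
    | cons e a ih => obtain ⟨a', t⟩ := e; exact ⟨hv.1, ih _ hv.2⟩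
  · rwa [tk_self h hk]

/-- the shifted profile -/
def shP (h : G.History) (σ : G.Profile) : G.Profile := fun i h' => σ i (catH h h'.2)

/-- prepend -/
def pre (h : G.History) (r : G.Run) : G.Run :=
  (h.1, fun k => if hk : k < h.2.length then h.2[k] else r.2 (k - h.2.length))

theorem pf_pre (h : G.History) (r : G.Run) (n : ℕ) : pf (pre h r) (h.2.length + n) = catH h (pf r n).2 := by
  simp only [pf, pre, catH, Prod.mk.injEq, true_and]
  apply List.ext_getElem
  · simp
  · intro k h1 h2
    simp only [List.getElem_map, List.getElem_range]
    split_ifs with hk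
    · rw [List.getElem_append_left hk]
    · rw [List.getElem_append_right (by omega)]; simp

theorem pf_pre' (h : G.History) (r : G.Run) : pf (pre h r) h.2.length = h := by
  have := pf_pre h r 0
  rw [add_zero] at this
  rw [this]; simp [pf, catH]

theorem measurable_pre (h : G.History) : Measurable (pre h) := by
  refine Measurable.prodMk measurable_const (measurable_pi_lambda _ fun k => ?_)
  by_cases hk : k < h.2.length
  · simp only [hk, dif_pos]; exact measurable_const
  · simp only [hk, dif_neg, not_false_eq_true]
    exact (measurable_pi_apply _).comp measurable_snd

theorem contProb_shP (h : G.History) (σ : G.Profile) (l : List G.Ev) : ∀ l0,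
    contProb (shP h σ) (lastState h, l0) l = contProb σ (catH h l0) l := by
  induction l with
  | nil => intro l0; rfl
  | cons e l ih =>
    intro l0
    obtain ⟨a, t⟩ := e
    simp only [contProb, lastState_cat]
    have h2 : snocH (G := G) (lastState h, l0) a t = (lastState h, l0 ++ [(a, t)]) := rfl
    have h3 : snocH (catH h l0) a t = catH h (l0 ++ [(a, t)]) := by simp [snocH, catH]
    rw [h2, h3, ih]; rfl

theorem shift_iter {f : G.Run → ℝ} (hshift : ∀ r : G.Run, RunValid r → f r = f (shiftRun r)) (n : ℕ) :
    ∀ r : G.Run, RunValid r → f r = f (stateAt r n, fun k => r.2 (k + n)) := by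
  induction n with
  | zero => intro r _; rfl
  | succ n ih =>
    intro r hr
    rw [hshift r hr]
    have hr' : RunValid (shiftRun r) := fun k => by
      have := hr (k + 1)
      cases k with
      | zero => exact this
      | succ k => exact this
    rw [ih _ hr']
    congr 1
    refine Prod.ext ?_ ?_
    · cases n <;> rfl
    · funext k; rfl

variable {P : G.History → G.Profile → Measure G.Run} (hP : IsInducedFamily G P)
include hP

theorem ae_valid (σ : G.Profile) (h : G.History) (hv : Valid h) : ∀ᵐ r ∂(P h σ), RunValid r := by
  haveI := hP.1 h σ
  let bad : G.History → ℝ := fun h' => if ∃ g e, h' = sn g e ∧ G.trans (lastState g) e.1 e.2 = 0 then 1 else 0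
  have hb : ∀ h', |bad h'| ≤ 1 := fun h' => by simp only [bad]; split_ifs <;> simp
  have hb0 : ∀ h', 0 ≤ bad h' := fun h' => by simp only [bad]; split_ifs <;> simp
  have h1 : ∀ n, h.2.length ≤ n → ∀ᵐ r ∂(P h σ), bad (pf r (n + 1)) = 0 := by
    intro n hn
    have e := E_op hP σ hb h hn
    have e2 : ∫ r, bad (pf r (n + 1)) ∂(P h σ) = 0 := by
      rw [e]
      refine (integral_congr_ae (g := fun _ => (0 : ℝ)) (Eventually.of_forall fun r => ?_)).trans (by simp)
      refine le_antisymm ?_ ?_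
      · dsimp only
        rw [← os_const (xr_mix σ (pf r n)) (s := lastState (pf r n)) 0]
        refine os_mono' (xr_mix _ _) (fun e => hb _) (C' := 0) (by simp) fun e he => ?_
        simp only [bad]
        rw [if_neg]
        rintro ⟨g, e', h3, h4⟩
        have := sn_inj h3
        rw [← this.1, ← this.2] at h4; exact he h4
      · dsimp only
        rw [← os_const (xr_mix σ (pf r n)) (s := lastState (pf r n)) 0]
        exact os_mono (xr_mix _ _) (C := 0) (by simp) (fun e => hb _) fun e => hb0 _
    have e3 := (integral_eq_zero_iff_of_nonneg (fun r => hb0 _) (P_integrable hP h σ (measurable_pf _ bad) fun r => hb _)).1 e2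
    exact e3
  have h2 : ∀ᵐ r ∂(P h σ), ∀ n, h.2.length ≤ n → bad (pf r (n + 1)) = 0 := by
    rw [ae_all_iff]; intro n
    by_cases hn : h.2.length ≤ n
    · filter_upwards [h1 n hn] with r hr _ using hr
    · exact Eventually.of_forall fun r h => absurd h hn
  filter_upwards [h2, ae_cyl hP h σ] with r hr hc
  rw [RunValid_iff]
  intro n
  rcases le_total n h.2.length with hn | hn
  · rw [← tk_pf r hn, hc]; exact Valid_tk hv n
  · induction n, hn using Nat.le_induction with
    | base => rw [hc]; exact hv
    | succ n hn ih =>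
      rw [pf_succ, Valid_sn]
      refine ⟨ih, fun h0 => ?_⟩
      have := hr n hn
      simp only [bad] at this
      rw [if_pos ⟨pf r n, r.2 n, pf_succ r n, h0⟩] at this
      norm_num at this

theorem P_pre (σ : G.Profile) (h : G.History) :
    (P (initH G (lastState h)) (shP h σ)).map (pre h) = P h σ := by
  haveI := hP.1 (initH G (lastState h)) (shP h σ)
  haveI : IsProbabilityMeasure ((P (initH G (lastState h)) (shP h σ)).map (pre h)) :=
    Measure.isProbabilityMeasure_map (measurable_pre h).aemeasurable
  refine P_eq hP h σ _ fun l => ?_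
  rw [Measure.map_apply (measurable_pre h) (measurableSet_cyl _)]
  have e1 := hP.2 (initH G (lastState h)) (shP h σ) l
  have e2 := contProb_shP h σ l []
  rw [catH_nil] at e2
  rw [← e2]
  refine Eq.trans (measure_congr ?_) e1
  filter_upwards [ae_cyl hP (initH G (lastState h)) (shP h σ)] with r hr
  have hr1 : r.1 = lastState h := congrArg Prod.fst hr
  apply propext
  change pre h r ∈ cyl (catH h l) ↔ r ∈ cyl (catH (initH G (lastState h)) l)
  rw [mem_cyl, mem_cyl]
  have h3 : (catH h l).2.length = h.2.length + l.length := by simp [catH]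
  have h4 : (catH (initH G (lastState h)) l).2.length = l.length := by simp [catH, initH]
  rw [h3, h4, pf_pre]
  constructor
  · intro h5
    have := congrArg Prod.snd h5
    simp only [catH, List.append_cancel_left_eq] at this
    refine Prod.ext hr1 ?_
    rw [this]; simp [catH, initH]
  · intro h5
    rw [h5]; simp [catH, initH]

theorem transport (σ : G.Profile) (h : G.History) (hv : Valid h) {f : G.Run → ℝ} (hf : Measurable f)
    (hshift : ∀ r : G.Run, RunValid r → f r = f (shiftRun r)) :
    ∫ r, f r ∂(P h σ) = ∫ r, f r ∂(P (initH G (lastState h)) (shP h σ)) := by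
  have h1 := ae_valid hP σ h hv
  rw [← P_pre hP σ h] at h1 ⊢
  rw [integral_map (measurable_pre h).aemeasurable hf.aestronglyMeasurable]
  refine integral_congr_ae ?_
  filter_upwards [ae_of_ae_map (measurable_pre h).aemeasurable h1, ae_cyl hP (initH G (lastState h)) (shP h σ)] with r hr hr2
  have hr1 : r.1 = lastState h := congrArg Prod.fst hr2
  rw [shift_iter hshift h.2.length _ hr]
  congr 1
  refine Prod.ext ?_ ?_
  · simp only
    rw [← lastState_pf, pf_pre', hr1]
  · funext k
    simp [pre]

end StochGame
end

section
open scoped ENNReal NNReal Classical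
open MeasureTheory Filter

namespace StochGame
variable {G : StochGame}

theorem mix_update {x : ∀ i, G.A i → ℝ} (hx : x ∈ Mix G) (i : G.I) (c : G.A i) :
    Function.update x i (Pi.single c 1) ∈ Mix G := by
  intro j
  by_cases hj : j = i
  · subst hj
    rw [Function.update_self]; exact single_mem_stdSimplex ℝ c
  · rw [Function.update_of_ne hj]; exact hx j

theorem osA_eq {s : G.S} {x : ∀ i, G.A i → ℝ} (hx : x ∈ Mix G) (i : G.I) (c : G.A i) (d : G.Ev → ℝ) :
    osA s x i c d = os s (Function.update x i (Pi.single c 1)) d := by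
  rw [os_resample hx (i := i) (fun j hj => Function.update_of_ne hj _ _)]
  rw [Function.update_self, Finset.sum_eq_single c]
  · simp
  · intro b _ hb; rw [Pi.single_eq_of_ne hb, zero_mul]
  · intro h; exact absurd (Finset.mem_univ c) h

theorem mix_nonempty (G : StochGame) : ∃ x : ∀ i, G.A i → ℝ, x ∈ Mix G :=
  ⟨fun i => Pi.single (Classical.arbitrary _) 1, fun i => single_mem_stdSimplex ℝ _⟩

/-- Player `i` can guarantee `w` in the one-shot game, whatever the opponents mix. -/
def M1at (i : G.I) (s : G.S) (w : ℝ) (d : G.Ev → ℝ) : Prop :=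
  ∀ x ∈ Mix G, ∃ c, w ≤ osA s x i c d

theorem M1at_const {i : G.I} {s : G.S} {w : ℝ} {d : G.Ev → ℝ} {C : ℝ} (hd : ∀ e, |d e| ≤ C) (h : ∀ e, w ≤ d e) :
    M1at i s w d := by
  intro x hx
  refine ⟨Classical.arbitrary _, ?_⟩
  rw [osA_eq hx, ← os_const (s := s) (mix_update hx i (Classical.arbitrary _)) w]
  exact os_mono (mix_update hx i _) (C := |w|) (fun _ => le_rfl) hd h

theorem M1at_mono {i : G.I} {s : G.S} {w w' : ℝ} {d d' : G.Ev → ℝ} {C : ℝ} (hd : ∀ e, |d e| ≤ C)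
    (hd' : ∀ e, |d' e| ≤ C) (h : ∀ e, d e ≤ d' e) (hw : w' ≤ w) (H : M1at i s w d) : M1at i s w' d' := by
  intro x hx
  obtain ⟨c, hc⟩ := H x hx
  refine ⟨c, hw.trans (hc.trans ?_)⟩
  rw [osA_eq hx, osA_eq hx]
  exact os_mono (mix_update hx i _) hd hd' h

/-- moves of the auxiliary game -/
abbrev MV (G : StochGame) := (G.Ev → ℝ) × G.Ev

/-- current history and current value -/
def st (h0 : G.History) (w : ℝ) : List G.MV → G.History × ℝ
  | [] => (h0, w)
  | [_] => (h0, w)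
  | m2 :: m1 :: p => (sn (st h0 w p).1 m2.2, m1.1 m2.2)

/-- legal moves of the auxiliary game -/
def Leg (i : G.I) (h0 : G.History) (w : ℝ) (p : List G.MV) (m : G.MV) : Prop :=
  (p.length.bodd = false → (∀ e, 0 ≤ m.1 e ∧ m.1 e ≤ 1) ∧
    M1at i (lastState (st h0 w p).1) (st h0 w p).2 m.1) ∧
  (p.length.bodd = true → ∃ m1 q, p = m1 :: q ∧ 0 < m1.1 m.2)

/-- legal positions -/
def TT (i : G.I) (h0 : G.History) (w : ℝ) : List G.MV → Prop
  | [] => True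
  | m :: p => TT i h0 w p ∧ Leg i h0 w p m

theorem bodd_cases (n : ℕ) : n.bodd = false ∨ n.bodd = true := by cases n.bodd <;> simp

theorem TT_st {i : G.I} {h0 : G.History} {w : ℝ} (hw0 : 0 < w) (hw1 : w ≤ 1) : ∀ p : List G.MV,
    p.length.bodd = false → TT i h0 w p → 0 < (st h0 w p).2 ∧ (st h0 w p).2 ≤ 1
  | [], _, _ => ⟨hw0, hw1⟩
  | [_], h, _ => by simp at h
  | m2 :: m1 :: p, h, hT => by
    have hp : p.length.bodd = false := by simpa [Nat.bodd_succ] using h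
    obtain ⟨⟨_, h1⟩, h2⟩ := hT
    obtain ⟨m1', q, h3, h4⟩ := h2.2 (by simp [Nat.bodd_succ, hp])
    simp only [List.cons.injEq] at h3
    rw [← h3.1] at h4
    exact ⟨h4, ((h1.1 hp).1 _).2⟩

theorem TT_ext {i : G.I} {h0 : G.History} {w : ℝ} (hw0 : 0 < w) (hw1 : w ≤ 1) (p : List G.MV)
    (hT : TT i h0 w p) : ∃ m, TT i h0 w (m :: p) := by
  rcases bodd_cases p.length with hb | hb
  · refine ⟨(fun _ => 1, Classical.arbitrary _), hT, fun _ => ⟨fun e => by norm_num, ?_⟩, fun h => ?_⟩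
    · exact M1at_const (C := 1) (by simp) fun e => (TT_st hw0 hw1 p hb hT).2
    · rw [hb] at h; cases h
  · cases p with
    | nil => simp at hb
    | cons m1 p =>
      have hp : p.length.bodd = false := by simpa [Nat.bodd_succ] using hb
      obtain ⟨hT1, hl⟩ := hT
      obtain ⟨h1, h2⟩ := hl.1 hp
      by_contra hc
      push Not at hc
      have h3 : ∀ e, m1.1 e ≤ 0 := by
        intro e
        by_contra h4
        push Not at h4
        refine hc ((fun _ => 1), e) ⟨⟨hT1, hl⟩, fun h => ?_, fun _ => ⟨m1, p, rfl, h4⟩⟩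
        rw [hb] at h; cases h
      obtain ⟨x, hx⟩ := mix_nonempty G
      obtain ⟨c, hc2⟩ := h2 x hx
      have h5 : osA (lastState (st h0 w p).1) x i c m1.1 ≤ 0 := by
        rw [osA_eq hx, ← os_const (s := lastState (st h0 w p).1) (mix_update hx i c) 0]
        exact os_mono (mix_update hx i _) (C := 1) (C' := 0) (fun e => abs_le.2 ⟨by linarith [(h1 e).1], (h1 e).2⟩) (by simp) h3
      linarith [(TT_st hw0 hw1 p hp hT1).1]

/-- the auxiliary game -/
abbrev AG (i : G.I) (h0 : G.History) (w : ℝ) (hw0 : 0 < w) (hw1 : w ≤ 1) : BDet.Arena where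
  M := G.MV
  T := {p | TT i h0 w p}
  nil_mem := trivial
  tail_mem := fun _ _ h => h.1
  ext := fun p h => TT_ext hw0 hw1 p h

/-- run of the stochastic game associated to a play -/
noncomputable def rn (h0 : G.History) (x : ℕ → G.MV) : G.Run := pre h0 (h0.1, fun n => (x (2 * n + 1)).2)

/-- values along a play -/
def dn (x : ℕ → G.MV) (n : ℕ) : ℝ := (x (2 * n)).1 (x (2 * n + 1)).2

/-- winning set of player I -/
def WW (h0 : G.History) (f : G.Run → ℝ) : Set (ℕ → G.MV) :=
  {x | ∀ k : ℕ, ∃ N, ∀ n, N ≤ n → dn x n ≤ f (rn h0 x) + 1 / ((k : ℝ) + 1)}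

theorem pre_apply {M : Type} {x y : ℕ → M} {n : ℕ} (h : BDet.pre x n = BDet.pre y n) {k : ℕ} (hk : k < n) : x k = y k := by
  have := BDet.pre_eq_of_le hk h
  simp only [Nat.succ_eq_add_one, BDet.pre, List.cons.injEq] at this
  exact this.1

theorem WW_meas (h0 : G.History) {f : G.Run → ℝ} (hf : Measurable f) :
    MeasurableSet[MeasurableSpace.generateFrom (BDet.FinDep G.MV)] (WW h0 f) := by
  letI : MeasurableSpace (ℕ → G.MV) := MeasurableSpace.generateFrom (BDet.FinDep G.MV)
  have h1 : Measurable (rn h0) := by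
    refine (measurable_pre h0).comp (Measurable.prodMk measurable_const (measurable_pi_lambda _ fun n => ?_))
    intro B _
    refine MeasurableSpace.measurableSet_generateFrom ⟨2 * n + 2, fun x y hxy => ?_⟩
    simp only [Set.mem_preimage]
    rw [pre_apply hxy (show 2 * n + 1 < 2 * n + 2 by omega)]
  have h2 : ∀ n, Measurable (fun x : ℕ → G.MV => dn x n) := by
    intro n B _
    refine MeasurableSpace.measurableSet_generateFrom ⟨2 * n + 2, fun x y hxy => ?_⟩
    simp only [Set.mem_preimage, dn]
    rw [pre_apply hxy (show 2 * n + 1 < 2 * n + 2 by omega), pre_apply hxy (show 2 * n < 2 * n + 2 by omega)]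
  have : WW h0 f = ⋂ k : ℕ, ⋃ N : ℕ, ⋂ n : ℕ, ⋂ _ : N ≤ n, {x | dn x n ≤ f (rn h0 x) + 1 / ((k : ℝ) + 1)} := by
    ext x; simp only [WW, Set.mem_setOf_eq, Set.mem_iInter, Set.mem_iUnion, exists_prop]
  rw [this]
  refine MeasurableSet.iInter fun k => MeasurableSet.iUnion fun N => MeasurableSet.iInter fun n => MeasurableSet.iInter fun _ => ?_
  exact measurableSet_le (h2 n) ((hf.comp h1).add_const _)

/-- interleave -/
def il {M : Type} (a b : ℕ → M) (k : ℕ) : M := if k.bodd then b (k / 2) else a (k / 2)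

theorem il_even {M : Type} (a b : ℕ → M) (n : ℕ) : il a b (2 * n) = a n := by
  simp [il]

theorem il_odd {M : Type} (a b : ℕ → M) (n : ℕ) : il a b (2 * n + 1) = b n := by
  have : (2 * n + 1) / 2 = n := by omega
  simp [il, this]

theorem il_pre {M : Type} {a b : ℕ → M} {p : ℕ → List M} (h0 : p 0 = [])
    (h : ∀ n, p (n + 1) = b n :: a n :: p n) (n : ℕ) : BDet.pre (il a b) (2 * n) = p n := by
  induction n with
  | zero => rw [h0]; rfl
  | succ n ih =>
    rw [show 2 * (n + 1) = 2 * n + 1 + 1 by ring]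
    rw [BDet.pre, BDet.pre, ih, il_even, il_odd, h]

theorem il_isRun {G' : BDet.Arena} {a b : ℕ → G'.M} {p : ℕ → List G'.M} (h0 : p 0 = [])
    (h : ∀ n, p (n + 1) = b n :: a n :: p n) (hT : ∀ n, p n ∈ G'.T) : G'.IsRun (il a b) := by
  intro n
  have h1 := hT n
  rw [← il_pre h0 h n] at h1
  exact G'.suffix_mem (BDet.pre_suffix _ (by omega)) h1

end StochGame
end

section
open scoped ENNReal NNReal Classical
open MeasureTheory Filter

namespace StochGame
variable {G : StochGame}

theorem pre_tail {h : G.History} {r : G.Run} (hr : pf r h.2.length = h) (s : G.S) :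
    pre h (s, fun n => r.2 (h.2.length + n)) = r := by
  have hc := mem_cyl.2 hr
  refine Prod.ext hc.1.symm ?_
  funext k
  simp only [pre]
  split_ifs with hk
  · exact (hc.2 k hk).symm
  · rw [show h.2.length + (k - h.2.length) = k by omega]

/-- suffix of a history after the root -/
def sf (h0 h : G.History) : List G.Ev := h.2.drop h0.2.length

theorem sf_sn {h0 h : G.History} (hh : Ext h0 h) (e : G.Ev) : sf h0 (sn h e) = sf h0 h ++ [e] := by
  simp only [sf, snocH]
  rw [List.drop_append_of_le_length (Ext_len hh)]

theorem sf_self (h0 : G.History) : sf h0 h0 = [] := by simp [sf]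

theorem cat_sf {h0 h : G.History} (hh : Ext h0 h) : catH h0 (sf h0 h) = h := by
  have h1 := hh.2
  have h2 := List.prefix_iff_eq_append.1 h1
  exact Prod.ext hh.1 h2

/-- The conclusion of Martin's construction. -/
structure MD (i : G.I) (f : G.Run → ℝ) (h0 : G.History) (D : G.History → ℝ) : Prop where
  nonneg : ∀ h, 0 ≤ D h
  le_one : ∀ h, D h ≤ 1
  m1 : ∀ h, Ext h0 h → M1at i (lastState h) (D h) (fun e => D (sn h e))
  lim : ∀ r, pf r h0.2.length = h0 → ∀ δ > 0, ∀ᶠ n in atTop, D (pf r n) ≤ f r + δ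

/-- positions along player I strategy -/
def qI (σ : List G.MV → G.MV) (l : List G.Ev) : List G.MV := l.foldl (fun p e => (fun _ => 0, e) :: σ p :: p) []

theorem qI_snoc (σ : List G.MV → G.MV) (l : List G.Ev) (e : G.Ev) :
    qI σ (l ++ [e]) = (fun _ => 0, e) :: σ (qI σ l) :: qI σ l := by
  simp [qI, List.foldl_append]

theorem qI_bodd (σ : List G.MV → G.MV) (l : List G.Ev) : (qI σ l).length.bodd = false := by
  induction l using List.reverseRecOn with
  | nil => simp [qI]
  | append_singleton l e ih => rw [qI_snoc]; simp [Nat.bodd_succ, ih]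

theorem qI_st (σ : List G.MV → G.MV) (h0 : G.History) (w : ℝ) (l : List G.Ev) :
    (st h0 w (qI σ l)).1 = catH h0 l := by
  induction l using List.reverseRecOn with
  | nil => simp [qI, st, catH]
  | append_singleton l e ih =>
    rw [qI_snoc]; simp only [st, ih]; simp [catH, snocH]

theorem martin_I {i : G.I} {f : G.Run → ℝ} (hf0 : ∀ r, 0 ≤ f r) {h0 : G.History} {w : ℝ} (hw0 : 0 < w) (hw1 : w ≤ 1)
    {σ : List G.MV → G.MV} (hσ : (AG i h0 w hw0 hw1).Legal σ)
    (hwin : ∀ x, (AG i h0 w hw0 hw1).IsRun x → BDet.Cons false σ x → x ∈ WW h0 f) :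
    ∃ D, MD i f h0 D ∧ D h0 = w := by
  let D : G.History → ℝ := fun h => if TT i h0 w (qI σ (sf h0 h)) then (st h0 w (qI σ (sf h0 h))).2 else 0
  have hD0 : ∀ h, 0 ≤ D h := fun h => by
    simp only [D]; split_ifs with hT
    · exact (TT_st hw0 hw1 _ (qI_bodd _ _) hT).1.le
    · exact le_rfl
  have hD1 : ∀ h, D h ≤ 1 := fun h => by
    simp only [D]; split_ifs with hT
    · exact (TT_st hw0 hw1 _ (qI_bodd _ _) hT).2
    · norm_num
  have hDn : ∀ h, Ext h0 h → TT i h0 w (qI σ (sf h0 h)) → ∀ e, D (sn h e) = (σ (qI σ (sf h0 h))).1 e := by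
    intro h hh hT e
    have hl : Leg i h0 w (qI σ (sf h0 h)) (σ (qI σ (sf h0 h))) := (hσ _ hT).2
    have hl1 := hl.1 (qI_bodd _ _)
    simp only [D]
    rw [sf_sn hh, qI_snoc]
    split_ifs with hT2
    · rfl
    · by_contra hne
      apply hT2
      have hpos : 0 < (σ (qI σ (sf h0 h))).1 e := lt_of_le_of_ne (hl1.1 e).1 hne
      refine ⟨⟨hT, hl⟩, fun hb => ?_, fun _ => ⟨_, _, rfl, hpos⟩⟩
      simp [Nat.bodd_succ, qI_bodd] at hb
  refine ⟨D, ⟨hD0, hD1, ?_, ?_⟩, ?_⟩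
  · intro h hh
    by_cases hT : TT i h0 w (qI σ (sf h0 h))
    · have hl : Leg i h0 w (qI σ (sf h0 h)) (σ (qI σ (sf h0 h))) := (hσ _ hT).2
      have hl1 := (hl.1 (qI_bodd _ _)).2
      rw [qI_st, cat_sf hh] at hl1
      have e1 : (fun e => D (sn h e)) = (σ (qI σ (sf h0 h))).1 := funext fun e => hDn h hh hT e
      have e2 : D h = (st h0 w (qI σ (sf h0 h))).2 := by simp only [D, hT, if_true]
      rw [e1, e2]; exact hl1
    · have e2 : D h = 0 := by simp only [D, hT, if_false]
      rw [e2]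
      exact M1at_const (C := 1) (fun e => abs_le.2 ⟨by linarith [hD0 (sn h e)], hD1 _⟩) fun e => hD0 _
  · intro r hr δ hδ
    set L := h0.2.length with hL
    let p : ℕ → List G.MV := fun n => qI σ (sf h0 (pf r (L + n)))
    let a : ℕ → G.MV := fun n => σ (p n)
    let b : ℕ → G.MV := fun n => (fun _ => 0, r.2 (L + n))
    have hp0 : p 0 = [] := by simp only [p, add_zero, hr, sf_self]; rfl
    have hE : ∀ n, Ext h0 (pf r (L + n)) := fun n => Ext_pf hr (by omega)
    have hp : ∀ n, p (n + 1) = b n :: a n :: p n := by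
      intro n
      simp only [p, a, b]
      rw [← add_assoc, pf_succ, sf_sn (hE n), qI_snoc]
    by_cases hT : ∀ n, TT i h0 w (p n)
    · have hrun := il_isRun (G' := AG i h0 w hw0 hw1) hp0 hp hT
      have hcons : BDet.Cons false σ (il a b) := by
        intro n hn
        obtain ⟨m, rfl⟩ : ∃ m, n = 2 * m := by
          have := Nat.bodd_add_div2 n
          rw [hn] at this
          exact ⟨n.div2, by simpa using this.symm⟩
        rw [il_even, il_pre hp0 hp]
      have hW := hwin _ hrun hcons
      have hrn : rn h0 (il a b) = r := by
        simp only [rn, il_odd, b]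
        exact pre_tail hr _
      obtain ⟨k, hk⟩ := exists_nat_one_div_lt hδ
      obtain ⟨N, hN⟩ := hW k
      filter_upwards [eventually_ge_atTop (L + N + 1)] with n hn
      obtain ⟨m, rfl⟩ : ∃ m, n = L + m + 1 := ⟨n - L - 1, by omega⟩
      have h1 := hN m (by omega)
      rw [hrn] at h1
      simp only [dn, il_even, il_odd, a, b] at h1
      rw [pf_succ, hDn _ (hE m) (hT m)]
      linarith
    · push Not at hT
      obtain ⟨n0, hn0⟩ := hT
      have hT' : ∀ n, n0 ≤ n → ¬ TT i h0 w (p n) := by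
        intro n hn
        induction n, hn using Nat.le_induction with
        | base => exact hn0
        | succ n _ ih => rw [hp]; exact fun h => ih h.1.1
      filter_upwards [eventually_ge_atTop (L + n0)] with n hn
      obtain ⟨m, rfl⟩ : ∃ m, n = L + m := ⟨n - L, by omega⟩
      have e2 : D (pf r (L + m)) = 0 := by
        have := hT' m (by omega)
        simp only [p] at this
        simp only [D, this, if_false]
      rw [e2]; linarith [hf0 r]
  · have : TT i h0 w (qI σ (sf h0 h0)) := by rw [sf_self]; trivial
    simp only [D, this, if_true]
    rw [sf_self]; rfl

end StochGame
end

section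
open scoped ENNReal NNReal Classical
open MeasureTheory Filter

namespace StochGame
variable {G : StochGame}

/-- a probability mass function from a point of the simplex -/
noncomputable def mkPMF {T : Type} [Fintype T] (y : T → ℝ) (hy : y ∈ stdSimplex ℝ T) : PMF T :=
  PMF.ofFintype (fun c => ENNReal.ofReal (y c)) (by
    rw [← ENNReal.ofReal_sum_of_nonneg fun c _ => hy.1 c, hy.2, ENNReal.ofReal_one])

theorem mkPMF_toReal {T : Type} [Fintype T] (y : T → ℝ) (hy : y ∈ stdSimplex ℝ T) (c : T) :
    (mkPMF y hy c).toReal = y c := by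
  simp [mkPMF, ENNReal.toReal_ofReal (hy.1 c)]

section II
variable (i : G.I) (h0 : G.History) (w ε : ℝ) (τ : List G.MV → G.MV)

/-- candidate values -/
def SS (p : List G.MV) (e : G.Ev) : Set ℝ :=
  insert 1 {y | ∃ m, Leg i h0 w p m ∧ (τ (m :: p)).2 = e ∧ y = m.1 e}

/-- infimum of candidate values -/
noncomputable def uu (p : List G.MV) (e : G.Ev) : ℝ := sInf (SS i h0 w τ p e)

/-- error at a position -/
noncomputable def et (p : List G.MV) : ℝ := ε / 2 ^ (p.length / 2 + 2)

/-- next position -/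
noncomputable def nx (p : List G.MV) (e : G.Ev) : Option (List G.MV) :=
  if h : ∃ m, Leg i h0 w p m ∧ (τ (m :: p)).2 = e ∧ m.1 e ≤ uu i h0 w τ p e + et ε p then
    some (τ (h.choose :: p) :: h.choose :: p) else none

/-- positions along player II strategy -/
noncomputable def qII (l : List G.Ev) : Option (List G.MV) :=
  l.foldl (fun o e => o.bind fun p => nx i h0 w ε τ p e) (some [])

variable {i h0 w ε τ}

theorem qII_snoc (l : List G.Ev) (e : G.Ev) :
    qII i h0 w ε τ (l ++ [e]) = (qII i h0 w ε τ l).bind fun p => nx i h0 w ε τ p e := by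
  simp [qII, List.foldl_append]

theorem SS_bdd {p : List G.MV} (hp : p.length.bodd = false) (e : G.Ev) : ∀ y ∈ SS i h0 w τ p e, 0 ≤ y := by
  rintro y (rfl | ⟨m, hm, _, rfl⟩)
  · norm_num
  · exact ((hm.1 hp).1 e).1

theorem uu_nonneg {p : List G.MV} (hp : p.length.bodd = false) (e : G.Ev) : 0 ≤ uu i h0 w τ p e :=
  Real.sInf_nonneg (SS_bdd hp e)

theorem uu_le_one {p : List G.MV} (hp : p.length.bodd = false) (e : G.Ev) : uu i h0 w τ p e ≤ 1 :=
  csInf_le ⟨0, SS_bdd hp e⟩ (Set.mem_insert _ _)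

theorem uu_le {p : List G.MV} (hp : p.length.bodd = false) {m : G.MV} (hm : Leg i h0 w p m) :
    uu i h0 w τ p (τ (m :: p)).2 ≤ m.1 (τ (m :: p)).2 :=
  csInf_le ⟨0, SS_bdd hp _⟩ (Set.mem_insert_of_mem _ ⟨m, hm, rfl, rfl⟩)

theorem nx_none {p : List G.MV} (hp : p.length.bodd = false) {e : G.Ev} (hε : 0 < ε)
    (h : nx i h0 w ε τ p e = none) : uu i h0 w τ p e = 1 := by
  by_contra hne
  have hlt := lt_of_le_of_ne (uu_le_one (i := i) (h0 := h0) (w := w) (τ := τ) hp e) hne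
  have het : 0 < et ε p := by unfold et; positivity
  have hne' : (SS i h0 w τ p e).Nonempty := ⟨1, Set.mem_insert _ _⟩
  obtain ⟨y, hy, hlt2⟩ := exists_lt_of_csInf_lt hne' (show sInf (SS i h0 w τ p e) < min 1 (uu i h0 w τ p e + et ε p) from
    lt_min hlt (by change uu i h0 w τ p e < _; linarith))
  rw [lt_min_iff] at hlt2
  rcases hy with rfl | ⟨m, h1, h2, rfl⟩
  · exact lt_irrefl _ hlt2.1
  · unfold nx at h
    rw [dif_pos ⟨m, h1, h2, hlt2.2.le⟩] at h
    cases h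

theorem nx_some {p p' : List G.MV} {e : G.Ev} (h : nx i h0 w ε τ p e = some p') :
    ∃ m, Leg i h0 w p m ∧ (τ (m :: p)).2 = e ∧ m.1 e ≤ uu i h0 w τ p e + et ε p ∧ p' = τ (m :: p) :: m :: p := by
  unfold nx at h
  split_ifs at h with hc
  refine ⟨hc.choose, hc.choose_spec.1, hc.choose_spec.2.1, hc.choose_spec.2.2, ?_⟩
  simpa using h.symm

variable {hw0 : 0 < w} {hw1 : w ≤ 1} (hτ : (AG i h0 w hw0 hw1).Legal τ)
include hτ

theorem qII_inv (l : List G.Ev) : ∀ p, qII i h0 w ε τ l = some p →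
    TT i h0 w p ∧ p.length = 2 * l.length ∧ (st h0 w p).1 = catH h0 l := by
  induction l using List.reverseRecOn with
  | nil =>
    intro p hp
    simp only [qII, List.foldl_nil, Option.some.injEq] at hp
    subst hp
    exact ⟨trivial, rfl, by simp [st, catH]⟩
  | append_singleton l e ih =>
    intro p hp
    rw [qII_snoc] at hp
    obtain ⟨p0, h1, h2⟩ := Option.bind_eq_some_iff.1 hp
    obtain ⟨m, h3, h4, h5, rfl⟩ := nx_some h2
    obtain ⟨h6, h7, h8⟩ := ih p0 h1
    refine ⟨hτ _ ⟨h6, h3⟩, by simp [h7]; ring, ?_⟩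
    simp only [st, h8, h4]
    simp [catH, snocH]

theorem uu_claim {p : List G.MV} (hT : TT i h0 w p) (hp : p.length.bodd = false) {η : ℝ} (hη : 0 < η) :
    ∃ x ∈ Mix G, ∀ c, osA (lastState (st h0 w p).1) x i c (uu i h0 w τ p) ≤ (st h0 w p).2 + η := by
  by_contra hc
  push Not at hc
  let u := uu i h0 w τ p
  have hu0 : ∀ e, 0 ≤ u e := uu_nonneg hp
  have hu1 : ∀ e, u e ≤ 1 := uu_le_one hp
  let d : G.Ev → ℝ := fun e => max (u e - η) 0
  have hd0 : ∀ e, 0 ≤ d e := fun e => le_max_right _ _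
  have hd1 : ∀ e, d e ≤ 1 := fun e => max_le (by linarith [hu1 e]) zero_le_one
  have hM : M1at i (lastState (st h0 w p).1) (st h0 w p).2 d := by
    intro x hx
    obtain ⟨c, hc⟩ := hc x hx
    refine ⟨c, ?_⟩
    rw [osA_eq hx] at hc ⊢
    have hm := mix_update hx i c
    have hub : ∀ e, |u e| ≤ 1 := fun e => abs_le.2 ⟨by linarith [hu0 e], hu1 e⟩
    have h1 := os_add (s := lastState (st h0 w p).1) (x := Function.update x i (Pi.single c 1)) hub (d' := fun _ => -η) (C' := |(-η)|) (fun _ => le_rfl)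
    rw [os_const hm] at h1
    have h2 : os (lastState (st h0 w p).1) (Function.update x i (Pi.single c 1)) (fun t => u t + -η) ≤
        os (lastState (st h0 w p).1) (Function.update x i (Pi.single c 1)) d :=
      os_mono hm (C := 1 + |(-η)|) (C' := 1) (fun e => (abs_add_le _ _).trans (by linarith [hub e]))
        (fun e => abs_le.2 ⟨by linarith [hd0 e], hd1 e⟩) fun e => by
          simp only [d]; exact le_trans (by linarith) (le_max_left _ _)
    linarith
  have hL : Leg i h0 w p (d, Classical.arbitrary _) :=
    ⟨fun _ => ⟨fun e => ⟨hd0 e, hd1 e⟩, hM⟩, fun h => by rw [hp] at h; cases h⟩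
  have hT2 : TT i h0 w ((d, Classical.arbitrary _) :: p) := ⟨hT, hL⟩
  have h3 : Leg i h0 w ((d, Classical.arbitrary _) :: p) (τ ((d, Classical.arbitrary _) :: p)) :=
    (hτ ((d, Classical.arbitrary _) :: p) hT2).2
  obtain ⟨m1, q, h4, h5⟩ := h3.2 (by simp [Nat.bodd_succ, hp])
  simp only [List.cons.injEq] at h4
  rw [← h4.1] at h5
  have h6 := uu_le (τ := τ) hp hL
  dsimp only at h5 h6
  have h7 : d (τ ((d, Classical.arbitrary _) :: p)).2 = u (τ ((d, Classical.arbitrary _) :: p)).2 - η := by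
    simp only [d] at h5 ⊢
    rcases lt_max_iff.1 h5 with h | h
    · exact max_eq_left h.le
    · exact absurd h (lt_irrefl _)
  rw [h7] at h6
  change u _ ≤ _ at h6
  linarith

end II

variable {P : G.History → G.Profile → Measure G.Run} (hP : IsInducedFamily G P)
include hP

theorem martin_II {i : G.I} {f : G.Run → ℝ} (hf : Measurable f) (hf0 : ∀ r, 0 ≤ f r) (hf1 : ∀ r, f r ≤ 1)
    {h0 : G.History} {w : ℝ} (hw0 : 0 < w) (hw1 : w ≤ 1)
    {τ : List G.MV → G.MV} (hτ : (AG i h0 w hw0 hw1).Legal τ)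
    (hwin : ∀ x, (AG i h0 w hw0 hw1).IsRun x → BDet.Cons true τ x → x ∉ WW h0 f) {ε : ℝ} (hε : 0 < ε) :
    ∃ σ : G.Profile, ∀ ρ : G.Strategy i, ∫ r, f r ∂(P h0 (Function.update σ i ρ)) ≤ w + ε := by
  have hx : ∀ h : G.History, ∃ x ∈ Mix G, ∀ p, qII i h0 w ε τ (sf h0 h) = some p →
      ∀ c, osA (lastState (st h0 w p).1) x i c (uu i h0 w τ p) ≤ (st h0 w p).2 + et ε p := by
    intro h
    cases hq : qII i h0 w ε τ (sf h0 h) with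
    | none => obtain ⟨x, hx⟩ := mix_nonempty G; exact ⟨x, hx, by simp⟩
    | some p =>
      obtain ⟨h1, h2, h3⟩ := qII_inv hτ _ p hq
      obtain ⟨x, hx, h4⟩ := uu_claim hτ h1 (by rw [h2]; simp) (η := et ε p) (by unfold et; positivity)
      exact ⟨x, hx, fun p' hp' c => by simp only [Option.some.injEq] at hp'; subst hp'; exact h4 c⟩
  choose X hXm hX using hx
  let σ : G.Profile := fun j h => mkPMF (X h j) (hXm h j)
  have hσ : ∀ h, xr σ h = X h := fun h => by
    funext j c; exact mkPMF_toReal _ _ _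
  refine ⟨σ, fun ρ => ?_⟩
  let bv : G.History → ℝ := fun h => match qII i h0 w ε τ (sf h0 h) with
    | some p => (st h0 w p).2
    | none => 1
  have hbs : ∀ h p, qII i h0 w ε τ (sf h0 h) = some p → bv h = (st h0 w p).2 := fun h p hp => by simp only [bv, hp]
  have hbn : ∀ h, qII i h0 w ε τ (sf h0 h) = none → bv h = 1 := fun h hp => by simp only [bv, hp]
  have hb : ∀ h, 0 ≤ bv h ∧ bv h ≤ 1 := by
    intro h
    cases hq : qII i h0 w ε τ (sf h0 h) with
    | none => rw [hbn h hq]; norm_num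
    | some p =>
      rw [hbs h p hq]
      obtain ⟨h1, h2, h3⟩ := qII_inv hτ _ p hq
      have := TT_st hw0 hw1 p (by rw [h2]; simp) h1
      exact ⟨this.1.le, this.2⟩
  let V : G.History → ℝ := fun h => bv h + ε / 2 ^ (sf h0 h).length
  have hsl : ∀ n : ℕ, 0 < ε / 2 ^ n ∧ ε / 2 ^ n ≤ ε := fun n =>
    ⟨by positivity, div_le_self hε.le (one_le_pow₀ (by norm_num))⟩
  have hV : ∀ h, |V h| ≤ 1 + ε := fun h => by
    have := hb h; have := hsl (sf h0 h).length
    simp only [V]; rw [abs_le]; constructor <;> linarith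
  have key := VL hP (Function.update σ i ρ) h0 hf (C := 1 + ε) (fun r => by rw [abs_of_nonneg (hf0 r)]; linarith [hf1 r]) hV ∅ ?_ ?_ ?_
  · have : V h0 = w + ε := by
      have h1 : qII i h0 w ε τ (sf h0 h0) = some [] := by rw [sf_self]; rfl
      simp only [V, hbs _ _ h1, sf_self]; simp [st]
    rwa [this] at key
  · intro h hh _
    refine os_dev_le (i := i) (x := X h) (hXm h) (xr_mix _ _) (fun j hj => ?_) fun c => ?_
    · rw [← hσ]; funext b; simp only [xr]; rw [Function.update_of_ne hj]
    · have hm := mix_update (hXm h) i c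
      set n := (sf h0 h).length with hn
      have hl : ∀ e, (sf h0 (sn h e)).length = n + 1 := fun e => by rw [sf_sn hh]; simp [hn]
      have hpow : ε / 2 ^ n = ε / 2 ^ (n + 1) + 2 * (ε / 2 ^ (n + 2)) := by
        rw [pow_succ, pow_succ]; field_simp; ring
      cases hq : qII i h0 w ε τ (sf h0 h) with
      | none =>
        have hV1 : V h = 1 + ε / 2 ^ n := by simp only [V, hbn h hq, hn]
        rw [osA_eq (hXm h), hV1, ← os_const (s := lastState h) hm (1 + ε / 2 ^ n)]
        refine os_mono hm (C' := |1 + ε / 2 ^ n|) (fun e => hV _) (fun _ => le_rfl) fun e => ?_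
        simp only [V, hl]
        linarith [(hb (sn h e)).2, (hsl (n + 2)).1]
      | some p =>
        obtain ⟨h1, h2, h3⟩ := qII_inv hτ _ p hq
        have hpb : p.length.bodd = false := by rw [h2]; simp
        have hV1 : V h = (st h0 w p).2 + ε / 2 ^ n := by simp only [V, hbs h p hq, hn]
        have het : et ε p = ε / 2 ^ (n + 2) := by unfold et; rw [h2]; simp [hn]
        have h4 := hX h p hq c
        rw [h3, cat_sf hh, osA_eq (hXm h)] at h4
        rw [osA_eq (hXm h), hV1]
        have hub : ∀ e, |uu i h0 w τ p e| ≤ 1 := fun e => abs_le.2 ⟨by linarith [uu_nonneg (i := i) (h0 := h0) (w := w) (τ := τ) hpb e], uu_le_one hpb e⟩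
        set K := ε / 2 ^ (n + 2) + ε / 2 ^ (n + 1) with hK
        have h5 := os_add (s := lastState h) (x := Function.update (X h) i (Pi.single c 1)) hub (d' := fun _ => K) (C' := |K|) (fun _ => le_rfl)
        rw [os_const hm] at h5
        have h6 : os (lastState h) (Function.update (X h) i (Pi.single c 1)) (fun e => V (sn h e)) ≤
            os (lastState h) (Function.update (X h) i (Pi.single c 1)) (fun t => uu i h0 w τ p t + K) := by
          refine os_mono hm (C' := 1 + |K|) (fun e => hV _) (fun e => (abs_add_le _ _).trans (by linarith [hub e])) fun e => ?_
          simp only [V, hl]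
          have hqe : qII i h0 w ε τ (sf h0 (sn h e)) = nx i h0 w ε τ p e := by
            rw [sf_sn hh, qII_snoc, hq]; rfl
          cases hnx : nx i h0 w ε τ p e with
          | none =>
            rw [hbn _ (hqe.trans hnx), nx_none hpb hε hnx]
            linarith [(hsl (n + 2)).1]
          | some p' =>
            rw [hbs _ _ (hqe.trans hnx)]
            obtain ⟨m, a1, a2, a3, rfl⟩ := nx_some hnx
            simp only [st, a2]
            rw [het] at a3
            linarith
        rw [het] at h4
        linarith
  · intro h' _ hx; exact absurd hx (Set.notMem_empty _)
  · filter_upwards [ae_cyl hP h0 (Function.update σ i ρ)] with r hr _ δ hδ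
    set L := h0.2.length with hL
    have hE : ∀ n, Ext h0 (pf r (L + n)) := fun n => Ext_pf hr (by omega)
    have hsn : ∀ n, sf h0 (pf r (L + (n + 1))) = sf h0 (pf r (L + n)) ++ [r.2 (L + n)] := fun n => by
      rw [← add_assoc, pf_succ, sf_sn (hE n)]
    by_cases hon : ∀ n, ∃ p, qII i h0 w ε τ (sf h0 (pf r (L + n))) = some p
    · choose p hp using hon
      have hp0 : p 0 = [] := by
        have := hp 0
        rw [add_zero, hr, sf_self] at this
        simpa [qII] using this.symm
      have hstep : ∀ n, ∃ m, (τ (m :: p n)).2 = r.2 (L + n) ∧ p (n + 1) = τ (m :: p n) :: m :: p n := by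
        intro n
        have h1 := hp (n + 1)
        rw [hsn, qII_snoc, hp n] at h1
        obtain ⟨m, _, a2, _, a4⟩ := nx_some (show nx i h0 w ε τ (p n) (r.2 (L + n)) = some (p (n + 1)) from h1)
        exact ⟨m, a2, a4⟩
      choose a ha1 ha2 using hstep
      let b : ℕ → G.MV := fun n => τ (a n :: p n)
      have hrun := il_isRun (G' := AG i h0 w hw0 hw1) (a := a) (b := b) hp0 ha2 (fun n => (qII_inv hτ _ _ (hp n)).1)
      have hcons : BDet.Cons true τ (il a b) := by
        intro n hn
        obtain ⟨m, rfl⟩ : ∃ m, n = 2 * m + 1 := by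
          have := Nat.bodd_add_div2 n
          rw [hn] at this
          exact ⟨n.div2, by simp at this; omega⟩
        rw [il_odd, BDet.pre, il_even, il_pre (a := a) (b := b) hp0 ha2]
      have hW := hwin _ hrun hcons
      have hrn : rn h0 (il a b) = r := by
        simp only [rn, il_odd, b, ha1]
        exact pre_tail hr _
      simp only [WW, Set.mem_setOf_eq] at hW
      push Not at hW
      obtain ⟨k, hk⟩ := hW
      rw [frequently_atTop]
      intro N
      obtain ⟨n, hn, h1⟩ := hk N
      refine ⟨L + (n + 1), by omega, ?_⟩
      rw [hrn] at h1
      simp only [dn, il_even, il_odd, b] at h1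
      have h2 : bv (pf r (L + (n + 1))) = (a n).1 (τ (a n :: p n)).2 := by
        rw [hbs _ _ (hp (n + 1)), ha2]; rfl
      have h3 : (0 : ℝ) < 1 / ((k : ℝ) + 1) := by positivity
      simp only [V]
      rw [h2]
      linarith [(hsl (sf h0 (pf r (L + (n + 1)))).length).1]
    · push Not at hon
      obtain ⟨n0, hn0⟩ := hon
      have hoff : ∀ n, n0 ≤ n → qII i h0 w ε τ (sf h0 (pf r (L + n))) = none := by
        intro n hn
        induction n, hn using Nat.le_induction with
        | base => exact Option.eq_none_iff_forall_ne_some.2 hn0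
        | succ n _ ih => rw [hsn, qII_snoc, ih]; rfl
      refine Eventually.frequently ?_
      filter_upwards [eventually_ge_atTop (L + n0)] with n hn
      obtain ⟨m, rfl⟩ : ∃ m, n = L + m := ⟨n - L, by omega⟩
      simp only [V]
      rw [hbn _ (hoff m (by omega))]
      linarith [hf1 r, (hsl (sf h0 (pf r (L + m))).length).1]

/-- minmax value -/
noncomputable def vv (P : G.History → G.Profile → Measure G.Run) (i : G.I) (f : G.Run → ℝ) (h : G.History) : ℝ :=
  sInf {w | 0 ≤ w ∧ ∃ σ : G.Profile, ∀ ρ : G.Strategy i, ∫ r, f r ∂(P h (Function.update σ i ρ)) ≤ w}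

theorem vv_nonempty (i : G.I) {f : G.Run → ℝ} (hf0 : ∀ r, 0 ≤ f r) (hf1 : ∀ r, f r ≤ 1) (h : G.History) :
    (1 : ℝ) ∈ {w | 0 ≤ w ∧ ∃ σ : G.Profile, ∀ ρ : G.Strategy i, ∫ r, f r ∂(P h (Function.update σ i ρ)) ≤ w} := by
  refine ⟨zero_le_one, fun j h => PMF.pure (Classical.arbitrary _), fun ρ => ?_⟩
  exact (abs_le.1 (E_abs hP h _ (C := 1) fun r => abs_le.2 ⟨by linarith [hf0 r], hf1 r⟩)).2

theorem vv_bounds (i : G.I) {f : G.Run → ℝ} (hf0 : ∀ r, 0 ≤ f r) (hf1 : ∀ r, f r ≤ 1) (h : G.History) :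
    0 ≤ vv P i f h ∧ vv P i f h ≤ 1 :=
  ⟨Real.sInf_nonneg fun _ h => h.1, csInf_le ⟨0, fun _ h => h.1⟩ (vv_nonempty hP i hf0 hf1 h)⟩

theorem vv_punish (i : G.I) {f : G.Run → ℝ} (hf0 : ∀ r, 0 ≤ f r) (hf1 : ∀ r, f r ≤ 1) (h : G.History) {δ : ℝ} (hδ : 0 < δ) :
    ∃ σ : G.Profile, ∀ ρ : G.Strategy i, ∫ r, f r ∂(P h (Function.update σ i ρ)) ≤ vv P i f h + δ := by
  obtain ⟨y, ⟨_, σ, h1⟩, h2⟩ := exists_lt_of_csInf_lt ⟨1, vv_nonempty hP i hf0 hf1 h⟩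
    (show vv P i f h < vv P i f h + δ by linarith)
  exact ⟨σ, fun ρ => (h1 ρ).trans h2.le⟩

theorem martin {i : G.I} {f : G.Run → ℝ} (hf : Measurable f) (hf0 : ∀ r, 0 ≤ f r) (hf1 : ∀ r, f r ≤ 1)
    {h0 : G.History} {w : ℝ} (hw0 : 0 < w) (hw : w < vv P i f h0) : ∃ D, MD i f h0 D ∧ D h0 = w := by
  have hw1 : w ≤ 1 := hw.le.trans (vv_bounds hP i hf0 hf1 h0).2
  rcases BDet.borel_determinacy (AG i h0 w hw0 hw1) (WW h0 f) (WW_meas h0 hf) with ⟨σ, h1, h2⟩ | ⟨τ, h1, h2⟩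
  · exact martin_I hf0 hw0 hw1 h1 h2
  · exfalso
    set ε := (vv P i f h0 - w) / 2 with hε
    have hε0 : 0 < ε := by rw [hε]; linarith
    obtain ⟨σ, h3⟩ := martin_II hP hf hf0 hf1 hw0 hw1 h1 h2 hε0
    have : vv P i f h0 ≤ w + ε := csInf_le ⟨0, fun _ h => h.1⟩ ⟨by linarith, σ, h3⟩
    linarith

end StochGame
end

section
open scoped ENNReal NNReal Classical
open MeasureTheory Filter

namespace StochGame
variable {G : StochGame}

section rt
variable (Dm : G.History → G.History → ℝ) (v : G.History → ℝ) (ε : ℝ)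

/-- current restart root -/
noncomputable def rt : ℕ → G.History → G.History
  | 0, h => tk h 0
  | n + 1, h => if Dm (rt n h) (tk h (n + 1)) < v (tk h (n + 1)) - ε then tk h (n + 1) else rt n h

theorem rt_tk (h : G.History) (m : ℕ) : ∀ n, n ≤ m → rt Dm v ε n (tk h m) = rt Dm v ε n h := by
  intro n
  induction n with
  | zero => intro hn; simp only [rt]; exact tk_tk h hn
  | succ n ih =>
    intro hn
    simp only [rt]
    rw [ih (by omega), tk_tk h hn]

theorem rt_ext (h : G.History) : ∀ n, Ext (rt Dm v ε n h) (tk h n) := by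
  intro n
  induction n with
  | zero => exact Ext_refl _
  | succ n ih =>
    simp only [rt]
    split_ifs
    · exact Ext_refl _
    · refine Ext_trans ih ?_
      rw [← tk_tk h (Nat.le_succ n)]
      exact Ext_tk _ _

/-- root of a history -/
noncomputable def rr (h : G.History) : G.History := rt Dm v ε h.2.length h

theorem rr_ext (h : G.History) : Ext (rr Dm v ε h) h := by
  have := rt_ext Dm v ε h h.2.length
  rwa [tk_self h le_rfl] at this

theorem rr_sn (h : G.History) (e : G.Ev) : rr Dm v ε (sn h e) =
    if Dm (rr Dm v ε h) (sn h e) < v (sn h e) - ε then sn h e else rr Dm v ε h := by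
  have h1 : (sn h e).2.length = h.2.length + 1 := by simp [snocH]
  have h2 : rt Dm v ε h.2.length (sn h e) = rr Dm v ε h := by
    rw [← rt_tk Dm v ε (sn h e) h.2.length _ le_rfl, tk_sn h e le_rfl, tk_self h le_rfl]; rfl
  conv_lhs => unfold rr
  rw [h1]
  simp only [rt]
  rw [h2, tk_self _ h1.le]

end rt

theorem sn_cases (h : G.History) : h.2.length = 0 ∨ ∃ h' e, h = sn h' e := by
  rcases Ext_cases (Ext_tk h 0) with h1 | ⟨h', e, h1, _⟩
  · left; rw [h1]; simp [tk]
  · exact Or.inr ⟨h', e, h1⟩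

variable {P : G.History → G.Profile → Measure G.Run} (hP : IsInducedFamily G P)
include hP

theorem patch {i : G.I} {f : G.Run → ℝ} (hf : Measurable f) (hf0 : ∀ r, 0 ≤ f r) (hf1 : ∀ r, f r ≤ 1)
    {ε : ℝ} (hε : 0 < ε) (hε1 : ε ≤ 1) : ∃ D A : G.History → ℝ, (∀ h, 0 ≤ D h - A h) ∧ (∀ h, D h ≤ 1) ∧
      (∀ h, A h = 0 ∨ A h = ε / 2) ∧
      (∀ h, M1at i (lastState h) (D h) (fun e => D (sn h e) - A (sn h e))) ∧
      (∀ h, vv P i f h - ε ≤ D h - A h) ∧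
      (∀ r, (∀ᶠ n in atTop, A (pf r n) = 0) → ∀ δ > 0, ∀ᶠ n in atTop, D (pf r n) ≤ f r + δ) := by
  have key : ∀ h : G.History, ∃ D, MD i f h D ∧ vv P i f h - ε / 2 ≤ D h ∧
      (ε / 2 < vv P i f h → D h = vv P i f h - ε / 2) := by
    intro h
    by_cases hh : ε / 2 < vv P i f h
    · obtain ⟨D, h1, h2⟩ := martin hP hf hf0 hf1 (i := i) (h0 := h) (w := vv P i f h - ε / 2) (by linarith) (by linarith)
      exact ⟨D, h1, h2.ge, fun _ => h2⟩
    · refine ⟨fun _ => 0, ⟨fun _ => le_rfl, fun _ => zero_le_one, fun h _ => ?_, fun r _ δ hδ => ?_⟩, by linarith, fun h => absurd h hh⟩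
      · exact M1at_const (C := 0) (by simp) (by simp)
      · exact Eventually.of_forall fun n => by linarith [hf0 r]
  choose Dm hm hv hv' using key
  let v := vv P i f
  let R := rr Dm v ε
  let D : G.History → ℝ := fun h => Dm (R h) h
  let A : G.History → ℝ := fun h => if 0 < h.2.length ∧ R h = h then ε / 2 else 0
  have hRs : ∀ h e, R (sn h e) = if Dm (R h) (sn h e) < v (sn h e) - ε then sn h e else R h := rr_sn Dm v ε
  have hne : ∀ h e, R h ≠ sn h e := by
    intro h e h1
    have := Ext_len (rr_ext Dm v ε h)
    change (R h).2.length ≤ _ at this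
    rw [h1] at this
    simp [snocH] at this
  have hlen : ∀ (h : G.History) e, 0 < (sn h e).2.length := fun h e => by simp [snocH]
  have hA : ∀ h, A h = 0 ∨ A h = ε / 2 := fun h => by
    simp only [A]; split_ifs <;> simp
  have step : ∀ h e, (A (sn h e) = 0 ∧ R (sn h e) = R h ∧ v (sn h e) - ε ≤ Dm (R h) (sn h e)) ∨
      (A (sn h e) = ε / 2 ∧ D (sn h e) = v (sn h e) - ε / 2 ∧ Dm (R h) (sn h e) < v (sn h e) - ε) := by
    intro h e
    by_cases hc : Dm (R h) (sn h e) < v (sn h e) - ε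
    · right
      have h1 : R (sn h e) = sn h e := by rw [hRs, if_pos hc]
      refine ⟨by simp only [A]; rw [if_pos ⟨hlen h e, h1⟩], ?_, hc⟩
      simp only [D]; rw [h1]
      exact hv' _ (by have := (hm (R h)).nonneg (sn h e); change _ < v _; linarith)
    · left
      have h1 : R (sn h e) = R h := by rw [hRs, if_neg hc]
      refine ⟨?_, h1, not_lt.1 hc⟩
      simp only [A]; rw [if_neg]; rintro ⟨_, h2⟩; rw [h1] at h2; exact hne h e h2
  have ge1 : ∀ h e, Dm (R h) (sn h e) ≤ D (sn h e) - A (sn h e) := by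
    intro h e
    rcases step h e with ⟨h1, h2, h3⟩ | ⟨h1, h2, h3⟩
    · rw [h1, sub_zero]; simp only [D]; rw [h2]
    · rw [h1, h2]; linarith
  have hA0 : ∀ h : G.History, h.2.length = 0 → A h = 0 := fun h hh => by
    simp only [A]; rw [if_neg]; rintro ⟨h1, _⟩; omega
  have hD1 : ∀ h, D h ≤ 1 := fun h => (hm _).le_one _
  have hDA : ∀ h, 0 ≤ D h - A h := by
    intro h
    rcases sn_cases h with h1 | ⟨h', e, rfl⟩
    · rw [hA0 h h1, sub_zero]; exact (hm _).nonneg _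
    · exact ((hm _).nonneg _).trans (ge1 h' e)
  have hAn : ∀ h, 0 ≤ A h := fun h => by rcases hA h with h | h <;> rw [h]; linarith
  refine ⟨D, A, hDA, hD1, hA, fun h => ?_, fun h => ?_, fun r hr => ?_⟩
  · refine M1at_mono (C := 1) (fun e => ?_) (fun e => ?_) (ge1 h) le_rfl ((hm (R h)).m1 h (rr_ext Dm v ε h))
    · exact abs_le.2 ⟨by linarith [(hm (R h)).nonneg (sn h e)], (hm _).le_one _⟩
    · exact abs_le.2 ⟨by linarith [hDA (sn h e)], by linarith [hD1 (sn h e), hAn (sn h e)]⟩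
  · rcases sn_cases h with h1 | ⟨h', e, rfl⟩
    · rw [hA0 h h1, sub_zero]
      have h2 : R h = h := by simp only [R, rr]; rw [h1]; simp only [rt]; exact tk_self h h1.le
      simp only [D]; rw [h2]; linarith [hv h]
    · rcases step h' e with ⟨h1, h2, h3⟩ | ⟨h1, h2, h3⟩
      · rw [h1, sub_zero]; simp only [D]; rw [h2]; exact h3
      · rw [h1, h2]; change v _ - ε ≤ _; linarith
  · obtain ⟨N, hN⟩ := eventually_atTop.1 hr
    have hc : ∀ n, N ≤ n → R (pf r n) = R (pf r N) := by
      intro n hn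
      induction n, hn using Nat.le_induction with
      | base => rfl
      | succ n hn ih =>
        have h0 := hN (n + 1) (by omega)
        rw [pf_succ] at h0 ⊢
        rcases step (pf r n) (r.2 n) with ⟨h1, h2, h3⟩ | ⟨h1, h2, h3⟩
        · exact h2.trans ih
        · rw [h1] at h0; linarith
    have he := Ext_iff.1 (rr_ext Dm v ε (pf r N))
    change (R (pf r N)).2.length ≤ _ ∧ tk _ (R (pf r N)).2.length = R (pf r N) at he
    rw [pf_len] at he
    rw [tk_pf r he.1] at he
    intro δ hδ
    filter_upwards [(hm (R (pf r N))).lim r he.2 δ hδ, eventually_ge_atTop N] with n h1 h2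
    simp only [D]; rw [hc n h2]; exact h1

end StochGame
end

section
open scoped ENNReal NNReal Classical
open MeasureTheory Filter

namespace StochGame
variable {G : StochGame}

/-- actions of players with index below `k` from `a`, the others from `b` -/
noncomputable def mg (k : ℕ) (a b : ∀ i, G.A i) : ∀ i, G.A i :=
  fun i => if (Fintype.equivFin G.I i : ℕ) < k then a i else b i

/-- partial average -/
noncomputable def gk (x : ∀ i, G.A i → ℝ) (w : (∀ i, G.A i) → ℝ) (k : ℕ) (a : ∀ i, G.A i) : ℝ :=
  NashG.U x (fun b => w (mg k a b))

theorem U_bounds {x : ∀ i, G.A i → ℝ} (hx : x ∈ Mix G) {u : (∀ i, G.A i) → ℝ} {δ C : ℝ}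
    (h : ∀ a, δ ≤ u a ∧ u a ≤ C) : δ ≤ NashG.U x u ∧ NashG.U x u ≤ C := by
  constructor
  · rw [← NashG.U_const x (fun i => (hx i).2) δ]
    exact NashG.U_mono x (fun i => (hx i).1) fun a => (h a).1
  · rw [← NashG.U_const x (fun i => (hx i).2) C]
    exact NashG.U_mono x (fun i => (hx i).1) fun a => (h a).2

theorem gk_step {x : ∀ i, G.A i → ℝ} (hx : x ∈ Mix G) (w : (∀ i, G.A i) → ℝ) (j : G.I) (a : ∀ i, G.A i) :
    ∑ c, x j c * gk x w ((Fintype.equivFin G.I j : ℕ) + 1) (Function.update a j c) =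
      gk x w (Fintype.equivFin G.I j) a := by
  set k : ℕ := (Fintype.equivFin G.I j : ℕ) with hk
  simp only [gk]
  rw [NashG.U_resample x x j (hx j).2 (fun _ _ => rfl) (fun b => w (mg k a b)), NashG.U_sum]
  refine Finset.sum_congr rfl fun c _ => ?_
  rw [← NashG.U_mul]
  congr 1; funext b
  congr 2
  funext i
  simp only [mg]
  by_cases hi : i = j
  · subst hi; simp [← hk]
  · rw [Function.update_of_ne hi, Function.update_of_ne hi]
    have hne : (Fintype.equivFin G.I i : ℕ) ≠ k := by
      rw [hk]; intro h; exact hi ((Fintype.equivFin G.I).injective (Fin.ext h))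
    by_cases h1 : (Fintype.equivFin G.I i : ℕ) < k
    · rw [if_pos h1, if_pos (by omega)]
    · rw [if_neg h1, if_neg (by omega)]

theorem gk_inv (x : ∀ i, G.A i → ℝ) (w : (∀ i, G.A i) → ℝ) (j : G.I) (a : ∀ i, G.A i) (c : G.A j) :
    gk x w (Fintype.equivFin G.I j) (Function.update a j c) = gk x w (Fintype.equivFin G.I j) a := by
  simp only [gk]
  congr 1; funext b
  congr 1
  funext i
  simp only [mg]
  by_cases hi : i = j
  · subst hi; simp
  · rw [Function.update_of_ne hi]

theorem gk_tele {x : ∀ i, G.A i → ℝ} (hx : x ∈ Mix G) {w : (∀ i, G.A i) → ℝ} (a : ∀ i, G.A i)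
    (hpos : ∀ k, 0 < gk x w k a) : ∏ j : G.I, (gk x w ((Fintype.equivFin G.I j : ℕ) + 1) a / gk x w (Fintype.equivFin G.I j) a) =
      w a / NashG.U x w := by
  rw [Equiv.prod_comp (Fintype.equivFin G.I) (fun k : Fin _ => gk x w ((k : ℕ) + 1) a / gk x w (k : ℕ) a),
    Fin.prod_univ_eq_prod_range (fun k => gk x w (k + 1) a / gk x w k a)]
  have h1 : ∀ n, ∏ k ∈ Finset.range n, (gk x w (k + 1) a / gk x w k a) = gk x w n a / gk x w 0 a := by
    intro n
    induction n with
    | zero => simp [div_self (hpos 0).ne']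
    | succ n ih =>
      rw [Finset.prod_range_succ, ih]
      have := (hpos n).ne'
      have := (hpos 0).ne'
      field_simp
  have h2 : gk x w (Fintype.card G.I) a = w a := by
    have : ∀ b, mg (Fintype.card G.I) a b = a := fun b => by
      funext i; simp only [mg]; rw [if_pos (Fin.is_lt _)]
    simp only [gk, this]
    exact NashG.U_const x (fun i => (hx i).2) _
  have h3 : gk x w 0 a = NashG.U x w := by
    have : ∀ b, mg 0 a b = b := fun b => by
      funext i; simp [mg]
    simp only [gk, this]
  rw [h1, h2, h3]

/-- the tests used to attribute an unlikely event to a player or to nature -/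
theorem tests {s : G.S} {x : ∀ i, G.A i → ℝ} (hx : x ∈ Mix G) {e : G.Ev → ℝ} {δ C : ℝ} (hδ : 0 < δ)
    (he : ∀ t, δ ≤ e t ∧ e t ≤ C) : ∃ r : Option G.I → G.Ev → ℝ, (∀ k t, 0 ≤ r k t) ∧
      (∀ k t, r k t ≤ C / δ) ∧ (∀ y ∈ Mix G, os s y (r none) = 1) ∧
      (∀ j, ∀ y ∈ Mix G, y j = x j → os s y (r (some j)) = 1) ∧
      ∀ t, ∏ k, r k t = e t / os s x e := by
  let e1 : (∀ i, G.A i) → ℝ := fun a => ny (G.trans s a) (fun t => e (a, t))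
  have heb : ∀ t, |e t| ≤ C := fun t => abs_le.2 ⟨by linarith [(he t).1, (he t).2], (he t).2⟩
  have he1 : ∀ a, δ ≤ e1 a ∧ e1 a ≤ C := by
    intro a
    constructor
    · rw [← ny_const (G.trans s a) δ]
      exact ny_mono _ (C := |δ|) (fun _ => le_rfl) (fun t => heb (a, t)) fun t => (he (a, t)).1
    · exact (abs_le.1 (ny_abs _ fun t => heb (a, t))).2
  have hg : ∀ k a, δ ≤ gk x e1 k a ∧ gk x e1 k a ≤ C := fun k a => U_bounds hx fun b => he1 _
  have hC : 0 ≤ C := hδ.le.trans ((he1 (Classical.arbitrary _)).1.trans (he1 _).2)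
  let r : Option G.I → G.Ev → ℝ := fun k t => match k with
    | none => e t / e1 t.1
    | some j => gk x e1 ((Fintype.equivFin G.I j : ℕ) + 1) t.1 / gk x e1 (Fintype.equivFin G.I j) t.1
  refine ⟨r, ?_, ?_, ?_, ?_, ?_⟩
  · intro k t
    cases k with
    | none => exact div_nonneg (hδ.le.trans (he t).1) (hδ.le.trans (he1 _).1)
    | some j => exact div_nonneg (hδ.le.trans (hg _ _).1) (hδ.le.trans (hg _ _).1)
  · intro k t
    cases k with
    | none => exact div_le_div₀ hC (he t).2 hδ (he1 _).1
    | some j => exact div_le_div₀ hC (hg _ _).2 hδ (hg _ _).1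
  · intro y hy
    rw [os]
    have : (fun a => ny (G.trans s a) (fun t => r none (a, t))) = fun _ => (1 : ℝ) := by
      funext a
      have h1 : (fun t => r none (a, t)) = fun t => (e1 a)⁻¹ * e (a, t) := by
        funext t; simp only [r]; rw [div_eq_inv_mul]
      rw [h1, ny_mul]
      exact inv_mul_cancel₀ (hδ.trans_le (he1 a).1).ne'
    rw [this, NashG.U_const y fun i => (hy i).2]
  · intro j y hy hyx
    rw [os]
    have : (fun a => ny (G.trans s a) (fun t => r (some j) (a, t))) = fun a =>
        gk x e1 ((Fintype.equivFin G.I j : ℕ) + 1) a / gk x e1 (Fintype.equivFin G.I j) a := by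
      funext a
      exact ny_const (G.trans s a) (gk x e1 ((Fintype.equivFin G.I j : ℕ) + 1) a / gk x e1 (Fintype.equivFin G.I j) a)
    rw [this, NashG.U_resample y y j (hy j).2 (fun _ _ => rfl)]
    have : (fun a => ∑ c, y j c * (gk x e1 ((Fintype.equivFin G.I j : ℕ) + 1) (Function.update a j c) /
        gk x e1 (Fintype.equivFin G.I j) (Function.update a j c))) = fun _ => (1 : ℝ) := by
      funext a
      simp only [gk_inv, ← mul_div_assoc]
      rw [← Finset.sum_div, hyx, gk_step hx]
      exact div_self (hδ.trans_le (hg _ _).1).ne'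
    rw [this, NashG.U_const y fun i => (hy i).2]
  · intro t
    rw [Fintype.prod_option]
    have h1 := gk_tele hx (w := e1) t.1 fun k => hδ.trans_le (hg k _).1
    simp only [r]
    rw [h1]
    have h2 := (hδ.trans_le (he1 t.1).1).ne'
    change _ = e t / NashG.U x e1
    field_simp

end StochGame
end

section
open scoped ENNReal NNReal Classical
open MeasureTheory Filter

namespace StochGame
variable {G : StochGame}

/-- recursion along histories -/
def hrec {T : Type} (init : T) (step : G.History → G.Ev → T → T) (s : G.S) : List G.Ev → T
  | [] => init
  | e :: l => step (s, l.reverse) e (hrec init step s l)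

theorem hist_rec {T : Type} (init : T) (step : G.History → G.Ev → T → T) :
    ∃ M : G.History → T, (∀ h, h.2.length = 0 → M h = init) ∧ ∀ h e, M (sn h e) = step h e (M h) := by
  refine ⟨fun h => hrec init step h.1 h.2.reverse, fun h hh => ?_, fun h e => ?_⟩
  · dsimp only; rw [List.length_eq_zero_iff.1 hh]; rfl
  · simp [snocH, hrec]

/-- topologically closed sets of runs -/
def ClK (K : Set G.Run) : Prop := ∀ r : G.Run, (∀ n, ∃ r' ∈ K, pf r' n = pf r n) → r ∈ K

theorem inner_reg (μ : Measure G.Run) [IsFiniteMeasure μ] {B : Set G.Run} (hB : MeasurableSet B) {η : ℝ≥0∞} (hη : η ≠ 0) :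
    ∃ K, K ⊆ B ∧ ClK K ∧ MeasurableSet K ∧ μ (B \ K) < η := by
  letI : TopologicalSpace G.S := ⊥
  letI : TopologicalSpace G.ActionProfile := ⊥
  haveI : DiscreteTopology G.S := ⟨rfl⟩
  haveI : DiscreteTopology G.ActionProfile := ⟨rfl⟩
  haveI : BorelSpace G.S := ⟨(borel_eq_top_of_discrete).symm⟩
  haveI : BorelSpace G.ActionProfile := ⟨(borel_eq_top_of_discrete).symm⟩
  haveI : Countable G.ActionProfile := by unfold ActionProfile; infer_instance
  haveI : SecondCountableTopology G.S := inferInstance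
  haveI : SecondCountableTopology G.ActionProfile := inferInstance
  haveI : BorelSpace (G.ActionProfile × G.S) := inferInstance
  haveI : BorelSpace G.Run := inferInstance
  haveI : TopologicalSpace.PseudoMetrizableSpace (G.ActionProfile × G.S) := inferInstance
  haveI : TopologicalSpace.PseudoMetrizableSpace (ℕ → G.ActionProfile × G.S) := inferInstance
  haveI : TopologicalSpace.PseudoMetrizableSpace G.Run := inferInstance
  obtain ⟨K, h1, h2, h3⟩ := hB.exists_isClosed_sdiff_lt (μ := μ) (measure_ne_top _ _) hη
  refine ⟨K, h1, fun r hr => ?_, h2.measurableSet, h3⟩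
  choose r' hr' he using hr
  refine h2.mem_of_tendsto (f := r') (b := atTop) ?_ (Eventually.of_forall hr')
  have hfst : ∀ n, (r' n).1 = r.1 := fun n => congrArg (fun h : G.History => h.1) (he n)
  have hsnd : ∀ k n, k < n → (r' n).2 k = r.2 k := by
    intro k n hk
    have := pf_mono_eq (n := k + 1) hk (he n)
    rw [pf_succ, pf_succ] at this
    exact (sn_inj this).2
  rw [Prod.tendsto_iff]
  constructor
  · simp only [hfst]; exact tendsto_const_nhds
  · rw [tendsto_pi_nhds]
    intro k
    refine Tendsto.congr' (f₁ := fun _ => r.2 k) ?_ tendsto_const_nhds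
    filter_upwards [eventually_gt_atTop k] with n hn
    exact (hsnd k n hn).symm

/-- histories not compatible with `K` -/
def ExK (K : Set G.Run) : Set G.History := {h | ∀ r, pf r h.2.length = h → r ∉ K}

theorem ExK_never {K : Set G.Run} (hK : ClK K) {r : G.Run} {L : ℕ} (h : ∀ n, L ≤ n → pf r n ∉ ExK K) : r ∈ K := by
  refine hK r fun n => ?_
  have := h (max n L) (le_max_right _ _)
  simp only [ExK, Set.mem_setOf_eq, not_forall, not_not, pf_len] at this
  obtain ⟨r', h1, h2⟩ := this
  exact ⟨r', h2, pf_mono_eq (le_max_left _ _) h1⟩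

variable {P : G.History → G.Profile → Measure G.Run} (hP : IsInducedFamily G P)
include hP

/-- indicator of a set of runs -/
noncomputable def ind (K : Set G.Run) : G.Run → ℝ := K.indicator fun _ => 1

omit hP in
theorem ind_abs (K : Set G.Run) (r : G.Run) : |ind K r| ≤ 1 := by
  by_cases h : r ∈ K <;> simp [ind, h]

omit hP in
theorem ind_meas {K : Set G.Run} (hK : MeasurableSet K) : Measurable (ind K) := measurable_const.indicator hK

omit hP in
theorem ind_int (μ : Measure G.Run) {K : Set G.Run} (hK : MeasurableSet K) : ∫ r, ind K r ∂μ = μ.real K := by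
  simp only [ind]
  rw [integral_indicator hK]; simp

theorem ExK_real {K : Set G.Run} (hK : MeasurableSet K) (σ : G.Profile) {x : G.History} (hx : x ∈ ExK K) :
    (P x σ).real Kᶜ = 1 := by
  haveI := hP.1 x σ
  rw [probReal_compl_eq_one_sub hK]
  have : P x σ K = 0 := by
    have := ae_cyl hP x σ
    rw [← compl_compl K]
    refine (mem_ae_iff (s := Kᶜ)).1 ?_
    filter_upwards [this] with r hr
    exact hx r hr
  simp [measureReal_def, this]

theorem density (σ : G.Profile) (h : G.History) {K : Set G.Run} (hK : MeasurableSet K) (hpos : P h σ K ≠ 0)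
    {q : ℝ} (hq0 : 0 ≤ q) (hq1 : q < 1) : ∃ h', Ext h h' ∧ q < (P h' σ).real K := by
  by_contra hc
  push Not at hc
  haveI := hP.1 h σ
  have hp : 0 < (P h σ).real K := ENNReal.toReal_pos hpos (measure_ne_top _ _)
  obtain ⟨K', h1, h2, h3, h4⟩ := inner_reg (P h σ) hK.compl (η := ENNReal.ofReal ((1 - q) * (P h σ).real K))
    (by rw [ne_eq, ENNReal.ofReal_eq_zero, not_le]; exact mul_pos (by linarith) hp)
  have h5 : (P h σ).real (Kᶜ \ K') ≤ (1 - q) * (P h σ).real K := by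
    rw [measureReal_def]
    exact ENNReal.toReal_le_of_le_ofReal (mul_nonneg (by linarith) hp.le) h4.le
  have h6 : (P h σ).real K'ᶜ ≤ (P h σ).real K + (P h σ).real (Kᶜ \ K') := by
    refine le_trans (measureReal_mono ?_) (measureReal_union_le _ _)
    intro r hr
    by_cases hk : r ∈ K
    · exact Or.inl hk
    · exact Or.inr ⟨hk, hr⟩
  have hIntg : ∀ h', ∫ r, (ind K r - q * ind K'ᶜ r) ∂(P h' σ) = (P h' σ).real K - q * (P h' σ).real K'ᶜ := by
    intro h'
    rw [integral_sub (P_integrable hP h' σ (ind_meas hK) (ind_abs K))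
      ((P_integrable hP h' σ (ind_meas h3.compl) (ind_abs _)).const_mul q), integral_const_mul, ind_int _ hK, ind_int _ h3.compl]
  have h7 := VL hP σ h (f := fun r => ind K r - q * ind K'ᶜ r) ((ind_meas hK).sub ((ind_meas h3.compl).const_mul q)) (C := 2)
    (fun r => by
      have a1 := ind_abs K r
      have a2 := ind_abs K'ᶜ r
      refine (abs_sub _ _).trans ?_
      rw [abs_mul, abs_of_nonneg hq0]
      nlinarith [abs_nonneg (ind K'ᶜ r)]) (V := fun _ => 0) (by simp) (ExK K')
    (fun h' _ _ => by rw [os_const (xr_mix _ _)])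
    (fun h' he hx _ => by
      rw [hIntg, ExK_real hP h3 σ hx]; linarith [hc h' he])
    (by
      refine Eventually.of_forall fun r hr δ hδ => Eventually.frequently (Eventually.of_forall fun n => ?_)
      have hk := ExK_never h2 hr
      have hk2 : r ∉ K := h1 hk
      simp [ind, hk, hk2, hδ.le])
  rw [hIntg] at h7
  have h8 : q * (P h σ).real K'ᶜ ≤ q * ((2 - q) * (P h σ).real K) := mul_le_mul_of_nonneg_left (by linarith) hq0
  have h9 : 0 < (P h σ).real K * (1 - q) ^ 2 := by
    have : 0 < 1 - q := by linarith
    positivity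
  nlinarith

end StochGame
end

section
open scoped ENNReal NNReal Classical
open MeasureTheory Filter

namespace StochGame
variable {G : StochGame}
variable {P : G.History → G.Profile → Measure G.Run} (hP : IsInducedFamily G P)
include hP

theorem stepA {f : G.I → G.Run → ℝ} (hf : ∀ i, Measurable (f i)) (hf0 : ∀ i r, 0 ≤ f i r) (hf1 : ∀ i r, f i r ≤ 1)
    {ε : ℝ} (hε : 0 < ε) (hε1 : ε ≤ 1) :
    ∃ (σ : G.Profile) (D A B : G.I → G.History → ℝ),
      (∀ i h, 0 ≤ D i h - A i h) ∧ (∀ i h, D i h ≤ 1) ∧ (∀ i h, 0 ≤ A i h) ∧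
      (∀ i h, vv P i (f i) h - ε ≤ D i h - A i h) ∧ (∀ i h, 0 ≤ B i h) ∧ (∀ i h, B i h ≤ 1) ∧
      (∀ i h c, osA (lastState h) (xr σ h) i c (fun e => D i (sn h e) - A i (sn h e)) ≤ D i h + B i h) ∧
      ∀ h i, ∀ᵐ r ∂(P h σ), Summable (fun n => B i (pf r n)) ∧ (∀ᶠ n in atTop, A i (pf r n) = 0) ∧
        (∃ l, Tendsto (fun n => D i (pf r n)) atTop (nhds l)) ∧ ∀ δ > 0, ∀ᶠ n in atTop, D i (pf r n) ≤ f i r + δ := by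
  choose D A h0 h1 hA hM hv hl using fun i => patch hP (i := i) (hf i) (hf0 i) (hf1 i) hε hε1
  choose x hx hN using fun h : G.History => NashG.nash (I := G.I) (A := G.A)
    (fun i a => ny (G.trans (lastState h) a) (fun t => D i (sn h (a, t)) - A i (sn h (a, t))))
  let σ : G.Profile := fun i h => mkPMF (x h i) (hx h i)
  have hxr : ∀ h, xr σ h = x h := by
    intro h; funext i c
    simp only [xr, σ]
    exact mkPMF_toReal _ _ _
  have hA0 : ∀ i h, 0 ≤ A i h := fun i h => by rcases hA i h with h | h <;> rw [h]; linarith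
  have hb : ∀ i h, |D i h - A i h| ≤ 1 := fun i h => abs_le.2 ⟨by linarith [h0 i h], by linarith [h1 i h, hA0 i h]⟩
  have hDb : ∀ i h, |D i h| ≤ 1 := fun i h => abs_le.2 ⟨by linarith [h0 i h, hA0 i h], h1 i h⟩
  have hAb : ∀ i h, |A i h| ≤ 1 := fun i h => abs_le.2 ⟨by linarith [hA0 i h], by linarith [h0 i h, h1 i h]⟩
  let B : G.I → G.History → ℝ := fun i h =>
    os (lastState h) (xr σ h) (fun e => D i (sn h e) - A i (sn h e)) - D i h
  have hNash : ∀ i h c, osA (lastState h) (xr σ h) i c (fun e => D i (sn h e) - A i (sn h e)) ≤ D i h + B i h := by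
    intro i h c
    simp only [B]
    rw [add_sub_cancel, hxr]
    exact hN h i c
  have hB0 : ∀ i h, 0 ≤ B i h := by
    intro i h
    obtain ⟨c, hc⟩ := hM i h (xr σ h) (xr_mix _ _)
    linarith [hNash i h c]
  have hB1 : ∀ i h, B i h ≤ 1 := by
    intro i h
    have := os_abs (s := lastState h) (xr_mix σ h) (d := fun e => D i (sn h e) - A i (sn h e)) (C := 1) (fun e => hb i _)
    simp only [B]
    linarith [(abs_le.1 this).2, h0 i h, hA0 i h]
  refine ⟨σ, D, A, B, h0, h1, hA0, hv, hB0, hB1, hNash, fun h i => ?_⟩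
  have s1 := drift_summable hP σ h (V := D i) (A := A i) (B := B i) (C := 1) (hDb i) (hAb i)
    (fun h => abs_le.2 ⟨by linarith [hB0 i h], hB1 i h⟩) (hA0 i) (hB0 i) (fun h' _ => by simp [B])
  have s2 := sub_conv hP σ h (V := D i) (C := 1) (hDb i) (fun h' _ => by
    have a1 : D i h' ≤ os (lastState h') (xr σ h') (fun e => D i (sn h' e) - A i (sn h' e)) := by
      have := hB0 i h'; simp only [B] at this; linarith
    refine a1.trans (os_mono (xr_mix _ _) (fun e => hb i _) (fun e => hDb i _) fun e => ?_)
    linarith [hA0 i (sn h' e)])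
  filter_upwards [s1, s2] with r r1 r2
  have hAz : ∀ᶠ n in atTop, A i (pf r n) = 0 := by
    have t0 := r1.tendsto_atTop_zero
    have t1 : ∀ᶠ n in atTop, A i (pf r (n + 1)) = 0 := by
      filter_upwards [t0.eventually_lt_const (show (0:ℝ) < ε / 2 by linarith)] with n hn
      rcases hA i (pf r (n + 1)) with h | h
      · exact h
      · have := hB0 i (pf r n); linarith
    obtain ⟨N, hN⟩ := eventually_atTop.1 t1
    filter_upwards [eventually_ge_atTop (N + 1)] with n hn
    obtain ⟨m, rfl⟩ : ∃ m, n = m + 1 := ⟨n - 1, by omega⟩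
    exact hN m (by omega)
  exact ⟨Summable.of_nonneg_of_le (fun n => hB0 i _) (fun n => by linarith [hA0 i (pf r (n+1))]) r1, hAz, r2, hl i r hAz⟩

end StochGame
end

section
open scoped ENNReal NNReal Classical
open MeasureTheory Filter

namespace StochGame
variable {G : StochGame}

/-- the set of runs with stable behaviour after stage `N` -/
def Bset (f D A B : G.I → G.Run → ℕ → ℝ) (δ : ℝ) (N : ℕ) (k : G.I → ℕ) : Set G.Run :=
  {r | (∀ n, Valid (pf r n)) ∧ ∀ i, k i * δ ≤ f i r 0 ∧ f i r 0 ≤ k i * δ + δ ∧ ∀ n, N ≤ n →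
    (A i r n = 0 ∧ ∑ m ∈ Finset.Ico N n, B i r m ≤ δ ∧ |D i r n - D i r N| ≤ δ ∧ D i r n ≤ f i r 0 + δ)}

theorem Bset_meas {f D A B : G.I → G.Run → ℕ → ℝ} (hf : ∀ i n, Measurable fun r => f i r n) (hD : ∀ i n, Measurable fun r => D i r n)
    (hA : ∀ i n, Measurable fun r => A i r n) (hB : ∀ i n, Measurable fun r => B i r n) (δ : ℝ) (N : ℕ) (k : G.I → ℕ) :
    MeasurableSet (Bset f D A B δ N k) := by
  unfold Bset
  rw [measurableSet_setOf]
  refine (Measurable.forall fun n => measurable_pf n _).and (Measurable.forall fun i => ?_)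
  refine (measurableSet_setOf.1 (measurableSet_le measurable_const (hf i 0))).and
    ((measurableSet_setOf.1 (measurableSet_le (hf i 0) measurable_const)).and
      (Measurable.forall fun n => Measurable.forall fun hn => ?_))
  refine (measurableSet_setOf.1 (measurableSet_eq_fun (hA i n) measurable_const)).and
    ((measurableSet_setOf.1 (measurableSet_le (Finset.measurable_sum _ fun m _ => hB i m) measurable_const)).and
    ((measurableSet_setOf.1 (measurableSet_le ((hD i n).sub (hD i N)).norm measurable_const)).and
    (measurableSet_setOf.1 (measurableSet_le (hD i n) ((hf i 0).add measurable_const)))))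

variable {P : G.History → G.Profile → Measure G.Run} (hP : IsInducedFamily G P)
include hP

theorem stepB {f : G.I → G.Run → ℝ} (hf : ∀ i, Measurable (f i)) (hf0 : ∀ i r, 0 ≤ f i r) (hf1 : ∀ i r, f i r ≤ 1)
    {σ : G.Profile} {D A B : G.I → G.History → ℝ} (hB0 : ∀ i h, 0 ≤ B i h)
    (hae : ∀ h i, ∀ᵐ r ∂(P h σ), Summable (fun n => B i (pf r n)) ∧ (∀ᶠ n in atTop, A i (pf r n) = 0) ∧
        (∃ l, Tendsto (fun n => D i (pf r n)) atTop (nhds l)) ∧ ∀ δ > 0, ∀ᶠ n in atTop, D i (pf r n) ≤ f i r + δ)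
    {δ : ℝ} (hδ : 0 < δ) (hδ1 : δ ≤ 1) :
    ∃ (h : G.History) (K : Set G.Run) (c : G.I → ℝ), Valid h ∧ ClK K ∧ MeasurableSet K ∧ (P h σ).real Kᶜ < δ ∧
      (∀ i, 0 ≤ c i ∧ c i ≤ 1 ∧ D i h ≤ c i + 2 * δ) ∧
      ∀ r ∈ K, ∀ i, c i ≤ f i r ∧ f i r ≤ c i + δ ∧ ∀ n, h.2.length ≤ n →
        (A i (pf r n) = 0 ∧ ∑ m ∈ Finset.Ico h.2.length n, B i (pf r m) ≤ δ ∧ |D i (pf r n) - D i (pf r h.2.length)| ≤ 2 * δ) := by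
  let S := Bset (fun i r _ => f i r) (fun i r n => D i (pf r n)) (fun i r n => A i (pf r n)) (fun i r n => B i (pf r n)) δ
  have hS : ∀ N k, MeasurableSet (S N k) := fun N k => Bset_meas (fun i _ => hf i) (fun i n => measurable_pf n _)
    (fun i n => measurable_pf n _) (fun i n => measurable_pf n _) δ N k
  obtain ⟨s⟩ := G.nonemptyS
  let h0 := initH G s
  haveI := hP.1 h0 σ
  have hU : ∀ᵐ r ∂(P h0 σ), ∃ q : ℕ × (G.I → ℕ), r ∈ S q.1 q.2 := by
    filter_upwards [ae_valid hP σ h0 (by simp [h0, initH, Valid, ValidFrom]), ae_all_iff.2 (hae h0)] with r hr1 hr2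
    have hev : ∀ i, ∃ N, ∀ M, N ≤ M → ∀ n, M ≤ n → (A i (pf r n) = 0 ∧ ∑ m ∈ Finset.Ico M n, B i (pf r m) ≤ δ ∧
        |D i (pf r n) - D i (pf r M)| ≤ δ ∧ D i (pf r n) ≤ f i r + δ) := by
      intro i
      obtain ⟨h1, h2, ⟨l, h3⟩, h4⟩ := hr2 i
      obtain ⟨N2, hN2⟩ := eventually_atTop.1 h2
      obtain ⟨N4, hN4⟩ := eventually_atTop.1 (h4 δ hδ)
      obtain ⟨N3, hN3⟩ := Metric.cauchySeq_iff.1 h3.cauchySeq δ hδ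
      obtain ⟨N1, hN1⟩ := Metric.cauchySeq_iff.1 h1.hasSum.tendsto_sum_nat.cauchySeq δ hδ
      refine ⟨N1 + N2 + N3 + N4, fun M hM n hn => ⟨hN2 n (by omega), ?_, ?_, hN4 n (by omega)⟩⟩
      · rw [Finset.sum_Ico_eq_sub _ hn]
        have := hN1 n (by omega) M (by omega)
        rw [Real.dist_eq] at this
        exact ((le_abs_self _).trans this.le)
      · have := hN3 n (by omega) M (by omega)
        rw [Real.dist_eq] at this
        exact this.le
    choose N hN using hev
    refine ⟨(Finset.univ.sup N, fun i => ⌊f i r / δ⌋₊), (RunValid_iff r).1 hr1, fun i => ⟨?_, ?_, fun n hn =>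
      hN i _ (Finset.le_sup (Finset.mem_univ i)) n hn⟩⟩
    · have := Nat.floor_le (div_nonneg (hf0 i r) hδ.le)
      rwa [le_div_iff₀ hδ] at this
    · have := (Nat.lt_floor_add_one (f i r / δ)).le
      rw [div_le_iff₀ hδ] at this
      dsimp only
      linarith
  obtain ⟨⟨N, k⟩, hq⟩ : ∃ q : ℕ × (G.I → ℕ), P h0 σ (S q.1 q.2) ≠ 0 := by
    by_contra hc
    push Not at hc
    have := measure_iUnion_null hc
    have h2 : P h0 σ (⋃ q : ℕ × (G.I → ℕ), S q.1 q.2)ᶜ = 0 := by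
      refine (mem_ae_iff (s := ⋃ q : ℕ × (G.I → ℕ), S q.1 q.2)).1 ?_
      filter_upwards [hU] with r hr
      exact Set.mem_iUnion.2 hr
    have h3 := prob_add_prob_compl (μ := P h0 σ) (MeasurableSet.iUnion fun q : ℕ × (G.I → ℕ) => hS q.1 q.2)
    rw [this, h2] at h3
    simp at h3
  dsimp only at hq
  obtain ⟨h1, h1l, h1p⟩ : ∃ h1 : G.History, h1.2.length = N ∧ P h1 σ (S N k) ≠ 0 := by
    by_contra hc
    push Not at hc
    have ht := E_tower hP σ (g := fun r => ind (S N k) r) (ind_meas (hS N k)) (ind_abs _) N h0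
    have hz : ∀ r : G.Run, ∫ r', ind (S N k) r' ∂P (pf r (h0.2.length + N)) σ = 0 := by
      intro r
      rw [ind_int _ (hS N k), measureReal_def, hc]
      · rfl
      · rw [pf_len]; simp [h0, initH]
    simp only [hz] at ht
    rw [ind_int _ (hS N k), integral_zero, measureReal_def, ENNReal.toReal_eq_zero_iff] at ht
    rcases ht with ht | ht
    · exact hq ht
    · exact measure_ne_top _ _ ht
  obtain ⟨h, he, hd⟩ := density hP σ h1 (hS N k) h1p (q := 1 - δ / 2) (by linarith) (by linarith)
  haveI := hP.1 h σ
  have hNL : N ≤ h.2.length := h1l ▸ Ext_len he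
  obtain ⟨r0, hr0, hr0'⟩ : ∃ r0 ∈ S N k, pf r0 h.2.length = h := by
    by_contra hc
    push Not at hc
    have : P h σ (S N k) = 0 := by
      rw [← compl_compl (S N k)]
      refine (mem_ae_iff (s := (S N k)ᶜ)).1 ?_
      filter_upwards [ae_cyl hP h σ] with r hr hr'
      exact hc r hr' hr
    rw [measureReal_def, this] at hd
    simp at hd
    linarith
  obtain ⟨K, k1, k2, k3, k4⟩ := inner_reg (P h σ) (hS N k) (η := ENNReal.ofReal (δ / 2))
    (by rw [ne_eq, ENNReal.ofReal_eq_zero, not_le]; linarith)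
  have h5 : (P h σ).real (S N k \ K) ≤ δ / 2 := by
    rw [measureReal_def]
    exact ENNReal.toReal_le_of_le_ofReal (by linarith) k4.le
  have h6 : (P h σ).real (S N k) ≤ (P h σ).real K + (P h σ).real (S N k \ K) := by
    refine le_trans (measureReal_mono ?_) (measureReal_union_le _ _)
    intro r hr
    by_cases hk : r ∈ K
    · exact Or.inl hk
    · exact Or.inr ⟨hr, hk⟩
  refine ⟨h, K, fun i => k i * δ, ?_, k2, k3, ?_, fun i => ⟨by positivity, ?_, ?_⟩, fun r hr i => ?_⟩
  · rw [← hr0']; exact hr0.1 _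
  · rw [probReal_compl_eq_one_sub k3]; linarith
  · exact (hr0.2 i).1.trans (hf1 i r0)
  · have h7 := ((hr0.2 i).2.2 _ hNL).2.2.2
    have h8 := (hr0.2 i).2.1
    dsimp only at h7 h8
    rw [hr0'] at h7
    linarith
  · obtain ⟨-, hr2⟩ := k1 hr
    obtain ⟨a1, a2, a3⟩ := hr2 i
    refine ⟨a1, a2, fun n hn => ?_⟩
    obtain ⟨b1, b2, b3, -⟩ := a3 n (hNL.trans hn)
    obtain ⟨-, -, c3, -⟩ := a3 _ hNL
    refine ⟨b1, le_trans ?_ b2, ?_⟩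
    · refine Finset.sum_le_sum_of_subset_of_nonneg (Finset.Ico_subset_Ico_left hNL) fun m _ _ => hB0 _ _
    · dsimp only at b3 c3
      rw [abs_le] at b3 c3 ⊢
      constructor <;> linarith

end StochGame
end

section
open scoped ENNReal NNReal Classical
open MeasureTheory Filter

namespace StochGame
variable {G : StochGame}

theorem os_min_le {s : G.S} {y : ∀ i, G.A i → ℝ} (hy : y ∈ Mix G) {q : G.Ev → ℝ} {c : ℝ} (hq0 : ∀ t, 0 ≤ q t) (hqc : ∀ t, q t ≤ c)
    (hq : os s y q = 1) {m θ : ℝ} (hm : 0 ≤ m) (hθ : 0 < θ) :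
    os s y (fun t => min (m * q t / θ) 1) ≤ min (m / θ) 1 := by
  have hb : ∀ t, |min (m * q t / θ) 1| ≤ 1 := fun t => by
    have : 0 ≤ m * q t / θ := div_nonneg (mul_nonneg hm (hq0 t)) hθ.le
    rw [abs_of_nonneg (le_min this zero_le_one)]
    exact min_le_right _ _
  refine le_min ?_ ?_
  · have h1 : os s y (fun t => m / θ * q t) = m / θ := by rw [os_mul, hq, mul_one]
    rw [← h1]
    refine os_mono hy hb (C' := m / θ * c) (fun t => ?_) fun t => ?_
    · rw [abs_of_nonneg (mul_nonneg (div_nonneg hm hθ.le) (hq0 t))]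
      exact mul_le_mul_of_nonneg_left (hqc t) (div_nonneg hm hθ.le)
    · refine (min_le_left _ _).trans (le_of_eq ?_)
      ring
  · exact (le_abs_self _).trans (os_abs hy hb)

theorem Mlem (σ : G.Profile) (h : G.History) {e : G.History → ℝ} {δ C : ℝ} (hδ : 0 < δ) (he : ∀ h, δ ≤ e h ∧ e h ≤ C)
    (hm : ∀ h, e h = os (lastState h) (xr σ h) fun t => e (sn h t)) :
    ∃ M : Option G.I → G.History → ℝ, (∀ k h, 0 ≤ M k h) ∧ (∀ k, M k h = 1) ∧
      (∀ h', Ext h h' → ∏ k, M k h' = e h' / e h) ∧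
      (∀ h', Ext h h' → ∀ y ∈ Mix G, ∀ θ > 0,
        os (lastState h') y (fun t => min (M none (sn h' t) / θ) 1) ≤ min (M none h' / θ) 1) ∧
      (∀ h', Ext h h' → ∀ j, ∀ y ∈ Mix G, y j = xr σ h' j → ∀ θ > 0,
        os (lastState h') y (fun t => min (M (some j) (sn h' t) / θ) 1) ≤ min (M (some j) h' / θ) 1) := by
  choose q q0 q1 q2 q3 q4 using fun h' : G.History => tests (s := lastState h') (xr_mix σ h') (e := fun t => e (sn h' t)) hδ
    (fun t => he (sn h' t))
  choose M m1 m2 using fun k : Option G.I => hist_rec (G := G) (1 : ℝ)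
    (fun h' t m => if h.2.length ≤ h'.2.length then m * q h' k t else 1)
  have hpos : ∀ h, 0 < e h := fun h => hδ.trans_le (he h).1
  have hs : ∀ h', Ext h h' → ∀ k t, M k (sn h' t) = M k h' * q h' k t := fun h' hh k t => by
    rw [m2, if_pos (Ext_len hh)]
  have h0 : ∀ k h, 0 ≤ M k h := by
    intro k h'
    obtain ⟨n, hn⟩ : ∃ n, h'.2.length = n := ⟨_, rfl⟩
    induction n generalizing h' with
    | zero => rw [m1 k h' hn]; exact zero_le_one
    | succ n ih =>
      rcases sn_cases h' with h1 | ⟨h1, t, rfl⟩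
      · omega
      · rw [m2]
        rw [sn_len] at hn
        split_ifs
        · exact mul_nonneg (ih h1 (by omega)) (q0 _ _ _)
        · exact zero_le_one
  have hh : ∀ k, M k h = 1 := by
    intro k
    rcases sn_cases h with h1 | ⟨h1, t, hh1⟩
    · exact m1 k h h1
    · have : h.2.length = h1.2.length + 1 := by rw [hh1, sn_len]
      conv_lhs => rw [hh1]
      rw [m2, if_neg (by omega)]
  refine ⟨M, h0, hh, ?_, ?_, ?_⟩
  · intro h'
    obtain ⟨n, hn⟩ : ∃ n, h'.2.length = n := ⟨_, rfl⟩
    induction n generalizing h' with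
    | zero =>
      intro hx
      rcases Ext_cases hx with rfl | ⟨h1, t, rfl, -⟩
      · simp [hh, (hpos _).ne']
      · rw [sn_len] at hn; omega
    | succ n ih =>
      intro hx
      rcases Ext_cases hx with rfl | ⟨h1, t, rfl, h2⟩
      · simp [hh, (hpos _).ne']
      · rw [sn_len] at hn
        simp only [hs h1 h2]
        rw [Finset.prod_mul_distrib, ih h1 (by omega) h2, q4, ← hm h1]
        have a1 := (hpos h1).ne'
        have a2 := (hpos h).ne'
        field_simp
  · intro h' hx y hy θ hθ
    simp only [hs h' hx]
    exact os_min_le hy (q0 h' none) (q1 h' none) (q2 h' y hy) (h0 _ _) hθ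
  · intro h' hx j y hy hj θ hθ
    simp only [hs h' hx]
    exact os_min_le hy (q0 h' _) (q1 h' _) (q3 h' j y hy hj) (h0 _ _) hθ

/-- the first exit from the complement of `Ex` -/
noncomputable def fx (Ex : Set G.History) (L : ℕ) (h' : G.History) : Option G.History :=
  if H : ∃ k, L ≤ k ∧ k ≤ h'.2.length ∧ tk h' k ∈ Ex then some (tk h' (Nat.find H)) else none

theorem fx_alive {Ex : Set G.History} {L : ℕ} {h' : G.History} (h : Alive Ex L h') : fx Ex L h' = none := by
  unfold fx
  rw [dif_neg]
  rintro ⟨k, h1, h2, h3⟩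
  exact h k h1 h2 h3

theorem fx_exit {Ex : Set G.History} {L : ℕ} {x h' : G.History} (hx : x ∈ Ex) (hL : L ≤ x.2.length)
    (h : ∀ k, L ≤ k → k < x.2.length → tk x k ∉ Ex) (he : Ext x h') : fx Ex L h' = some x := by
  obtain ⟨h1, h2⟩ := Ext_iff.1 he
  have H : ∃ k, L ≤ k ∧ k ≤ h'.2.length ∧ tk h' k ∈ Ex := ⟨x.2.length, hL, h1, by rw [h2]; exact hx⟩
  unfold fx
  rw [dif_pos H]
  have : Nat.find H = x.2.length := by
    rw [Nat.find_eq_iff]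
    refine ⟨⟨hL, h1, by rw [h2]; exact hx⟩, fun k hk hc => ?_⟩
    refine h k hc.1 hk ?_
    have := hc.2.2
    rw [← h2, tk_tk h' hk.le]
    exact this
  rw [this, h2]

end StochGame
end

section
open scoped ENNReal NNReal Classical
open MeasureTheory Filter

namespace StochGame
variable {G : StochGame}
variable {P : G.History → G.Profile → Measure G.Run} (hP : IsInducedFamily G P)
include hP

theorem stepC {f : G.I → G.Run → ℝ} (hf : ∀ i, Measurable (f i)) (hf0 : ∀ i r, 0 ≤ f i r) (hf1 : ∀ i r, f i r ≤ 1)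
    {σ : G.Profile} {D A B : G.I → G.History → ℝ} {ε δ θ : ℝ} (hε : 0 < ε) (hδ : 0 < δ) (hδ1 : δ ≤ 1) (hθ : 0 < θ)
    (hθδ : θ ^ Fintype.card (Option G.I) * (2 * δ) ≤ 1)
    (h0 : ∀ i h, 0 ≤ D i h - A i h) (h1 : ∀ i h, D i h ≤ 1) (hA0 : ∀ i h, 0 ≤ A i h)
    (hv : ∀ i h, vv P i (f i) h - ε ≤ D i h - A i h) (hB0 : ∀ i h, 0 ≤ B i h)
    (hN : ∀ i h c, osA (lastState h) (xr σ h) i c (fun e => D i (sn h e) - A i (sn h e)) ≤ D i h + B i h)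
    {h : G.History} {K : Set G.Run} {c : G.I → ℝ} (hKc : ClK K) (hK : MeasurableSet K) (hKδ : (P h σ).real Kᶜ < δ)
    (hc : ∀ i, 0 ≤ c i ∧ c i ≤ 1 ∧ D i h ≤ c i + 2 * δ)
    (hKr : ∀ r ∈ K, ∀ i, c i ≤ f i r ∧ f i r ≤ c i + δ ∧ ∀ n, h.2.length ≤ n →
        (A i (pf r n) = 0 ∧ ∑ m ∈ Finset.Ico h.2.length n, B i (pf r m) ≤ δ ∧ |D i (pf r n) - D i (pf r h.2.length)| ≤ 2 * δ)) :
    ∃ σ' : G.Profile, ∀ i (ρ : G.Strategy i), ∫ r, f i r ∂(P h (Function.update σ' i ρ)) -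
      (6 * δ + ε + Fintype.card (Option G.I) / θ) ≤ ∫ r, f i r ∂(P h σ') := by
  set L := h.2.length with hL
  set Ex := ExK K with hEx
  have hfb : ∀ i r, |f i r| ≤ 1 := fun i r => abs_le.2 ⟨by linarith [hf0 i r], hf1 i r⟩
  let p : G.History → ℝ := fun h' => ∫ r, ind Kᶜ r ∂(P h' σ)
  have hp : ∀ h', p h' = (P h' σ).real Kᶜ := fun h' => ind_int _ hK.compl
  have hp0 : ∀ h', 0 ≤ p h' := fun h' => by rw [hp]; exact measureReal_nonneg
  have hp1 : ∀ h', p h' ≤ 1 := fun h' => by haveI := hP.1 h' σ; rw [hp]; exact measureReal_le_one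
  have hps : ∀ h', p h' = os (lastState h') (xr σ h') fun t => p (sn h' t) := fun h' =>
    E_step hP h' σ (ind_meas hK.compl) (ind_abs _)
  have hpb : ∀ h', |p h'| ≤ 1 := fun h' => abs_le.2 ⟨by linarith [hp0 h'], hp1 h'⟩
  obtain ⟨M, M0, M1, M2, M3, M4⟩ := Mlem σ h (e := fun h' => p h' + δ) (C := 1 + δ) hδ
    (fun h' => ⟨by linarith [hp0 h'], by linarith [hp1 h']⟩) (fun h' => by
      rw [os_add (C := 1) (C' := δ) (fun t => hpb _) (fun t => (abs_of_pos hδ).le), os_const (xr_mix _ _), ← hps])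
  -- blame
  have hbl : ∀ x, Ext h x → x ∈ Ex → ∃ k, θ ≤ M k x := by
    intro x hx hxe
    by_contra hcon
    push Not at hcon
    have a1 := M2 x hx
    rw [hp x, ExK_real hP hK σ hxe, hp h] at a1
    have a2 : ∏ k, M k x ≤ θ ^ Fintype.card (Option G.I) := by
      have := Finset.prod_le_prod (s := Finset.univ) (f := fun k => M k x) (g := fun _ => θ) (fun k _ => M0 k x) (fun k _ => (hcon k).le)
      simpa using this
    rw [a1, div_le_iff₀ (by linarith [measureReal_nonneg (μ := P h σ) (s := Kᶜ)])] at a2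
    have a3 : θ ^ Fintype.card (Option G.I) * ((P h σ).real Kᶜ + δ) ≤ θ ^ Fintype.card (Option G.I) * (2 * δ) :=
      mul_le_mul_of_nonneg_left (by linarith) (by positivity)
    linarith
  have hpun : ∀ x : G.History, ∃ (k : Option G.I) (τ : G.Profile), Ext h x → x ∈ Ex → θ ≤ M k x ∧ ∀ i, k = some i →
      ∀ ρ, ∫ r, f i r ∂(P x (Function.update τ i ρ)) ≤ vv P i (f i) x + δ := by
    intro x
    by_cases hx : Ext h x ∧ x ∈ Ex
    · obtain ⟨k, hk⟩ := hbl x hx.1 hx.2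
      cases k with
      | none => exact ⟨none, σ, fun _ _ => ⟨hk, fun i hi => by simp at hi⟩⟩
      | some j =>
        obtain ⟨τ, hτ⟩ := vv_punish hP j (hf0 j) (hf1 j) x hδ
        refine ⟨some j, τ, fun _ _ => ⟨hk, fun i hi => ?_⟩⟩
        obtain rfl := Option.some_injective _ hi
        exact hτ
    · exact ⟨none, σ, fun a b => (hx ⟨a, b⟩).elim⟩
  choose kk τ hτ using hpun
  let σ' : G.Profile := fun i h' => (fx Ex L h').elim (σ i h') (fun x => τ x i h')
  have hsa : ∀ h', Alive Ex L h' → ∀ i, σ' i h' = σ i h' := fun h' ha i => by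
    simp only [σ']; rw [fx_alive ha]; rfl
  have hse : ∀ x, x ∈ Ex → L ≤ x.2.length → (∀ k, L ≤ k → k < x.2.length → tk x k ∉ Ex) → ∀ h', Ext x h' →
      ∀ i, σ' i h' = τ x i h' := fun x a1 a2 a3 h' a4 i => by
    simp only [σ']; rw [fx_exit a1 a2 a3 a4]; rfl
  have hxa : ∀ h', Alive Ex L h' → xr σ' h' = xr σ h' := fun h' ha => by
    funext i c; simp only [xr]; rw [hsa h' ha]
  refine ⟨σ', fun i ρ => ?_⟩
  -- baseline
  have hbase : c i - δ ≤ ∫ r, f i r ∂(P h σ') := by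
    have b1 : ∫ r, ind Kᶜ r ∂(P h σ') ≤ p h := by
      refine VL hP σ' h (ind_meas hK.compl) (ind_abs _) hpb Ex (fun h' _ ha => ?_) (fun h' _ hx _ => ?_)
        (Eventually.of_forall fun r hr ζ hζ => Eventually.frequently (Eventually.of_forall fun n => ?_))
      · rw [hxa h' ha, ← hps]
      · rw [hp, ExK_real hP hK σ hx, ind_int _ hK.compl, ExK_real hP hK σ' hx]
      · have : r ∈ K := ExK_never hKc hr
        have h2 : ind Kᶜ r = 0 := by simp [ind, this]
        rw [h2]; linarith [hp0 (pf r n)]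
    have b2 : ∫ r, (c i - ind Kᶜ r) ∂(P h σ') ≤ ∫ r, f i r ∂(P h σ') := by
      refine integral_mono (P_integrable hP h σ' (measurable_const.sub (ind_meas hK.compl)) (C := 2) (fun r => ?_))
        (P_integrable hP h σ' (hf i) (hfb i)) fun r => ?_
      · have := ind_abs Kᶜ r
        rw [abs_le] at this ⊢
        constructor <;> linarith [(hc i).1, (hc i).2.1]
      · by_cases hr : r ∈ K
        · have h2 : ind Kᶜ r = 0 := by simp [ind, hr]
          dsimp only
          rw [h2]; linarith [(hKr r hr i).1]
        · have h2 : ind Kᶜ r = 1 := by simp [ind, hr]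
          dsimp only
          rw [h2]; linarith [(hc i).2.1, hf0 i r]
    haveI := hP.1 h σ'
    rw [integral_sub (integrable_const _) (P_integrable hP h σ' (ind_meas hK.compl) (ind_abs _))] at b2
    simp only [integral_const, probReal_univ, one_smul] at b2
    rw [hp] at b1
    linarith
  -- deviation
  set ν : G.Profile := Function.update σ' i ρ with hν
  have hνj : ∀ j, j ≠ i → ν j = σ' j := fun j hj => Function.update_of_ne hj _ _
  let κ : ℝ := ε + δ + max (c i - D i h + 3 * δ) 0
  let S : G.History → ℝ := fun h' => ∑ m ∈ Finset.Ico L h'.2.length, B i (tk h' m)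
  have hS0 : ∀ h', 0 ≤ S h' := fun h' => Finset.sum_nonneg fun _ _ => hB0 _ _
  have hSs : ∀ h' t, L ≤ h'.2.length → S (sn h' t) = S h' + B i h' := by
    intro h' t hh
    simp only [S]
    rw [sn_len, Finset.sum_Ico_succ_top hh, tk_sn _ _ le_rfl, tk_self _ le_rfl]
    congr 1
    refine Finset.sum_congr rfl fun m hm => ?_
    rw [tk_sn _ _ (Finset.mem_Ico.1 hm).2.le]
  let ks : Finset (Option G.I) := Finset.univ.erase (some i)
  let T : G.History → ℝ := fun h' => ∑ k ∈ ks, min (M k h' / θ) 1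
  have hT1 : ∀ k h', 0 ≤ min (M k h' / θ) 1 := fun k h' => le_min (div_nonneg (M0 k h') hθ.le) zero_le_one
  have hT0 : ∀ h', 0 ≤ T h' := fun h' => Finset.sum_nonneg fun k _ => hT1 k h'
  have hTb : ∀ h', T h' ≤ Fintype.card (Option G.I) := fun h' => by
    refine (Finset.sum_le_card_nsmul ks _ 1 fun k _ => min_le_right _ _).trans ?_
    rw [nsmul_one]
    exact_mod_cast Finset.card_le_univ ks
  let V : G.History → ℝ := fun h' => (D i h' - A i h') + (δ - min δ (S h')) + κ + T h'
  have hκ0 : ε + δ ≤ κ := by simp only [κ]; linarith [le_max_right (c i - D i h + 3 * δ) 0]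
  have hκ1 : c i - D i h + 3 * δ ≤ κ := by simp only [κ]; linarith [le_max_left (c i - D i h + 3 * δ) 0]
  have hm1 : ∀ h', 0 ≤ δ - min δ (S h') := fun h' => by linarith [min_le_left δ (S h')]
  have hm2 : ∀ h', δ - min δ (S h') ≤ δ := fun h' => by linarith [le_min hδ.le (hS0 h')]
  have hDA : ∀ h', D i h' - A i h' ≤ 1 := fun h' => by linarith [h1 i h', hA0 i h']
  have hVb : ∀ h', |V h'| ≤ 1 + δ + κ + Fintype.card (Option G.I) := fun h' => by
    rw [abs_of_nonneg (by simp only [V]; linarith [h0 i h', hm1 h', hT0 h'])]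
    simp only [V]; linarith [hDA h', hm2 h', hTb h']
  have hmain : ∫ r, f i r ∂(P h ν) ≤ V h := by
    refine VL hP ν h (hf i) (C := 1 + δ + κ + Fintype.card (Option G.I))
      (fun r => (hfb i r).trans (by
        have : (0:ℝ) ≤ Fintype.card (Option G.I) := Nat.cast_nonneg _
        linarith)) hVb Ex (fun h' he ha => ?_) (fun x he hx hfirst => ?_)
      ((ae_cyl hP h ν).mono fun r hcy hr ζ hζ => Eventually.frequently ?_)
    · have hlen := Ext_len he
      obtain ⟨r, hr1, hr2⟩ : ∃ r, pf r h'.2.length = h' ∧ r ∈ K := by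
        have := ha _ hlen le_rfl
        rw [tk_self _ le_rfl] at this
        simpa [hEx, ExK] using this
      have hKr' := (hKr r hr2 i).2.2
      have hAz : A i h' = 0 := by rw [← hr1]; exact (hKr' _ hlen).1
      have hSn : S h' + B i h' ≤ δ := by
        have := (hKr' (h'.2.length + 1) (by omega)).2.1
        rw [Finset.sum_Ico_succ_top hlen, hr1] at this
        refine le_trans (le_of_eq ?_) this
        simp only [S]
        congr 1
        refine Finset.sum_congr rfl fun m hm => ?_
        rw [← tk_pf r (Finset.mem_Ico.1 hm).2.le, hr1]
      have hmix := xr_mix ν h'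
      have hj : ∀ j, j ≠ i → xr ν h' j = xr σ h' j := fun j hj => by
        rw [← hxa h' ha]; funext c; simp only [xr]; rw [hνj j hj]
      have d1 : os (lastState h') (xr ν h') (fun t => D i (sn h' t) - A i (sn h' t)) ≤ D i h' + B i h' :=
        os_dev_le (xr_mix σ h') hmix hj (hN i h')
      have d2 : os (lastState h') (xr ν h') (fun t => T (sn h' t)) ≤ T h' := by
        have gen : ∀ ks' : Finset (Option G.I), ks' ⊆ ks →
            os (lastState h') (xr ν h') (fun t => ∑ k ∈ ks', min (M k (sn h' t) / θ) 1) ≤ ∑ k ∈ ks', min (M k h' / θ) 1 := by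
          intro ks'
          induction ks' using Finset.induction_on with
          | empty => intro _; simp only [Finset.sum_empty]; rw [os_const hmix]
          | insert k s hk ih =>
            intro hsub
            simp only [Finset.sum_insert hk]
            rw [os_add (C := 1) (C' := (s.card : ℝ)) (fun t => by rw [abs_of_nonneg (hT1 _ _)]; exact min_le_right _ _)
              (fun t => by
                rw [abs_of_nonneg (Finset.sum_nonneg fun k _ => hT1 k _)]
                refine (Finset.sum_le_card_nsmul s _ 1 fun k _ => min_le_right _ _).trans ?_
                rw [nsmul_one])]
            refine add_le_add ?_ (ih fun a ha => hsub (Finset.mem_insert_of_mem ha))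
            have hki : k ≠ some i := (Finset.mem_erase.1 (hsub (Finset.mem_insert_self k s))).1
            cases k with
            | none => exact M3 h' he _ hmix θ hθ
            | some j => exact M4 h' he j _ hmix (hj j fun hji => hki (by rw [hji])) θ hθ
        exact gen ks subset_rfl
      have d3 : (fun t => V (sn h' t)) = fun t => (D i (sn h' t) - A i (sn h' t)) + (T (sn h' t) + (δ - (S h' + B i h') + κ)) := by
        funext t
        simp only [V]
        rw [hSs h' t hlen, min_eq_right hSn]
        ring
      rw [d3, os_add (C := 1) (C' := Fintype.card (Option G.I) + |δ - (S h' + B i h') + κ|)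
          (fun t => by rw [abs_of_nonneg (h0 i _)]; exact hDA _)
          (fun t => (abs_add_le _ _).trans (by rw [abs_of_nonneg (hT0 _)]; linarith [hTb (sn h' t)])),
        os_add (C := Fintype.card (Option G.I)) (C' := |δ - (S h' + B i h') + κ|)
          (fun t => by rw [abs_of_nonneg (hT0 _)]; exact hTb _) (fun t => le_rfl), os_const hmix]
      have : min δ (S h') = S h' := min_eq_right (by linarith [hB0 i h'])
      simp only [V]
      rw [this, hAz]
      linarith
    · have hlen := Ext_len he
      obtain ⟨t1, t2⟩ := hτ x he hx
      by_cases hk : kk x = some i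
      · have : P x ν = P x (Function.update (τ x) i ρ) := by
          refine P_congr hP x fun j h' hh => ?_
          by_cases hji : j = i
          · subst hji; simp [hν]
          · rw [hνj j hji, Function.update_of_ne hji]
            exact hse x hx hlen hfirst h' hh j
        rw [this]
        have := t2 i hk ρ
        simp only [V]
        linarith [hv i x, hm1 x, hT0 x]
      · have a1 : ∫ r, f i r ∂(P x ν) ≤ 1 := (le_abs_self _).trans (E_abs hP x ν (hfb i))
        have a2 : (1:ℝ) ≤ T x := by
          have b1 : min (M (kk x) x / θ) 1 = 1 := min_eq_right (by rw [le_div_iff₀ hθ]; linarith)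
          rw [← b1]
          exact Finset.single_le_sum (f := fun k => min (M k x / θ) 1) (fun k _ => hT1 k x)
            (Finset.mem_erase.2 ⟨hk, Finset.mem_univ _⟩)
        simp only [V]
        linarith [h0 i x, hm1 x]
    · have hrK : r ∈ K := ExK_never hKc hr
      filter_upwards [eventually_ge_atTop L] with n hn
      obtain ⟨-, g2, g3⟩ := hKr r hrK i
      obtain ⟨g4, -, g5⟩ := g3 n hn
      rw [hcy, abs_le] at g5
      simp only [V]
      rw [g4]
      linarith [hm1 (pf r n), hT0 (pf r n)]
  have hVh : V h ≤ c i + 5 * δ + ε + Fintype.card (Option G.I) / θ := by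
    have t1 : T h ≤ Fintype.card (Option G.I) / θ := by
      simp only [T, M1]
      refine (Finset.sum_le_card_nsmul ks _ (1 / θ) fun k _ => min_le_left _ _).trans ?_
      rw [nsmul_eq_mul, mul_one_div]
      refine div_le_div_of_nonneg_right ?_ hθ.le
      exact_mod_cast Finset.card_le_univ ks
    simp only [V, κ]
    have := (hc i).2.2
    rcases max_cases (c i - D i h + 3 * δ) 0 with ⟨e1, e2⟩ | ⟨e1, e2⟩ <;> rw [e1] <;> linarith [hA0 i h, hm2 h]
  linarith

end StochGame
end

section
open scoped ENNReal NNReal Classical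
open MeasureTheory Filter

namespace StochGame
variable {G : StochGame}
variable {P : G.History → G.Profile → Measure G.Run} (hP : IsInducedFamily G P)
include hP

theorem main01 {f : G.I → G.Run → ℝ} (hf : ∀ i, Measurable (f i)) (hf0 : ∀ i r, 0 ≤ f i r) (hf1 : ∀ i r, f i r ≤ 1)
    (hsh : ∀ i r, RunValid r → f i r = f i (shiftRun r)) {ε : ℝ} (hε : 0 < ε) (hε1 : ε ≤ 1) :
    ∃ s, ∃ σ : G.Profile, ∀ i (ρ : G.Strategy i),
      ∫ r, f i r ∂(P (initH G s) (Function.update σ i ρ)) - ε ≤ ∫ r, f i r ∂(P (initH G s) σ) := by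
  obtain ⟨σ, D, A, B, h0, h1, hA0, hv, hB0, hB1, hN, hae⟩ := stepA hP hf hf0 hf1 (ε := ε / 4) (by linarith) (by linarith)
  set n := Fintype.card (Option G.I) with hn
  have hnp : (0:ℝ) < n := by
    have : 0 < n := Fintype.card_pos
    exact_mod_cast this
  let θ : ℝ := 4 * n / ε
  have hθ : 0 < θ := by positivity
  let δ : ℝ := min (ε / 40) (1 / (2 * θ ^ n))
  have hδ : 0 < δ := lt_min (by linarith) (by positivity)
  have hδ2 : δ ≤ ε / 40 := min_le_left _ _
  have hδ3 : θ ^ n * (2 * δ) ≤ 1 := by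
    have : δ ≤ 1 / (2 * θ ^ n) := min_le_right _ _
    rw [le_div_iff₀ (by positivity)] at this
    linarith
  obtain ⟨h, K, c, hval, k1, k2, k3, k4, k5⟩ := stepB hP hf hf0 hf1 hB0 hae hδ (by linarith)
  obtain ⟨σ', hσ'⟩ := stepC hP hf hf0 hf1 (ε := ε / 4) (by linarith) hδ (by linarith) hθ hδ3 h0 h1 hA0 hv hB0 hN k1 k2 k3 k4 k5
  have hnθ : (n : ℝ) / θ = ε / 4 := by
    simp only [θ]; field_simp
  refine ⟨lastState h, shP h σ', fun i ρ => ?_⟩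
  have e1 := hσ' i (fun h' => ρ (lastState h, sf h h'))
  rw [transport hP _ h hval (hf i) (hsh i), transport hP σ' h hval (hf i) (hsh i)] at e1
  have e2 : P (initH G (lastState h)) (shP h (Function.update σ' i fun h' => ρ (lastState h, sf h h'))) =
      P (initH G (lastState h)) (Function.update (shP h σ') i ρ) := by
    refine P_congr hP _ fun j h' hx => ?_
    by_cases hj : j = i
    · subst hj
      simp only [shP, Function.update_self]
      have : h' = (lastState h, h'.2) := by rw [show lastState h = h'.1 from hx.1]
      simp only [sf, catH, List.drop_left]
      rw [← this]
    · simp only [shP]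
      rw [Function.update_of_ne hj, Function.update_of_ne hj]; rfl
  rw [e2] at e1
  rw [← hn, hnθ] at e1
  linarith

theorem main_thm
    (hfm : ∀ i, Measurable (G.payoff i))
    (hfb : ∀ i, ∃ C, ∀ r, |G.payoff i r| ≤ C)
    (hshift : ∀ i (r : G.Run), RunValid r → G.payoff i r = G.payoff i (shiftRun r))
    (ε : ℝ) (hε : 0 < ε) :
    ∃ s : G.S, ∃ σstar : G.Profile, ∀ (i : G.I) (σi : G.Strategy i),
      expPay P (initH G s) (Function.update σstar i σi) i - ε ≤ expPay P (initH G s) σstar i := by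
  choose Cf hCf using hfb
  obtain ⟨C, hC0, hC⟩ : ∃ C : ℝ, 0 < C ∧ ∀ i r, |G.payoff i r| ≤ C := by
    refine ⟨1 + ∑ i, |Cf i|, ?_, fun i r => ?_⟩
    · have : 0 ≤ ∑ i, |Cf i| := Finset.sum_nonneg fun i _ => abs_nonneg _
      linarith
    · have : |Cf i| ≤ ∑ i, |Cf i| := Finset.single_le_sum (f := fun i => |Cf i|) (fun i _ => abs_nonneg _) (Finset.mem_univ i)
      linarith [hCf i r, le_abs_self (Cf i)]
  have hIntg : ∀ h σ i, ∫ r, (G.payoff i r + C) / (2 * C) ∂(P h σ) = (expPay P h σ i + C) / (2 * C) := by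
    intro h σ i
    haveI := hP.1 h σ
    rw [integral_div, integral_add (P_integrable hP h σ (hfm i) (hC i)) (integrable_const _)]
    simp [expPay]
  obtain ⟨s, σ, hs⟩ := main01 hP (f := fun i r => (G.payoff i r + C) / (2 * C)) (fun i => ((hfm i).add_const C).div_const _)
    (fun i r => div_nonneg (by linarith [(abs_le.1 (hC i r)).1]) (by linarith))
    (fun i r => by rw [div_le_one (by linarith)]; linarith [(abs_le.1 (hC i r)).2])
    (fun i r hr => by rw [← hshift i r hr]) (ε := min 1 (ε / (2 * C))) (lt_min one_pos (by positivity)) (min_le_left _ _)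
  refine ⟨s, σ, fun i ρ => ?_⟩
  have := hs i ρ
  rw [hIntg, hIntg] at this
  have h2 : min 1 (ε / (2 * C)) ≤ ε / (2 * C) := min_le_right _ _
  have h3 : (expPay P (initH G s) (Function.update σ i ρ) i + C) / (2 * C) ≤ (expPay P (initH G s) σ i + C) / (2 * C) + ε / (2 * C) := by
    linarith
  rw [← add_div, div_le_div_iff_of_pos_right (by linarith)] at h3
  linarith

end StochGame
end

namespace StochGame

/-- **Theorem (easy initial states under shift-invariant payoffs).**
If each payoff function is bounded, Borel-measurable and shift-invariant, then for every
`ε > 0` there is an initial state `s` for which an `ε`-equilibrium exists. -/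
theorem exists_easy_initial_state (G : StochGame)
    (P : G.History → G.Profile → Measure G.Run) (hP : IsInducedFamily G P)
    (hfm : ∀ i, Measurable (G.payoff i))
    (hfb : ∀ i, ∃ C : ℝ, ∀ r : G.Run, |G.payoff i r| ≤ C)
    (hshift : ∀ (i : G.I) (r : G.Run), RunValid r → G.payoff i r = G.payoff i (shiftRun r))
    (ε : ℝ) (hε : 0 < ε) :
    ∃ s : G.S, ∃ σstar : G.Profile, ∀ (i : G.I) (σi : G.Strategy i),
      expPay P (G.initH s) (Function.update σstar i σi) i - ε
        ≤ expPay P (G.initH s) σstar i := by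
  exact main_thm hP hfm hfb hshift ε hε

end StochGame
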